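/- Assume (H1), (H2), the Oseledec hypothesis, and the second-space hypothesis. Then for μ-almost every z ∈ B^ℤ there exist a ∈ A and b, c ∈ B (which may depend on z) such that τ_z(a,b,c) = λ2 − λ1. -/

import Mathlib

open Filter MeasureTheory Matrix

noncomputable section

/-- The left shift on bi-infinite sequences: `(shift z) n = z (n+1)`. -/
def shift {l : ℕ} (z : ℤ → Fin l) : ℤ → Fin l := fun n => z (n + 1)

/-- The inverse shift: `(invShift z) n = z (n-1)`. -/
def invShift {l : ℕ} (z : ℤ → Fin l) : ℤ → Fin l := fun n => z (n - 1)

/-- The matrix `(L_z)_{i,j} = q(z_0 | j) * p(j | i)`, where `p i j = p(j|i)` and `q i m = q(m|i)`. -/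
def Lmat {k l : ℕ} (p : Matrix (Fin k) (Fin k) ℝ) (q : Matrix (Fin k) (Fin l) ℝ)
    (z : ℤ → Fin l) : Matrix (Fin k) (Fin k) ℝ :=
  Matrix.of fun i j => q j (z 0) * p i j

/-- `Lpow p q n z = L_{S^{-(n-1)}z} ⋯ L_{S^{-1}z} L_z` (and `= 1` for `n = 0`). -/
def Lpow {k l : ℕ} (p : Matrix (Fin k) (Fin k) ℝ) (q : Matrix (Fin k) (Fin l) ℝ) :
    ℕ → (ℤ → Fin l) → Matrix (Fin k) (Fin k) ℝ
  | 0, _ => 1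
  | n + 1, z => Lmat p q (invShift^[n] z) * Lpow p q n z

/-- Euclidean norm on `ℝ^k`. -/
def enorm2 {k : ℕ} (v : Fin k → ℝ) : ℝ := Real.sqrt (∑ i, v i ^ 2)

/-- The path sum `S^{[n]}_{a,b}(z)`; for `n = m+1 ≥ 1` the sum is over paths
`x : Fin (m+1) → Fin k`, where `x i` stands for `x_{-(n-i)}`. -/
def Spath {k l : ℕ} (p : Matrix (Fin k) (Fin k) ℝ) (q : Matrix (Fin k) (Fin l) ℝ)
    (piv : Fin k → ℝ) : ℕ → Fin k → Fin l → (ℤ → Fin l) → ℝ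
  | 0, _, _, _ => 0
  | m + 1, a, b, z =>
      ∑ x : Fin (m + 1) → Fin k,
        piv (x 0) * q (x 0) b * p (x (Fin.last m)) a *
          ∏ j : Fin m,
            q (x j.succ) (z (((j : ℕ) : ℤ) - (m : ℤ))) * p (x j.castSucc) (x j.succ)

/-- `Δ^{[n]}_{a,b,c}(z)`. -/
def Del {k l : ℕ} (p : Matrix (Fin k) (Fin k) ℝ) (q : Matrix (Fin k) (Fin l) ℝ)
    (piv : Fin k → ℝ) (n : ℕ) (a : Fin k) (b c : Fin l) (z : ℤ → Fin l) : ℝ :=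
  Spath p q piv n a b z / (∑ a' : Fin k, Spath p q piv n a' b z)
    - Spath p q piv n a c z / (∑ a' : Fin k, Spath p q piv n a' c z)

/-- `τ_z(a,b,c) = limsup_n (1/n) log |Δ^{[n]}_{a,b,c}(z)|`. -/
def tau {k l : ℕ} (p : Matrix (Fin k) (Fin k) ℝ) (q : Matrix (Fin k) (Fin l) ℝ)
    (piv : Fin k → ℝ) (z : ℤ → Fin l) (a : Fin k) (b c : Fin l) : ℝ :=
  Filter.limsup (fun n : ℕ => Real.log |Del p q piv n a b c z| / n) Filter.atTop

/-- `μ` is the law of the hidden Markov chain with transitions `p`, emissions `q`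
and initial (invariant) law `piv`: cylinder probabilities. -/
def IsHMMLaw {k l : ℕ} (p : Matrix (Fin k) (Fin k) ℝ) (q : Matrix (Fin k) (Fin l) ℝ)
    (piv : Fin k → ℝ) (μ : Measure (ℤ → Fin l)) : Prop :=
  ∀ (m : ℤ) (n : ℕ) (w : ℕ → Fin l),
    μ {z | ∀ t : ℕ, t ≤ n → z (m + t) = w t} =
      ENNReal.ofReal (∑ x : Fin (n + 1) → Fin k,
        piv (x 0) * q (x 0) (w 0) *
          ∏ j : Fin n, p (x j.castSucc) (x j.succ) * q (x j.succ) (w (j + 1)))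


set_option linter.all false

/-! ### Interpolation -/

lemma aux_poly_mem {V : Type*} [AddCommGroup V] [Module ℝ V] (M : Submodule ℝ V)
    (T : Module.End ℝ V) (hT : ∀ x ∈ M, T x ∈ M) (P : Polynomial ℝ) :
    ∀ x ∈ M, (Polynomial.aeval T P) x ∈ M := by
  induction P using Polynomial.induction_on' with
  | add a b ha hb =>
    intro x hx
    rw [map_add, LinearMap.add_apply]
    exact M.add_mem (ha x hx) (hb x hx)
  | monomial n a =>
    intro x hx
    rw [Polynomial.aeval_monomial]
    have : ∀ n, (T ^ n) x ∈ M := by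
      intro n
      induction n with
      | zero => simpa using hx
      | succ n ih => rw [pow_succ', Module.End.mul_apply]; exact hT _ ih
    rw [Module.End.mul_apply, Module.algebraMap_end_apply]
    exact M.smul_mem _ (this n)

/-- a submodule of functions invariant under multiplication by `w` is invariant under
multiplication by `g ∘ w` -/
lemma interp_mem {ι : Type*} [Fintype ι] (M : Submodule ℝ (ι → ℝ)) (w : ι → ℝ)
    (hM : ∀ x ∈ M, (fun i => w i * x i) ∈ M) (g : ℝ → ℝ) :
    ∀ x ∈ M, (fun i => g (w i) * x i) ∈ M := by
  classical
  intro x hx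
  let T : Module.End ℝ (ι → ℝ) := LinearMap.pi fun i => w i • LinearMap.proj i
  have hT : ∀ x ∈ M, T x ∈ M := fun x hx => hM x hx
  have key : ∀ (P : Polynomial ℝ) (x : ι → ℝ),
      Polynomial.aeval T P x = fun i => P.eval (w i) * x i := by
    intro P
    induction P using Polynomial.induction_on' with
    | add a b ha hb =>
      intro x
      rw [map_add, LinearMap.add_apply, ha, hb]
      funext i
      simp [add_mul]
    | monomial n a =>
      intro x
      rw [Polynomial.aeval_monomial]
      have : ∀ n, (T ^ n) x = fun i => w i ^ n * x i := by
        intro n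
        induction n with
        | zero => simp
        | succ n ih =>
          rw [pow_succ', Module.End.mul_apply, ih]
          funext i
          simp [T, pow_succ']; ring
      rw [Module.End.mul_apply, Module.algebraMap_end_apply, this]
      funext i
      simp [mul_assoc]
  let P := Lagrange.interpolate (Finset.univ.image w) id g
  have hP : ∀ i, P.eval (w i) = g (w i) := by
    intro i
    exact Lagrange.eval_interpolate_at_node (v := id) g (Set.injOn_id _)
      (Finset.mem_image_of_mem w (Finset.mem_univ i))
  have := aux_poly_mem M T hT P x hx
  rw [key] at this
  simpa only [hP] using this

section CharLemma
variable {n : Type*} [Fintype n] [DecidableEq n]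

/-- homogeneous of weight `α` with respect to `ad (diagonal h)` -/
def IsWt (h : n → ℝ) (α : ℝ) (X : Matrix n n ℝ) : Prop := ∀ i j, X i j ≠ 0 → h i - h j = α

/-- weight component -/
def wcomp (h : n → ℝ) (α : ℝ) (X : Matrix n n ℝ) : Matrix n n ℝ :=
  Matrix.of fun i j => (if h i - h j = α then 1 else 0) * X i j

lemma isWt_wcomp (h : n → ℝ) (α : ℝ) (X : Matrix n n ℝ) : IsWt h α (wcomp h α X) := by
  intro i j hij
  by_contra hne
  exact hij (by simp [wcomp, hne])

lemma wcomp_mem (M : Submodule ℝ (Matrix n n ℝ)) (h : n → ℝ)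
    (hM : ∀ X ∈ M, diagonal h * X - X * diagonal h ∈ M) (α : ℝ) (X : Matrix n n ℝ) (hX : X ∈ M) :
    wcomp h α X ∈ M := by
  let e : (n × n → ℝ) ≃ₗ[ℝ] Matrix n n ℝ :=
    (LinearEquiv.curry ℝ ℝ n n)
  have h1 := interp_mem (M.comap e.toLinearMap) (fun ij => h ij.1 - h ij.2) (by
    intro x hx
    have := hM _ (show e x ∈ M from hx)
    show e _ ∈ M
    convert this using 1
    ext i j
    rw [Matrix.sub_apply, Matrix.diagonal_mul, Matrix.mul_diagonal]
    change (h i - h j) * x (i, j) = h i * x (i, j) - x (i, j) * h j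
    ring) (fun t => if t = α then 1 else 0) (e.symm X) (by
      show e (e.symm X) ∈ M
      simpa using hX)
  exact h1

lemma sum_wcomp (h : n → ℝ) (X : Matrix n n ℝ) :
    X = ∑ α ∈ Finset.univ.image (fun ij : n × n => h ij.1 - h ij.2), wcomp h α X := by
  ext i j
  rw [Matrix.sum_apply]
  rw [Finset.sum_eq_single (h i - h j)]
  · simp [wcomp]
  · intro b _ hb
    simp [wcomp, hb.symm]
  · intro hn
    exact absurd (Finset.mem_image_of_mem (fun ij : n × n => h ij.1 - h ij.2)
      (Finset.mem_univ (i, j))) hn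

lemma IsWt.mul {h : n → ℝ} {α β : ℝ} {X Y : Matrix n n ℝ} (hX : IsWt h α X) (hY : IsWt h β Y) :
    IsWt h (α + β) (X * Y) := by
  intro i j hij
  rw [Matrix.mul_apply] at hij
  obtain ⟨l, -, hl⟩ := Finset.exists_ne_zero_of_sum_ne_zero hij
  have h1 := hX i l (left_ne_zero_of_mul hl)
  have h2 := hY l j (right_ne_zero_of_mul hl)
  linarith

lemma IsWt.sub {h : n → ℝ} {α : ℝ} {X Y : Matrix n n ℝ} (hX : IsWt h α X) (hY : IsWt h α Y) :
    IsWt h α (X - Y) := by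
  intro i j hij
  by_cases h1 : X i j = 0
  · apply hY i j
    intro h2
    exact hij (by simp [h1, h2])
  · exact hX i j h1

lemma IsWt.one (h : n → ℝ) : IsWt h 0 1 := by
  intro i j hij
  by_cases e : i = j
  · simp [e]
  · exact absurd (Matrix.one_apply_ne e) hij

lemma IsWt.pow {h : n → ℝ} {α : ℝ} {X : Matrix n n ℝ} (hX : IsWt h α X) (N : ℕ) :
    IsWt h (N * α) (X ^ N) := by
  induction N with
  | zero => simpa using IsWt.one h
  | succ N ih =>
    rw [pow_succ]
    have := ih.mul hX
    convert this using 1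
    push_cast; ring

lemma IsWt.nilp {h : n → ℝ} {α : ℝ} {X : Matrix n n ℝ} (hX : IsWt h α X) (hα : α ≠ 0) :
    ∃ N : ℕ, N ≠ 0 ∧ X ^ N = 0 := by
  obtain ⟨N, hN⟩ := exists_nat_gt ((∑ i, ∑ j, |h i - h j|) / |α|)
  have hpos : 0 < |α| := abs_pos.mpr hα
  refine ⟨N, ?_, ?_⟩
  · rintro rfl
    have : 0 ≤ (∑ i, ∑ j, |h i - h j|) / |α| := by positivity
    simp at hN
    linarith
  · ext i j
    by_contra hne
    have := hX.pow N i j hne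
    rw [div_lt_iff₀ hpos] at hN
    have h1 : |h i - h j| = N * |α| := by rw [this, abs_mul]; simp
    have h2 : |h i - h j| ≤ ∑ i, ∑ j, |h i - h j| := by
      calc |h i - h j| ≤ ∑ j, |h i - h j| :=
            Finset.single_le_sum (f := fun j => |h i - h j|) (fun _ _ => abs_nonneg _)
              (Finset.mem_univ j)
        _ ≤ _ := Finset.single_le_sum (f := fun i => ∑ j, |h i - h j|)
              (fun _ _ => Finset.sum_nonneg fun _ _ => abs_nonneg _) (Finset.mem_univ i)
    linarith

lemma IsWt.zero_diag {h : n → ℝ} (hinj : Function.Injective h) {X : Matrix n n ℝ}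
    (hX : IsWt h 0 X) : X = diagonal X.diag := by
  ext i j
  by_cases e : i = j
  · subst e; simp
  · rw [Matrix.diagonal_apply_ne _ e]
    by_contra hne
    exact e (hinj (by linarith [hX i j hne]))

/-- the radical of the trace form -/
def trRad (G : Submodule ℝ (Matrix n n ℝ)) : Submodule ℝ (Matrix n n ℝ) where
  carrier := {X | X ∈ G ∧ ∀ Y ∈ G, (X * Y).trace = 0}
  zero_mem' := ⟨G.zero_mem, by simp⟩
  add_mem' := by
    rintro a b ⟨ha, ha'⟩ ⟨hb, hb'⟩
    exact ⟨G.add_mem ha hb, fun Y hY => by rw [add_mul, trace_add, ha' Y hY, hb' Y hY, add_zero]⟩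
  smul_mem' := by
    rintro c a ⟨ha, ha'⟩
    exact ⟨G.smul_mem c ha, fun Y hY => by rw [smul_mul_assoc, trace_smul, ha' Y hY, smul_zero]⟩

lemma trRad_ideal (G : Submodule ℝ (Matrix n n ℝ)) (hbr : ∀ X ∈ G, ∀ Y ∈ G, X * Y - Y * X ∈ G)
    (Y : Matrix n n ℝ) (hY : Y ∈ G) (X : Matrix n n ℝ) (hX : X ∈ trRad G) :
    Y * X - X * Y ∈ trRad G := by
  refine ⟨hbr _ hY _ hX.1, fun Z hZ => ?_⟩
  have h1 := hX.2 _ (hbr Z hZ Y hY)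
  rw [mul_sub, trace_sub] at h1
  rw [sub_mul, trace_sub, mul_assoc Y X Z, Matrix.trace_mul_comm Y]
  rw [← mul_assoc] at h1
  rw [mul_assoc X Y Z]
  exact h1

lemma trRad_claim (G : Submodule ℝ (Matrix n n ℝ)) (hbr : ∀ X ∈ G, ∀ Y ∈ G, X * Y - Y * X ∈ G)
    (h : n → ℝ) (hinj : Function.Injective h) :
    ∀ (L : ℕ) (l₁ l₂ : List (ℝ × Matrix n n ℝ)) (_ : l₁.length + l₂.length = L)
      (_ : ∀ y ∈ l₁, y.2 ∈ G ∧ IsWt h y.1 y.2) (_ : ∀ y ∈ l₂, y.2 ∈ G ∧ IsWt h y.1 y.2)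
      (α : ℝ) (X : Matrix n n ℝ) (_ : X ∈ trRad G) (_ : IsWt h α X)
      (_ : (l₁.map Prod.fst).sum + α + (l₂.map Prod.fst).sum = 0),
      (l₁.map Prod.snd).prod * X * (l₂.map Prod.snd).prod = 0 := by
  have hzero : ∀ X : Matrix n n ℝ, X ∈ trRad G → IsWt h 0 X → X = 0 := by
    intro X hX hw
    have hd := hw.zero_diag hinj
    have h1 := hX.2 X hX.1
    rw [hd, diagonal_mul_diagonal, trace_diagonal] at h1
    rw [Finset.sum_eq_zero_iff_of_nonneg (fun i _ => mul_self_nonneg _)] at h1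
    rw [hd]
    ext i j
    by_cases e : i = j
    · subst e
      simpa using h1 i (Finset.mem_univ i)
    · simp [e]
  have hlw : ∀ l : List (ℝ × Matrix n n ℝ), (∀ y ∈ l, y.2 ∈ G ∧ IsWt h y.1 y.2) →
      IsWt h (l.map Prod.fst).sum (l.map Prod.snd).prod := by
    intro l hl
    induction l with
    | nil => simpa using IsWt.one h
    | cons y l ih =>
      simp only [List.map_cons, List.sum_cons, List.prod_cons]
      exact (hl y (by simp)).2.mul (ih fun z hz => hl z (by simp [hz]))
  intro L
  induction L with
  | zero =>
    intro l₁ l₂ hL h₁ h₂ α X hX hw hs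
    have e1 : l₁ = [] := List.eq_nil_of_length_eq_zero (by omega)
    have e2 : l₂ = [] := List.eq_nil_of_length_eq_zero (by omega)
    subst e1 e2
    have : α = 0 := by simpa using hs
    subst this
    simp [hzero X hX hw]
  | succ L ih =>
    -- moving X to the left
    have move : ∀ (l₁ l₂ : List (ℝ × Matrix n n ℝ)) (_ : l₁.length + l₂.length = L + 1)
      (_ : ∀ y ∈ l₁, y.2 ∈ G ∧ IsWt h y.1 y.2) (_ : ∀ y ∈ l₂, y.2 ∈ G ∧ IsWt h y.1 y.2)
      (α : ℝ) (X : Matrix n n ℝ) (_ : X ∈ trRad G) (_ : IsWt h α X)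
      (_ : (l₁.map Prod.fst).sum + α + (l₂.map Prod.fst).sum = 0),
      (l₁.map Prod.snd).prod * X * (l₂.map Prod.snd).prod =
        X * ((l₁ ++ l₂).map Prod.snd).prod := by
      intro l₁
      induction l₁ using List.reverseRecOn with
      | nil => intros; simp
      | append_singleton l y ihl =>
        intro l₂ hL h₁ h₂ α X hX hw hs
        have hy := h₁ y (by simp)
        have h₁' : ∀ y ∈ l, y.2 ∈ G ∧ IsWt h y.1 y.2 := fun z hz => h₁ z (by simp [hz])
        have h₂' : ∀ z ∈ y :: l₂, z.2 ∈ G ∧ IsWt h z.1 z.2 := by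
          intro z hz
          rcases List.mem_cons.mp hz with rfl | hz
          · exact hy
          · exact h₂ z hz
        have a1 := ihl (y :: l₂) (by simp at hL ⊢; omega) h₁' h₂' α X hX hw
          (by simp at hs ⊢; linarith)
        have a2 := ih l l₂ (by simp at hL; omega) h₁' h₂ (y.1 + α) (y.2 * X - X * y.2)
          (trRad_ideal G hbr _ hy.1 X hX)
          ((hy.2.mul hw).sub (by rw [add_comm]; exact hw.mul hy.2))
          (by simp at hs; linarith)
        rw [List.append_assoc, List.singleton_append, ← a1]
        simp only [List.map_append, List.prod_append, List.map_cons, List.map_nil, List.prod_cons,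
          List.prod_nil, mul_one]
        rw [mul_sub, sub_mul, sub_eq_zero] at a2
        simp only [mul_assoc] at a2 ⊢
        exact a2
    intro l₁ l₂ hL h₁ h₂ α X hX hw hs
    rw [move l₁ l₂ hL h₁ h₂ α X hX hw hs]
    set l := l₁ ++ l₂ with hl
    have hlG : ∀ y ∈ l, y.2 ∈ G ∧ IsWt h y.1 y.2 := by
      intro y hy
      rcases List.mem_append.mp hy with hy | hy
      · exact h₁ y hy
      · exact h₂ y hy
    have hsl : (l.map Prod.fst).sum = -α := by
      simp [hl] at hs ⊢; linarith
    have hcomm := move l [] (by simp [hl]; omega) hlG (by simp) α X hX hw (by simp [hsl])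
    simp only [List.map_nil, List.prod_nil, mul_one, List.append_nil] at hcomm
    set Q := (l.map Prod.snd).prod with hQ
    by_cases hα : α = 0
    · subst hα
      simp [hzero X hX hw]
    · obtain ⟨N, hN0, hN⟩ := hw.nilp hα
      have hT : IsWt h 0 (X * Q) := by
        have := hw.mul (hlw l hlG)
        rwa [hsl, add_neg_cancel] at this
      have hd := hT.zero_diag hinj
      have hpow : (X * Q) ^ N = 0 := by
        rw [(show Commute X Q from hcomm.symm).mul_pow, hN, zero_mul]
      rw [hd, Matrix.diagonal_pow] at hpow
      rw [hd]
      ext i j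
      by_cases e : i = j
      · subst e
        have := congrFun (congrFun hpow i) i
        simp [hN0] at this
        simpa using this
      · simp [e]

lemma trRad_eq_bot (G : Submodule ℝ (Matrix n n ℝ))
    (hbr : ∀ X ∈ G, ∀ Y ∈ G, X * Y - Y * X ∈ G)
    (h : n → ℝ) (hinj : Function.Injective h) (hd : diagonal h ∈ G)
    (hirr : ∀ B : Submodule ℝ (n → ℝ), (∀ X ∈ G, ∀ x ∈ B, X *ᵥ x ∈ B) → B = ⊥ ∨ B = ⊤)
    (X : Matrix n n ℝ) (hX : X ∈ trRad G) : X = 0 := by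
  by_contra hne
  obtain ⟨j, i, hji⟩ : ∃ j i, X j i ≠ 0 := by
    by_contra hall
    push Not at hall
    exact hne (by ext j i; simpa using hall j i)
  set X' := wcomp h (h j - h i) X with hX'
  have hX'm : X' ∈ trRad G := wcomp_mem (trRad G) h (fun Y hY => trRad_ideal G hbr _ hd Y hY) _ X hX
  have hX'w : IsWt h (h j - h i) X' := isWt_wcomp h _ X
  have hX'ji : X' j i ≠ 0 := by simpa [hX', wcomp] using hji
  have hlw : ∀ l : List (ℝ × Matrix n n ℝ), (∀ y ∈ l, y.2 ∈ G ∧ IsWt h y.1 y.2) →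
      IsWt h (l.map Prod.fst).sum (l.map Prod.snd).prod := by
    intro l hl
    induction l with
    | nil => simpa using IsWt.one h
    | cons y l ih =>
      simp only [List.map_cons, List.sum_cons, List.prod_cons]
      exact (hl y (by simp)).2.mul (ih fun z hz => hl z (by simp [hz]))
  let S : Set (n → ℝ) := {x | ∃ l : List (ℝ × Matrix n n ℝ),
    (∀ y ∈ l, y.2 ∈ G ∧ IsWt h y.1 y.2) ∧ x = (l.map Prod.snd).prod *ᵥ (Pi.single j 1)}
  have hB : Submodule.span ℝ S = ⊤ := by
    refine (hirr _ ?_).resolve_left ?_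
    · intro Y hY x hx
      induction hx using Submodule.span_induction with
      | mem x hx =>
        obtain ⟨l, hl, rfl⟩ := hx
        rw [sum_wcomp h Y, Matrix.sum_mulVec]
        refine Submodule.sum_mem _ fun α _ => ?_
        apply Submodule.subset_span
        refine ⟨(α, wcomp h α Y) :: l, ?_, ?_⟩
        · intro y hy
          rcases List.mem_cons.mp hy with rfl | hy
          · exact ⟨wcomp_mem G h (fun Z hZ => hbr _ hd Z hZ) α Y hY, isWt_wcomp h α Y⟩
          · exact hl y hy
        · simp only [List.map_cons, List.prod_cons, Matrix.mulVec_mulVec]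
      | zero => simp
      | add x y _ _ hx hy => rw [Matrix.mulVec_add]; exact Submodule.add_mem _ hx hy
      | smul c x _ hx => rw [Matrix.mulVec_smul]; exact Submodule.smul_mem _ _ hx
    · intro hbot
      have : (Pi.single j 1 : n → ℝ) ∈ Submodule.span ℝ S :=
        Submodule.subset_span ⟨[], by simp, by simp only [List.map_nil, List.prod_nil, Matrix.one_mulVec]⟩
      rw [hbot, Submodule.mem_bot] at this
      simpa using congrFun this j
  have : ∃ l : List (ℝ × Matrix n n ℝ), (∀ y ∈ l, y.2 ∈ G ∧ IsWt h y.1 y.2) ∧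
      (l.map Prod.snd).prod i j ≠ 0 := by
    by_contra hall
    push Not at hall
    have hle : Submodule.span ℝ S ≤ LinearMap.ker (LinearMap.proj i : (n → ℝ) →ₗ[ℝ] ℝ) := by
      rw [Submodule.span_le]
      rintro x ⟨l, hl, rfl⟩
      have := hall l hl
      simpa [Matrix.mulVec_single] using this
    rw [hB] at hle
    have := hle (Submodule.mem_top (x := (Pi.single i 1 : n → ℝ)))
    simp at this
  obtain ⟨l, hl, hlij⟩ := this
  have hw := hlw l hl i j hlij
  have h0 := trRad_claim G hbr h hinj _ l [] rfl hl (by simp) _ X' hX'm hX'w (by simp [← hw])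
  have h00 := congrFun (congrFun h0 i) i
  simp only [List.map_nil, List.prod_nil, mul_one] at h00
  rw [Matrix.mul_apply, Finset.sum_eq_single j] at h00
  · exact (mul_ne_zero hlij hX'ji) h00
  · intro m _ hm
    by_contra hc
    have := hX'w m i (right_ne_zero_of_mul hc)
    exact hm (hinj (by linarith))
  · simp

theorem char_lemma [Nonempty n] (G : Submodule ℝ (Matrix n n ℝ))
    (hbr : ∀ X ∈ G, ∀ Y ∈ G, X * Y - Y * X ∈ G) (h1 : (1 : Matrix n n ℝ) ∈ G)
    (h : n → ℝ) (hinj : Function.Injective h) (hd : diagonal h ∈ G)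
    (hirr : ∀ B : Submodule ℝ (n → ℝ), (∀ X ∈ G, ∀ x ∈ B, X *ᵥ x ∈ B) → B = ⊥ ∨ B = ⊤)
    (φ : Matrix n n ℝ →ₗ[ℝ] ℝ) (hφ : ∀ X ∈ G, ∀ Y ∈ G, φ (X * Y - Y * X) = 0) :
    ∀ Z ∈ G, φ Z = φ 1 / Fintype.card n * Z.trace := by
  let T : G →ₗ[ℝ] Module.Dual ℝ G :=
    LinearMap.mk₂ ℝ (fun X Y : G => ((X : Matrix n n ℝ) * (Y : Matrix n n ℝ)).trace)
      (by intros; simp [add_mul]) (by intros; simp)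
      (by intros; simp [mul_add]) (by intros; simp)
  have hTinj : Function.Injective T := by
    rw [← LinearMap.ker_eq_bot, LinearMap.ker_eq_bot']
    intro X hX
    have : (X : Matrix n n ℝ) ∈ trRad G := ⟨X.2, fun Y hY => by
      have := LinearMap.congr_fun hX ⟨Y, hY⟩
      simpa [T] using this⟩
    exact Subtype.ext (trRad_eq_bot G hbr h hinj hd hirr _ this)
  have hTsurj : Function.Surjective T :=
    (LinearMap.injective_iff_surjective_of_finrank_eq_finrank
      (Subspace.dual_finrank_eq).symm).mp hTinj
  obtain ⟨⟨Z0, hZ0⟩, hT⟩ := hTsurj (φ.comp G.subtype)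
  have hZφ : ∀ Y ∈ G, (Z0 * Y).trace = φ Y := by
    intro Y hY
    have := LinearMap.congr_fun hT ⟨Y, hY⟩
    simpa [T] using this
  have hcomm : ∀ X ∈ G, Z0 * X = X * Z0 := by
    intro X hX
    rw [← sub_eq_zero]
    apply trRad_eq_bot G hbr h hinj hd hirr
    refine ⟨hbr _ hZ0 _ hX, fun Y hY => ?_⟩
    have := hZφ _ (hbr _ hX _ hY)
    rw [hφ X hX Y hY, mul_sub, trace_sub] at this
    rw [sub_mul, trace_sub, mul_assoc, mul_assoc, Matrix.trace_mul_comm X, mul_assoc]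
    exact this
  have hdiag : ∀ i j, i ≠ j → Z0 i j = 0 := by
    intro i j hij
    have := congrFun (congrFun (hcomm _ hd) i) j
    rw [Matrix.mul_diagonal, Matrix.diagonal_mul] at this
    have hne : h i - h j ≠ 0 := sub_ne_zero.mpr (fun e => hij (hinj e))
    have : (h i - h j) * Z0 i j = 0 := by linarith
    exact (mul_eq_zero.mp this).resolve_left hne
  obtain ⟨i0⟩ := ‹Nonempty n›
  let B : Submodule ℝ (n → ℝ) := LinearMap.ker (Matrix.toLin' (Z0 - Z0 i0 i0 • 1))
  have hBm : ∀ x, x ∈ B ↔ Z0 *ᵥ x = Z0 i0 i0 • x := by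
    intro x
    simp [B, Matrix.sub_mulVec, sub_eq_zero]
  have hBtop : B = ⊤ := by
    refine (hirr B ?_).resolve_left ?_
    · intro X hX x hx
      rw [hBm] at hx ⊢
      rw [Matrix.mulVec_mulVec, hcomm X hX, ← Matrix.mulVec_mulVec, hx, Matrix.mulVec_smul]
    · intro hbot
      have : (Pi.single i0 1 : n → ℝ) ∈ B := by
        rw [hBm]
        ext j
        by_cases e : j = i0
        · subst e; simp
        · simp [e, hdiag j i0 e]
      rw [hbot, Submodule.mem_bot] at this
      simpa using congrFun this i0
  have hscal : ∀ i, Z0 i i = Z0 i0 i0 := by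
    intro i
    have : (Pi.single i 1 : n → ℝ) ∈ B := hBtop ▸ Submodule.mem_top
    rw [hBm] at this
    simpa using congrFun this i
  have hZ : Z0 = Z0 i0 i0 • 1 := by
    ext i j
    by_cases e : i = j
    · subst e; simp [hscal i]
    · simp [e, hdiag i j e]
  intro Y hY
  have e1 := hZφ Y hY
  have e2 := hZφ 1 h1
  rw [hZ] at e1 e2
  have hc : (Fintype.card n : ℝ) ≠ 0 := by
    have : 0 < Fintype.card n := Fintype.card_pos_iff.mpr ⟨i0⟩
    positivity
  simp at e1 e2
  rw [← e1, ← e2]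
  field_simp

end CharLemma

section Gap

/-- data for the abstract gap theorem -/
structure GapData (n I β : Type) [Fintype n] [DecidableEq n] [Fintype I] [DecidableEq I] where
  K : Matrix n n ℝ →* Matrix I I ℝ
  dK : Matrix n n ℝ →ₗ[ℝ] Matrix I I ℝ
  hbr : ∀ X Y, dK (X * Y - Y * X) = dK X * dK Y - dK Y * dK X
  hconj : ∀ X Y Z, X * Y = 1 → dK (X * Z * Y) = K X * dK Z * K Y
  hdiag : ∀ h : n → ℝ, ∃ η : I → ℝ, dK (diagonal h) = diagonal η ∧
    K (diagonal fun i => Real.exp (h i)) = diagonal fun i => Real.exp (η i)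
  N : ℝ
  h1 : dK 1 = N • 1
  A : β → Matrix n n ℝ
  A' : β → Matrix n n ℝ
  hAA : ∀ m, A m * A' m = 1
  h : β → β → n → ℝ
  hA : ∀ m m', A m * A' m' = diagonal fun i => Real.exp (h m m' i)
  hsep : ∀ i j, i ≠ j → ∃ m m', h m m' i ≠ h m m' j
  hirr : ∀ B : Submodule ℝ (n → ℝ), (∀ (s : List β) (m m' : β), ∀ x ∈ B,
    ((s.map A).prod * diagonal (h m m') * (s.map A').reverse.prod) *ᵥ x ∈ B) → B = ⊥ ∨ B = ⊤

namespace GapData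
variable {n I β : Type} [Fintype n] [DecidableEq n] [Fintype I] [DecidableEq I]
  (g : GapData n I β)

def wd (s : List β) : Matrix n n ℝ := (s.map g.A).prod
def wd' (s : List β) : Matrix n n ℝ := (s.map g.A').reverse.prod

lemma wd_mul (s : List β) : g.wd s * g.wd' s = 1 := by
  induction s with
  | nil => simp [wd, wd']
  | cons m s ih =>
    simp only [wd, wd', List.map_cons, List.prod_cons, List.reverse_cons, List.prod_append,
      List.prod_nil, mul_one] at ih ⊢
    rw [mul_assoc, ← mul_assoc _ _ (g.A' m), ih, one_mul, g.hAA]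

lemma wd'_mul (s : List β) : g.wd' s * g.wd s = 1 := mul_eq_one_comm.mp (g.wd_mul s)

def Zg (s : List β) (m m' : β) : Matrix n n ℝ := g.wd s * diagonal (g.h m m') * g.wd' s

def cg (m m' : β) : ℝ := g.N * (∑ i, g.h m m' i) / Fintype.card n

def F : Submodule ℝ (I → ℝ) where
  carrier := {v | ∀ s m m', g.dK (g.Zg s m m') *ᵥ v = g.cg m m' • v}
  zero_mem' := by intro s m m'; simp
  add_mem' := by
    intro a b ha hb s m m'
    rw [Matrix.mulVec_add, ha s m m', hb s m m', smul_add]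
  smul_mem' := by
    intro c a ha s m m'
    rw [Matrix.mulVec_smul, ha s m m', smul_comm]

lemma KA'A (m : β) : g.K (g.A' m) * g.K (g.A m) = 1 := by
  rw [← map_mul, mul_eq_one_comm.mp (g.hAA m), map_one]
lemma KAA' (m : β) : g.K (g.A m) * g.K (g.A' m) = 1 := by
  rw [← map_mul, g.hAA m, map_one]

lemma F_A' (m : β) (v : I → ℝ) (hv : v ∈ g.F) : g.K (g.A' m) *ᵥ v ∈ g.F := by
  intro s m₁ m₂
  have h1 := hv (m :: s) m₁ m₂
  have h2 : g.Zg (m :: s) m₁ m₂ = g.A m * g.Zg s m₁ m₂ * g.A' m := by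
    simp [Zg, wd, wd', mul_assoc]
  rw [h2, g.hconj _ _ _ (g.hAA m)] at h1
  have h3 : g.K (g.A' m) *ᵥ ((g.K (g.A m) * g.dK (g.Zg s m₁ m₂) * g.K (g.A' m)) *ᵥ v) =
      g.K (g.A' m) *ᵥ (g.cg m₁ m₂ • v) := by rw [h1]
  rw [Matrix.mulVec_mulVec, mul_assoc (g.K (g.A m)), ← mul_assoc, g.KA'A, one_mul,
    ← Matrix.mulVec_mulVec, Matrix.mulVec_smul] at h3
  exact h3

lemma F_A (m : β) (v : I → ℝ) (hv : v ∈ g.F) : g.K (g.A m) *ᵥ v ∈ g.F := by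
  let T : g.F →ₗ[ℝ] g.F := ((Matrix.toLin' (g.K (g.A' m))).domRestrict g.F).codRestrict g.F
    (fun x => by simpa using g.F_A' m x.1 x.2)
  have hT : ∀ x : g.F, ((T x : g.F) : I → ℝ) = g.K (g.A' m) *ᵥ (x : I → ℝ) := fun x => by simp [T]
  have hinj : Function.Injective T := by
    intro x y hxy
    have := congrArg (fun x : g.F => (x : I → ℝ)) hxy
    simp only [hT] at this
    have h2 := congrArg (fun x => g.K (g.A m) *ᵥ x) this
    simp only [Matrix.mulVec_mulVec, g.KAA', Matrix.one_mulVec] at h2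
    exact Subtype.ext h2
  obtain ⟨w, hw⟩ := (LinearMap.injective_iff_surjective.mp hinj) ⟨v, hv⟩
  have h3 := congrArg (fun x : g.F => (x : I → ℝ)) hw
  simp only [hT] at h3
  rw [← h3, Matrix.mulVec_mulVec, g.KAA', Matrix.one_mulVec]
  exact w.2

lemma F_wd (s : List β) (v : I → ℝ) (hv : v ∈ g.F) : g.K (g.wd s) *ᵥ v ∈ g.F := by
  induction s with
  | nil => simpa [wd] using hv
  | cons m s ih =>
    have : g.wd (m :: s) = g.A m * g.wd s := by simp [wd]
    rw [this, map_mul, ← Matrix.mulVec_mulVec]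
    exact g.F_A m _ ih

lemma F_wd' (s : List β) : ∀ (v : I → ℝ) (hv : v ∈ g.F), g.K (g.wd' s) *ᵥ v ∈ g.F := by
  induction s with
  | nil => intro v hv; simpa [wd'] using hv
  | cons m s ih =>
    intro v hv
    have : g.wd' (m :: s) = g.wd' s * g.A' m := by simp [wd']
    rw [this, map_mul, ← Matrix.mulVec_mulVec]
    exact ih _ (g.F_A' m v hv)

lemma dK_Zg (s : List β) (m m' : β) : g.dK (g.Zg s m m') =
    g.K (g.wd s) * g.dK (diagonal (g.h m m')) * g.K (g.wd' s) :=
  g.hconj _ _ _ (g.wd_mul s)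

lemma Kwd'wd (s : List β) : g.K (g.wd' s) * g.K (g.wd s) = 1 := by
  rw [← map_mul, g.wd'_mul, map_one]
lemma Kwdwd' (s : List β) : g.K (g.wd s) * g.K (g.wd' s) = 1 := by
  rw [← map_mul, g.wd_mul, map_one]

lemma exists_sep : ∃ h : n → ℝ, Function.Injective h ∧
    ∀ G : Submodule ℝ (Matrix n n ℝ), (∀ m m', diagonal (g.h m m') ∈ G) → diagonal h ∈ G := by
  classical
  let U : Submodule ℝ (n → ℝ) := Submodule.span ℝ {x | ∃ m m', x = g.h m m'}
  -- functionals
  let S := {ij : n × n // ij.1 ≠ ij.2}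
  let f : S → Module.Dual ℝ U := fun ij =>
    ((LinearMap.proj ij.1.1 : (n → ℝ) →ₗ[ℝ] ℝ) - LinearMap.proj ij.1.2).comp U.subtype
  have hf : ∀ ij : S, ∃ x : U, f ij x ≠ 0 := by
    rintro ⟨⟨i, j⟩, hij⟩
    obtain ⟨m, m', hm⟩ := g.hsep i j hij
    refine ⟨⟨g.h m m', Submodule.subset_span ⟨m, m', rfl⟩⟩, ?_⟩
    simpa [f, sub_eq_zero] using hm
  obtain ⟨x, hx⟩ := Module.Dual.exists_forall_ne_zero_of_forall_exists f hf
  refine ⟨x, ?_, ?_⟩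
  · intro i j hij
    by_contra hne
    apply hx ⟨(i, j), hne⟩
    simp [f, hij]
  · intro G hG
    have : U ≤ G.comap (Matrix.diagonalLinearMap n ℝ ℝ) := by
      rw [Submodule.span_le]
      rintro y ⟨m, m', rfl⟩
      exact hG m m'
    exact this x.2

/-- no fixed line modulo `F` -/
theorem no_fixed_line [Nonempty n] (v : I → ℝ) (hv : v ∉ g.F)
    (hfix : ∀ s m m', ∃ c : ℝ, g.dK (g.Zg s m m') *ᵥ v - c • v ∈ g.F) : False := by
  let G : Submodule ℝ (Matrix n n ℝ) :=
    { carrier := {Z | (∀ f ∈ g.F, g.dK Z *ᵥ f ∈ g.F) ∧ ∃ c : ℝ, g.dK Z *ᵥ v - c • v ∈ g.F}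
      zero_mem' := ⟨by simp, 0, by simp⟩
      add_mem' := by
        rintro X Y ⟨hX, c, hc⟩ ⟨hY, d, hd⟩
        refine ⟨fun f hf => ?_, c + d, ?_⟩
        · rw [map_add, Matrix.add_mulVec]; exact g.F.add_mem (hX f hf) (hY f hf)
        · rw [map_add, Matrix.add_mulVec]
          convert g.F.add_mem hc hd using 1
          rw [add_smul]; abel
      smul_mem' := by
        rintro a X ⟨hX, c, hc⟩
        refine ⟨fun f hf => ?_, a * c, ?_⟩
        · rw [map_smul, Matrix.smul_mulVec]; exact g.F.smul_mem _ (hX f hf)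
        · rw [map_smul, Matrix.smul_mulVec]
          convert g.F.smul_mem a hc using 1
          rw [smul_sub, smul_smul] }
  have huniq : ∀ (Z : Matrix n n ℝ) (c d : ℝ), g.dK Z *ᵥ v - c • v ∈ g.F →
      g.dK Z *ᵥ v - d • v ∈ g.F → c = d := by
    intro Z c d hc hd
    by_contra hne
    have h1 := g.F.sub_mem hd hc
    have h2 : g.dK Z *ᵥ v - d • v - (g.dK Z *ᵥ v - c • v) = (c - d) • v := by
      rw [sub_smul]; abel
    rw [h2] at h1
    exact hv ((g.F.smul_mem_iff (sub_ne_zero.mpr hne)).mp h1)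
  have hex : ∀ Z : G, ∃ c : ℝ, g.dK Z *ᵥ v - c • v ∈ g.F := fun Z => Z.2.2
  choose c hc using hex
  let φ0 : G →ₗ[ℝ] ℝ :=
    { toFun := c
      map_add' := by
        intro X Y
        apply huniq _ _ _ (hc (X + Y))
        rw [Submodule.coe_add, map_add, Matrix.add_mulVec]
        convert g.F.add_mem (hc X) (hc Y) using 1
        rw [add_smul]; abel
      map_smul' := by
        intro a X
        apply huniq _ _ _ (hc (a • X))
        rw [Submodule.coe_smul, map_smul, Matrix.smul_mulVec]
        convert g.F.smul_mem a (hc X) using 1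
        simp [smul_sub, smul_smul] }
  obtain ⟨φ, hφ⟩ := LinearMap.exists_extend φ0
  have hφc : ∀ Z (hZ : Z ∈ G), φ Z = c ⟨Z, hZ⟩ := by
    intro Z hZ
    exact LinearMap.congr_fun hφ ⟨Z, hZ⟩
  have hbrv : ∀ X ∈ G, ∀ Y ∈ G, g.dK (X * Y - Y * X) *ᵥ v - (0 : ℝ) • v ∈ g.F := by
    rintro X ⟨hX, a, ha⟩ Y ⟨hY, b, hb⟩
    rw [g.hbr, Matrix.sub_mulVec, ← Matrix.mulVec_mulVec, ← Matrix.mulVec_mulVec]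
    have e1 := hX _ hb
    have e2 := hY _ ha
    rw [Matrix.mulVec_sub, Matrix.mulVec_smul] at e1 e2
    have e3 := g.F.sub_mem (g.F.add_mem e1 (g.F.smul_mem b ha))
      (g.F.add_mem e2 (g.F.smul_mem a hb))
    convert e3 using 1
    rw [smul_sub, smul_sub, smul_smul, smul_smul, mul_comm a b, zero_smul]
    abel
  have hbrG : ∀ X ∈ G, ∀ Y ∈ G, X * Y - Y * X ∈ G := by
    intro X hX Y hY
    refine ⟨fun f hf => ?_, 0, hbrv X hX Y hY⟩
    rw [g.hbr, Matrix.sub_mulVec, ← Matrix.mulVec_mulVec, ← Matrix.mulVec_mulVec]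
    exact g.F.sub_mem (hX.1 _ (hY.1 _ hf)) (hY.1 _ (hX.1 _ hf))
  have h1G : (1 : Matrix n n ℝ) ∈ G := by
    refine ⟨fun f hf => ?_, g.N, ?_⟩
    · rw [g.h1, Matrix.smul_mulVec, Matrix.one_mulVec]; exact g.F.smul_mem _ hf
    · rw [g.h1, Matrix.smul_mulVec, Matrix.one_mulVec, sub_self]; exact g.F.zero_mem
  have hgenG : ∀ s m m', g.Zg s m m' ∈ G := by
    intro s m m'
    refine ⟨fun f hf => ?_, hfix s m m'⟩
    rw [hf s m m']; exact g.F.smul_mem _ hf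
  obtain ⟨h, hinj, hh⟩ := g.exists_sep
  have hchar := char_lemma G hbrG h1G h hinj
    (hh G fun m m' => by simpa [Zg, wd, wd'] using hgenG [] m m')
    (fun B hB => g.hirr B fun s m m' x hx => hB _ (hgenG s m m') x hx) φ
    (fun X hX Y hY => by
      rw [hφc _ (hbrG X hX Y hY)]
      exact huniq _ _ _ (hc _) (hbrv X hX Y hY))
  have hφ1 : φ 1 = g.N := by
    rw [hφc 1 h1G]
    apply huniq _ _ _ (hc _)
    show g.dK 1 *ᵥ v - _ ∈ _
    rw [g.h1, Matrix.smul_mulVec, Matrix.one_mulVec, sub_self]; exact g.F.zero_mem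
  apply hv
  intro s m m'
  have hφZ : φ (g.Zg s m m') = g.cg m m' := by
    rw [hchar _ (hgenG s m m'), hφ1, cg, Zg, mul_assoc, Matrix.trace_mul_comm, mul_assoc,
      g.wd'_mul, mul_one, trace_diagonal]
    ring
  have hcv := hc ⟨_, hgenG s m m'⟩
  rw [← hφc _ (hgenG s m m'), hφZ] at hcv
  simp only at hcv
  have h2 := hcv s m m'
  set cc := g.cg m m'
  obtain ⟨η, hη, -⟩ := g.hdiag (g.h m m')
  rw [g.dK_Zg, hη] at h2 ⊢
  obtain ⟨w, hvw⟩ : ∃ w, v = g.K (g.wd s) *ᵥ w :=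
    ⟨g.K (g.wd' s) *ᵥ v, by rw [Matrix.mulVec_mulVec, g.Kwdwd', Matrix.one_mulVec]⟩
  have hinjK : ∀ x y, g.K (g.wd s) *ᵥ x = g.K (g.wd s) *ᵥ y → x = y := by
    intro x y hxy
    have := congrArg (fun x => g.K (g.wd' s) *ᵥ x) hxy
    simpa only [Matrix.mulVec_mulVec, g.Kwd'wd, Matrix.one_mulVec] using this
  have key : ∀ x, (g.K (g.wd s) * diagonal η * g.K (g.wd' s)) *ᵥ (g.K (g.wd s) *ᵥ x) =
      g.K (g.wd s) *ᵥ (diagonal η *ᵥ x) := by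
    intro x
    rw [Matrix.mulVec_mulVec, mul_assoc, g.Kwd'wd, mul_one, Matrix.mulVec_mulVec]
  rw [hvw] at h2 ⊢
  rw [key] at h2 ⊢
  rw [← Matrix.mulVec_smul, ← Matrix.mulVec_sub, key, ← Matrix.mulVec_smul] at h2
  have h3 := hinjK _ _ h2
  rw [← Matrix.mulVec_smul]
  congr 1
  ext i
  have h4 := congrFun h3 i
  simp only [Matrix.mulVec_diagonal, Pi.sub_apply, Pi.smul_apply, smul_eq_mul] at h4 ⊢
  have : (η i * w i - cc * w i) ^ 2 = 0 := by
    have : (η i * w i - cc * w i) ^ 2 =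
      w i * (η i * (η i * w i - cc * w i) - cc * (η i * w i - cc * w i)) := by ring
    rw [this, h4]; ring
  have := pow_eq_zero_iff (two_ne_zero) |>.mp this
  linarith

end GapData
end Gap

section Gap2

lemma exists_proj {I : Type} [Fintype I] (F : Submodule ℝ (I → ℝ)) :
    ∃ P : (I → ℝ) →ₗ[ℝ] (I → ℝ), (∀ x, P x = 0 ↔ x ∈ F) ∧ (∀ x, x - P x ∈ F) ∧
      (∀ x, ∀ f ∈ F, ∑ i, P x i * f i = 0) := by
  let e : EuclideanSpace ℝ I ≃ₗ[ℝ] (I → ℝ) := WithLp.linearEquiv 2 ℝ (I → ℝ)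
  let F' : Submodule ℝ (EuclideanSpace ℝ I) := F.comap e.toLinearMap
  have hF' : ∀ x, x ∈ F' ↔ e x ∈ F := fun x => Iff.rfl
  let P : (I → ℝ) →ₗ[ℝ] (I → ℝ) :=
    e.toLinearMap ∘ₗ (F'ᗮ.starProjection : EuclideanSpace ℝ I →ₗ[ℝ] EuclideanSpace ℝ I) ∘ₗ
      e.symm.toLinearMap
  have hP : ∀ x, P x = e (F'ᗮ.starProjection (e.symm x)) := fun x => rfl
  have h2 : ∀ x, x - P x ∈ F := by
    intro x
    have h := Submodule.sub_starProjection_mem_orthogonal (K := F'ᗮ) (e.symm x)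
    rw [Submodule.orthogonal_orthogonal, hF', map_sub, LinearEquiv.apply_symm_apply] at h
    exact h
  refine ⟨P, ?_, h2, ?_⟩
  · intro x
    constructor
    · intro h
      have := h2 x
      rwa [h, sub_zero] at this
    · intro h
      rw [hP]
      have : F'ᗮ.starProjection (e.symm x) = 0 := by
        rw [Submodule.starProjection_apply_eq_zero_iff, Submodule.orthogonal_orthogonal, hF']
        simpa using h
      rw [this, map_zero]
  · intro x f hf
    have h := Submodule.starProjection_apply_mem F'ᗮ (e.symm x)
    rw [Submodule.mem_orthogonal] at h
    have h3 := h (e.symm f) (by rw [hF']; simpa using hf)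
    rw [PiLp.inner_apply] at h3
    rw [← h3]
    refine Finset.sum_congr rfl fun i _ => ?_
    simp [hP, e]

/-- Rayleigh quotient increment -/
def Ginc {I : Type} [Fintype I] (τ : I → ℝ) (y : I → ℝ) : ℝ :=
  (∑ i, (τ i * (τ i * y i)) ^ 2) / (∑ i, (τ i * y i) ^ 2) -
    (∑ i, (τ i * y i) ^ 2) / (∑ i, y i ^ 2)

lemma sumsq_pos {I : Type} [Fintype I] {y : I → ℝ} (hy : y ≠ 0) : 0 < ∑ i, y i ^ 2 := by
  obtain ⟨i, hi⟩ := Function.ne_iff.mp hy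
  exact Finset.sum_pos' (fun _ _ => sq_nonneg _) ⟨i, Finset.mem_univ i, by
    have : y i ≠ 0 := hi
    positivity⟩

lemma Ginc_eq {I : Type} [Fintype I] (τ : I → ℝ) (hτ : ∀ i, 0 < τ i) (y : I → ℝ) (hy : y ≠ 0) :
    ∃ r, Ginc τ y = (∑ i, (y i * (τ i ^ 2 - r)) ^ 2) / (∑ i, (τ i * y i) ^ 2) ∧
      0 < ∑ i, (τ i * y i) ^ 2 ∧ 0 < r := by
  have h0 := sumsq_pos hy
  have h1 : 0 < ∑ i, (τ i * y i) ^ 2 := by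
    apply sumsq_pos (y := fun i => τ i * y i)
    intro h
    apply hy
    funext i
    have := congrFun h i
    simpa [(hτ i).ne'] using this
  refine ⟨(∑ i, (τ i * y i) ^ 2) / (∑ i, y i ^ 2), ?_, h1, by positivity⟩
  set a0 := ∑ i, y i ^ 2
  set a1 := ∑ i, (τ i * y i) ^ 2
  have : ∑ i, (y i * (τ i ^ 2 - a1 / a0)) ^ 2 =
      (∑ i, (τ i * (τ i * y i)) ^ 2) - 2 * (a1 / a0) * a1 + (a1 / a0) ^ 2 * a0 := by
    simp only [a0, a1]
    rw [Finset.mul_sum (s := Finset.univ) (f := fun i => (τ i * y i) ^ 2),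
      Finset.mul_sum (s := Finset.univ) (f := fun i => y i ^ 2), ← Finset.sum_sub_distrib,
      ← Finset.sum_add_distrib]
    refine Finset.sum_congr rfl fun i _ => ?_
    ring
  rw [this, Ginc]
  change (∑ i, (τ i * (τ i * y i)) ^ 2) / a1 - a1 / a0 = _
  generalize (∑ i, (τ i * (τ i * y i)) ^ 2) = a2
  clear_value a0 a1
  field_simp
  ring

lemma Ginc_nonneg {I : Type} [Fintype I] (τ : I → ℝ) (hτ : ∀ i, 0 < τ i) (y : I → ℝ)
    (hy : y ≠ 0) : 0 ≤ Ginc τ y := by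
  obtain ⟨r, hr, h, -⟩ := Ginc_eq τ hτ y hy
  rw [hr]
  positivity

lemma Ginc_zero {I : Type} [Fintype I] (η : I → ℝ) (y : I → ℝ)
    (hy : y ≠ 0) (h0 : Ginc (fun i => Real.exp (η i)) y = 0) : ∃ c, ∀ i, η i * y i = c * y i := by
  obtain ⟨r, hr, h, hr0⟩ := Ginc_eq _ (fun i => Real.exp_pos (η i)) y hy
  rw [hr, div_eq_zero_iff] at h0
  have h0 := h0.resolve_right h.ne'
  rw [Finset.sum_eq_zero_iff_of_nonneg (fun i _ => sq_nonneg _)] at h0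
  refine ⟨Real.log r / 2, fun i => ?_⟩
  have h2 := h0 i (Finset.mem_univ i)
  rw [pow_eq_zero_iff two_ne_zero, mul_eq_zero] at h2
  rcases h2 with h2 | h2
  · simp [h2]
  · have : r = Real.exp (2 * η i) := by
      rw [two_mul, Real.exp_add]; linarith [h2]
    rw [this, Real.log_exp]; ring

namespace GapData
variable {n I β : Type} [Fintype n] [DecidableEq n] [Fintype I] [DecidableEq I]
  (g : GapData n I β)

theorem gap [Nonempty n] [Nonempty β] : ∃ (T : Finset (List β × β × β))
    (ψ : List β × β × β → (I → ℝ) → ℝ) (ε : ℝ), 0 < ε ∧ (∀ t, ∃ C, ∀ v, |ψ t v| ≤ C) ∧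
    (∀ t (c : ℝ) v, c ≠ 0 → ψ t (c • v) = ψ t v) ∧
    ∀ v, v ∉ g.F → ε ≤ ∑ t ∈ T,
      (ψ t (g.K (g.wd t.1 * (g.A t.2.1 * g.A' t.2.2) * g.wd' t.1) *ᵥ v) - ψ t v) := by
  classical
  obtain ⟨P, hP0, hP1, hP2⟩ := exists_proj g.F
  choose η hη hη' using fun m m' => g.hdiag (g.h m m')
  have hPF : ∀ y, (∀ f ∈ g.F, ∑ i, y i * f i = 0) → P y = y := by
    intro y hy
    have h1 := hP1 y
    have h2 : ∑ i, (y i - P y i) * (y i - P y i) = 0 := by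
      have e1 := hy _ h1
      have e2 := hP2 y _ h1
      simp only [Pi.sub_apply] at e1 e2
      rw [← sub_eq_zero.mpr (e1.trans e2.symm), ← Finset.sum_sub_distrib]
      refine Finset.sum_congr rfl fun i _ => ?_
      ring
    rw [Finset.sum_eq_zero_iff_of_nonneg (fun i _ => mul_self_nonneg _)] at h2
    funext i
    have := mul_self_eq_zero.mp (h2 i (Finset.mem_univ i))
    linarith
  have hηF : ∀ m m', ∀ f ∈ g.F, ∀ i, η m m' i * f i = g.cg m m' * f i := by
    intro m m' f hf i
    have h1 := hf [] m m'
    have h2 : g.Zg [] m m' = diagonal (g.h m m') := by simp [Zg, wd, wd']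
    rw [h2, hη] at h1
    simpa [Matrix.mulVec_diagonal] using congrFun h1 i
  -- P commutes with multiplication by functions of η
  have hcomm : ∀ m m' (a : ℝ → ℝ) (x : I → ℝ) ,
      P (fun i => a (η m m' i) * x i) = fun i => a (η m m' i) * P x i := by
    intro m m' a x
    have hF : ∀ f ∈ g.F, (fun i => a (η m m' i) * f i) = a (g.cg m m') • f := by
      intro f hf
      funext i
      by_cases h : f i = 0
      · simp [h]
      · have := mul_right_cancel₀ h (hηF m m' f hf i)
        simp [this]
    have e1 : P (fun i => a (η m m' i) * (x i - P x i)) = 0 := by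
      rw [hP0]
      have := hF _ (hP1 x)
      simp only [Pi.sub_apply] at this
      rw [this]
      exact g.F.smul_mem _ (hP1 x)
    have e2 : P (fun i => a (η m m' i) * P x i) = fun i => a (η m m' i) * P x i := by
      apply hPF
      intro f hf
      have h3 := hP2 x _ (g.F.smul_mem (a (g.cg m m')) hf)
      rw [← hF f hf] at h3
      rw [← h3]
      refine Finset.sum_congr rfl fun i _ => ?_
      ring
    have e3 : (fun i => a (η m m' i) * x i) =
      (fun i => a (η m m' i) * (x i - P x i)) + (fun i => a (η m m' i) * P x i) := by
      funext i; simp; ring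
    rw [e3, map_add, e1, e2, zero_add]
  let τ : β → β → I → ℝ := fun m m' i => Real.exp (η m m' i)
  have hτ : ∀ m m' i, 0 < τ m m' i := fun m m' i => Real.exp_pos _
  let Y : List β → (I → ℝ) → (I → ℝ) := fun s v => P (g.K (g.wd' s) *ᵥ v)
  have hYne : ∀ s v, v ∉ g.F → Y s v ≠ 0 := by
    intro s v hv h0
    rw [hP0] at h0
    apply hv
    have := g.F_wd s _ h0
    rwa [Matrix.mulVec_mulVec, g.Kwdwd', Matrix.one_mulVec] at this
  let ψ : List β × β × β → (I → ℝ) → ℝ := fun t v =>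
    (∑ i, (τ t.2.1 t.2.2 i * Y t.1 v i) ^ 2) / (∑ i, Y t.1 v i ^ 2)
  have hinc : ∀ t v, ψ t (g.K (g.wd t.1 * (g.A t.2.1 * g.A' t.2.2) * g.wd' t.1) *ᵥ v) - ψ t v =
      Ginc (τ t.2.1 t.2.2) (Y t.1 v) := by
    rintro ⟨s, m, m'⟩ v
    have : Y s (g.K (g.wd s * (g.A m * g.A' m') * g.wd' s) *ᵥ v) =
        fun i => τ m m' i * Y s v i := by
      simp only [Y, τ]
      rw [← hcomm m m' Real.exp, Matrix.mulVec_mulVec, map_mul, map_mul, ← mul_assoc, ← mul_assoc,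
        g.Kwd'wd, one_mul, g.hA, hη', ← Matrix.mulVec_mulVec]
      congr 1
      funext i
      rw [Matrix.mulVec_diagonal]
    simp only [ψ, this, Ginc]
  -- positivity somewhere
  have hpos : ∀ v, v ∉ g.F → ∃ t : List β × β × β, 0 < Ginc (τ t.2.1 t.2.2) (Y t.1 v) := by
    intro v hv
    by_contra hall
    push Not at hall
    apply g.no_fixed_line v hv
    intro s m m'
    have h1 := le_antisymm (hall (s, m, m')) (Ginc_nonneg _ (hτ m m') _ (hYne s v hv))
    obtain ⟨c, hc⟩ := Ginc_zero (η m m') _ (hYne s v hv) h1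
    refine ⟨c, ?_⟩
    set w := g.K (g.wd' s) *ᵥ v with hw
    have hvw : v = g.K (g.wd s) *ᵥ w := by
      rw [hw, Matrix.mulVec_mulVec, g.Kwdwd', Matrix.one_mulVec]
    have h2 : diagonal (η m m') *ᵥ w - c • w ∈ g.F := by
      rw [← hP0, map_sub, map_smul]
      have e1 : diagonal (η m m') *ᵥ w = fun i => id (η m m' i) * w i := by
        funext i; simp [Matrix.mulVec_diagonal]
      rw [e1, hcomm m m' id w]
      funext i
      have := hc i
      simp only [Y, ← hw] at this
      simp [this]
    have h3 := g.F_wd s _ h2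
    rw [Matrix.mulVec_sub, Matrix.mulVec_smul, ← hvw] at h3
    rwa [g.dK_Zg, hη, ← Matrix.mulVec_mulVec, ← Matrix.mulVec_mulVec]
  -- compactness
  let S : Set (I → ℝ) := {y | P y = y ∧ ∑ i, y i ^ 2 = 1}
  have hPcont : Continuous P := LinearMap.continuous_of_finiteDimensional P
  have hScl : IsClosed S :=
    (isClosed_eq hPcont continuous_id).inter (isClosed_eq (by fun_prop) continuous_const)
  have hSb : S ⊆ Metric.closedBall 0 1 := by
    intro y hy
    rw [mem_closedBall_zero_iff, pi_norm_le_iff_of_nonneg zero_le_one]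
    intro i
    have : y i ^ 2 ≤ 1 := by
      rw [← hy.2]
      exact Finset.single_le_sum (f := fun i => y i ^ 2) (fun _ _ => sq_nonneg _)
        (Finset.mem_univ i)
    rw [Real.norm_eq_abs, abs_le_one_iff_mul_self_le_one]
    nlinarith
  have hSc : IsCompact S := (isCompact_closedBall _ _).of_isClosed_subset hScl hSb
  have hSF : ∀ y ∈ S, y ∉ g.F := by
    intro y hy hF
    rw [← hP0, hy.1] at hF
    have := hy.2
    simp [hF] at this
  have hYcont : ∀ s, Continuous (Y s) := fun s =>
    hPcont.comp (LinearMap.continuous_of_finiteDimensional (Matrix.toLin' (g.K (g.wd' s))))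
  have hGcont : ∀ t : List β × β × β, ContinuousOn (fun v => Ginc (τ t.2.1 t.2.2) (Y t.1 v)) S := by
    intro t
    have hYi : ∀ i, Continuous fun v => Y t.1 v i := fun i => (continuous_apply i).comp (hYcont t.1)
    unfold Ginc
    refine ContinuousOn.sub (ContinuousOn.div (by fun_prop) (by fun_prop) ?_)
      (ContinuousOn.div (by fun_prop) (by fun_prop) ?_)
    · intro y hy
      obtain ⟨r, -, h, -⟩ := Ginc_eq _ (hτ t.2.1 t.2.2) _ (hYne t.1 y (hSF y hy))
      exact h.ne'
    · intro y hy
      exact (sumsq_pos (hYne t.1 y (hSF y hy))).ne'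
  have hex : ∃ (T : Finset (List β × β × β)) (ε : ℝ), 0 < ε ∧ ∀ y ∈ S,
      ε ≤ ∑ t ∈ T, Ginc (τ t.2.1 t.2.2) (Y t.1 y) := by
    choose! t ht using hpos
    obtain ⟨T0, hT0, hcov⟩ := hSc.elim_nhdsWithin_subcover
      (fun y => {x | 0 < Ginc (τ (t y).2.1 (t y).2.2) (Y (t y).1 x)})
      (fun y hy => (hGcont (t y) y hy).eventually (lt_mem_nhds (ht y (hSF y hy))))
    let T := T0.image t
    have hTpos : ∀ y ∈ S, 0 < ∑ t ∈ T, Ginc (τ t.2.1 t.2.2) (Y t.1 y) := by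
      intro y hy
      have := hcov hy
      simp only [Set.mem_iUnion] at this
      obtain ⟨x, hx, hxy⟩ := this
      exact Finset.sum_pos' (fun t _ => Ginc_nonneg _ (hτ _ _) _ (hYne t.1 y (hSF y hy)))
        ⟨t x, Finset.mem_image_of_mem t hx, hxy⟩
    rcases S.eq_empty_or_nonempty with hS | hS
    · exact ⟨T, 1, one_pos, fun y hy => by rw [hS] at hy; exact absurd hy (Set.notMem_empty y)⟩
    · obtain ⟨y0, hy0, hmin⟩ := hSc.exists_isMinOn hS
        (continuousOn_finset_sum T fun t _ => hGcont t)
      exact ⟨T, _, hTpos y0 hy0, fun y hy => hmin hy⟩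
  obtain ⟨T, ε, hε, hT⟩ := hex
  refine ⟨T, ψ, ε, hε, ?_, ?_, ?_⟩
  · rintro ⟨s, m, m'⟩
    refine ⟨∑ i, τ m m' i ^ 2, fun v => ?_⟩
    have hnn : 0 ≤ ψ (s, m, m') v := by simp only [ψ]; positivity
    rw [abs_of_nonneg hnn]
    simp only [ψ]
    apply div_le_of_le_mul₀ (by positivity) (by positivity)
    rw [Finset.mul_sum]
    refine Finset.sum_le_sum fun i _ => ?_
    rw [mul_pow]
    refine mul_le_mul_of_nonneg_right ?_ (sq_nonneg _)
    exact Finset.single_le_sum (f := fun i => τ m m' i ^ 2) (fun _ _ => sq_nonneg _)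
        (Finset.mem_univ i)
  · rintro ⟨s, m, m'⟩ c v hc
    have : Y s (c • v) = c • Y s v := by simp [Y, Matrix.mulVec_smul]
    simp only [ψ, this, Pi.smul_apply, smul_eq_mul]
    have e1 : ∑ i, (τ m m' i * (c * Y s v i)) ^ 2 = c ^ 2 * ∑ i, (τ m m' i * Y s v i) ^ 2 := by
      rw [Finset.mul_sum]; exact Finset.sum_congr rfl fun i _ => by ring
    have e2 : ∑ i, (c * Y s v i) ^ 2 = c ^ 2 * ∑ i, (Y s v i) ^ 2 := by
      rw [Finset.mul_sum]; exact Finset.sum_congr rfl fun i _ => by ring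
    rw [e1, e2, mul_div_mul_left _ _ (by positivity)]
  · intro v hv
    simp only [hinc]
    have hPv : P v ≠ 0 := fun h => hv ((hP0 v).mp h)
    have hs := sumsq_pos hPv
    set a := (Real.sqrt (∑ i, P v i ^ 2))⁻¹ with ha
    have ha2 : a ^ 2 * ∑ i, P v i ^ 2 = 1 := by
      rw [ha, inv_pow, Real.sq_sqrt hs.le, inv_mul_cancel₀ hs.ne']
    have ha0 : a ≠ 0 := by
      intro h; rw [h] at ha2; simp at ha2
    have hPP : P (P v) = P v := by
      have := (hP0 _).mpr (hP1 v)
      rw [map_sub, sub_eq_zero] at this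
      exact this.symm
    have hyS : a • P v ∈ S := by
      refine ⟨by rw [map_smul, hPP], ?_⟩
      rw [← ha2, Finset.mul_sum]
      exact Finset.sum_congr rfl fun i _ => by simp [mul_pow]
    have h1 := hT _ hyS
    refine h1.trans (le_of_eq ?_)
    refine Finset.sum_congr rfl ?_
    rintro ⟨s, m, m'⟩ -
    have e1 : Y s (a • P v) = a • Y s v := by
      have : P (g.K (g.wd' s) *ᵥ (v - P v)) = 0 := (hP0 _).mpr (g.F_wd' s _ (hP1 v))
      rw [Matrix.mulVec_sub, map_sub, sub_eq_zero] at this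
      simp only [Y, Matrix.mulVec_smul, map_smul, this]
    simp only
    rw [e1]
    simp only [Ginc, Pi.smul_apply, smul_eq_mul]
    have q1 : ∑ i, (τ m m' i * (τ m m' i * (a * Y s v i))) ^ 2 =
        a ^ 2 * ∑ i, (τ m m' i * (τ m m' i * Y s v i)) ^ 2 := by
      rw [Finset.mul_sum]; exact Finset.sum_congr rfl fun i _ => by ring
    have q2 : ∑ i, (τ m m' i * (a * Y s v i)) ^ 2 =
        a ^ 2 * ∑ i, (τ m m' i * Y s v i) ^ 2 := by
      rw [Finset.mul_sum]; exact Finset.sum_congr rfl fun i _ => by ring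
    have q3 : ∑ i, (a * Y s v i) ^ 2 = a ^ 2 * ∑ i, (Y s v i) ^ 2 := by
      rw [Finset.mul_sum]; exact Finset.sum_congr rfl fun i _ => by ring
    rw [q1, q2, q3, mul_div_mul_left _ _ (by positivity), mul_div_mul_left _ _ (by positivity)]

end GapData
end Gap2

section EWsec
variable {β : Type} [Fintype β]

/-- expectation over random words with independent letters -/
def EW : List (β → ℝ) → (List β → ℝ) → ℝ
  | [], F => F []
  | c :: cs, F => ∑ m, c m * EW cs (fun w => F (m :: w))

/-- good weights -/
def GW (e : ℝ) (c : β → ℝ) : Prop := (∀ m, e ≤ c m) ∧ ∑ m, c m = 1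

lemma EW_add (cs : List (β → ℝ)) : ∀ F G, EW cs (fun u => F u + G u) = EW cs F + EW cs G := by
  induction cs with
  | nil => intro F G; rfl
  | cons c cs ih =>
    intro F G
    simp only [EW, ih, mul_add, Finset.sum_add_distrib]

lemma EW_mul_left (cs : List (β → ℝ)) (a : ℝ) : ∀ F, EW cs (fun u => a * F u) = a * EW cs F := by
  induction cs with
  | nil => intro F; rfl
  | cons c cs ih =>
    intro F
    simp only [EW, ih, Finset.mul_sum]
    exact Finset.sum_congr rfl fun m _ => by ring

lemma EW_mul_right (cs : List (β → ℝ)) (a : ℝ) (F) :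
    EW cs (fun u => F u * a) = EW cs F * a := by
  simp only [mul_comm _ a]
  exact EW_mul_left cs a F

lemma EW_sub (cs : List (β → ℝ)) (F G) : EW cs (fun u => F u - G u) = EW cs F - EW cs G := by
  have h1 := EW_add cs F (fun u => (-1) * G u)
  rw [EW_mul_left] at h1
  simp only [sub_eq_add_neg]
  simpa using h1

lemma EW_const (cs : List (β → ℝ)) (e : ℝ) (hc : ∀ c ∈ cs, GW e c) (a : ℝ) :
    EW cs (fun _ => a) = a := by
  induction cs with
  | nil => rfl
  | cons c cs ih =>
    simp only [EW]
    rw [ih (fun c hc' => hc c (by simp [hc'])), ← Finset.sum_mul, (hc c (by simp)).2, one_mul]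

lemma EW_mono (cs : List (β → ℝ)) (e : ℝ) (he : 0 ≤ e) (hc : ∀ c ∈ cs, GW e c) :
    ∀ (F G : List β → ℝ), (∀ u, u.length = cs.length → F u ≤ G u) → EW cs F ≤ EW cs G := by
  induction cs with
  | nil => intro F G h; exact h [] rfl
  | cons c cs ih =>
    intro F G h
    refine Finset.sum_le_sum fun m _ => mul_le_mul_of_nonneg_left ?_
      (he.trans ((hc c (by simp)).1 m))
    exact ih (fun c hc' => hc c (by simp [hc'])) _ _ fun u hu => h (m :: u) (by simp [hu])

lemma EW_nonneg (cs : List (β → ℝ)) (e : ℝ) (he : 0 ≤ e) (hc : ∀ c ∈ cs, GW e c)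
    (F : List β → ℝ) (hF : ∀ u, u.length = cs.length → 0 ≤ F u) : 0 ≤ EW cs F := by
  have := EW_mono cs e he hc (fun _ => 0) F hF
  rwa [EW_const cs e hc] at this

lemma EW_ge (cs : List (β → ℝ)) (e : ℝ) (he : 0 ≤ e) (hc : ∀ c ∈ cs, GW e c) :
    ∀ (F : List β → ℝ) (hF : ∀ u, u.length = cs.length → 0 ≤ F u) (u₀ : List β)
      (hu : u₀.length = cs.length), e ^ cs.length * F u₀ ≤ EW cs F := by
  induction cs with
  | nil =>
    intro F hF u₀ hu
    have : u₀ = [] := List.eq_nil_of_length_eq_zero hu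
    subst this
    simp [EW]
  | cons c cs ih =>
    intro F hF u₀ hu
    obtain ⟨m, w, rfl⟩ := List.exists_cons_of_length_eq_add_one hu
    have hw : w.length = cs.length := by simpa using hu
    have hc' : ∀ c ∈ cs, GW e c := fun c hc' => hc c (by simp [hc'])
    have h1 := ih hc' (fun w => F (m :: w)) (fun u hu => hF _ (by simp [hu])) w hw
    have h2 : c m * EW cs (fun w => F (m :: w)) ≤ EW (c :: cs) F := by
      apply Finset.single_le_sum (f := fun m => c m * EW cs (fun w => F (m :: w)))
        (fun m _ => ?_) (Finset.mem_univ m)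
      exact mul_nonneg (he.trans ((hc c (by simp)).1 m))
        (EW_nonneg cs e he hc' _ fun u hu => hF _ (by simp [hu]))
    have h3 := (hc c (by simp)).1 m
    have h4 : 0 ≤ EW cs (fun w => F (m :: w)) :=
      EW_nonneg cs e he hc' _ fun u hu => hF _ (by simp [hu])
    calc e ^ (c :: cs).length * F (m :: w) = e * (e ^ cs.length * F (m :: w)) := by
          rw [List.length_cons, pow_succ]; ring
      _ ≤ e * EW cs (fun w => F (m :: w)) := mul_le_mul_of_nonneg_left h1 he
      _ ≤ c m * EW cs (fun w => F (m :: w)) := mul_le_mul_of_nonneg_right h3 h4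
      _ ≤ _ := h2

lemma EW_append (cs ds : List (β → ℝ)) : ∀ F, EW (cs ++ ds) F =
    EW cs (fun u => EW ds (fun w => F (u ++ w))) := by
  induction cs with
  | nil => intro F; rfl
  | cons c cs ih =>
    intro F
    simp only [List.cons_append, EW, ih]

lemma EW_sq (cs : List (β → ℝ)) (e : ℝ) (he : 0 ≤ e) (hc : ∀ c ∈ cs, GW e c)
    (F : List β → ℝ) : (EW cs F) ^ 2 ≤ EW cs (fun u => F u ^ 2) := by
  have h1 := EW_nonneg cs e he hc (fun u => (F u - EW cs F) ^ 2) (fun _ _ => sq_nonneg _)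
  have h2 : (fun u => (F u - EW cs F) ^ 2) =
      fun u => (F u ^ 2 - (2 * EW cs F) * F u) + (EW cs F) ^ 2 := by funext u; ring
  rw [h2, EW_add, EW_const cs e hc, EW_sub, EW_mul_left] at h1
  nlinarith

lemma EW_swap {γ : Type} [Fintype γ] (cs : List (β → ℝ)) (ds : List (γ → ℝ)) :
    ∀ (F : List β → List γ → ℝ),
    EW cs (fun u => EW ds (fun w => F u w)) = EW ds (fun w => EW cs (fun u => F u w)) := by
  induction cs with
  | nil => intro F; rfl
  | cons c cs ih =>
    intro F
    have hsum : ∀ (s : Finset β) (H : β → List γ → ℝ),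
        EW ds (fun w => ∑ m ∈ s, H m w) = ∑ m ∈ s, EW ds (H m) := by
      intro s H
      classical
      induction s using Finset.induction_on with
      | empty =>
        simp only [Finset.sum_empty]
        have := EW_mul_left ds 0 (fun _ => 0)
        simpa using this
      | insert a s ha ihs =>
        simp only [Finset.sum_insert ha, EW_add, ihs]
    simp only [EW]
    rw [hsum]
    refine Finset.sum_congr rfl fun m _ => ?_
    rw [EW_mul_left, ih]

lemma EW_mul_EW (cs ds : List (β → ℝ)) (F G : List β → ℝ) :
    EW cs F * EW ds G = EW cs (fun u => EW ds (fun w => F u * G w)) := by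
  simp only [EW_mul_left]
  rw [EW_mul_right]

variable {X : Type}

lemma EW_tsum (cs : List (β → ℝ)) : ∀ (F : List β → X → ℝ)
    (_ : ∀ u, (Function.support (F u)).Finite),
    (Function.support fun y => EW cs (fun u => F u y)).Finite ∧
    ∑' y, EW cs (fun u => F u y) = EW cs (fun u => ∑' y, F u y) := by
  induction cs with
  | nil => intro F hF; exact ⟨hF [], rfl⟩
  | cons c cs ih =>
    intro F hF
    have ih' := fun m => ih (fun w => F (m :: w)) (fun w => hF _)
    have hm : ∀ m, (Function.support fun y => c m * EW cs (fun w => F (m :: w) y)).Finite := by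
      intro m
      refine (ih' m).1.subset ?_
      intro y hy
      exact right_ne_zero_of_mul hy
    constructor
    · simp only [EW]
      refine (Set.finite_iUnion hm).subset ?_
      intro y hy
      obtain ⟨m, -, hm⟩ := Finset.exists_ne_zero_of_sum_ne_zero hy
      exact Set.mem_iUnion.mpr ⟨m, hm⟩
    · simp only [EW]
      rw [Summable.tsum_finsetSum (fun m _ => summable_of_finite_support (hm m))]
      refine Finset.sum_congr rfl fun m _ => ?_
      rw [tsum_mul_left, (ih' m).2]

end EWsec

section Coll
variable {β : Type} [Fintype β] {X : Type}

/-- permutation attached to a word -/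
def permW (σ : β → Equiv.Perm X) : List β → Equiv.Perm X
  | [] => 1
  | m :: s => permW σ s * σ m

lemma permW_append (σ : β → Equiv.Perm X) (s t : List β) :
    permW σ (s ++ t) = permW σ t * permW σ s := by
  induction s with
  | nil => simp [permW]
  | cons m s ih => simp [permW, ih, mul_assoc]

/-- the distribution after random words -/
def pf (σ : β → Equiv.Perm X) (cs : List (β → ℝ)) (f : X → ℝ) : X → ℝ :=
  fun y => EW cs (fun u => f ((permW σ u).symm y))

/-- square norm -/
def Nsq (f : X → ℝ) : ℝ := ∑' y, f y ^ 2

lemma pf_append (σ : β → Equiv.Perm X) (cs ds : List (β → ℝ)) (f : X → ℝ) :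
    pf σ (cs ++ ds) f = pf σ ds (pf σ cs f) := by
  funext y
  simp only [pf, EW_append, permW_append]
  rw [EW_swap]
  rfl

lemma fs_comp {f : X → ℝ} (hf : (Function.support f).Finite) (θ : Equiv.Perm X) :
    (Function.support fun y => f (θ y)).Finite := by
  have : (Function.support fun y => f (θ y)) = θ ⁻¹' (Function.support f) := rfl
  rw [this]
  exact hf.preimage θ.injective.injOn

lemma fs_mul {f g : X → ℝ} (hf : (Function.support f).Finite) :
    (Function.support fun y => f y * g y).Finite :=
  hf.subset fun y hy => left_ne_zero_of_mul hy

lemma fs_sq {f : X → ℝ} (hf : (Function.support f).Finite) :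
    (Function.support fun y => f y ^ 2).Finite :=
  hf.subset fun y hy => by
    intro h
    exact hy (by simp [h])

lemma Nsq_pf (σ : β → Equiv.Perm X) (cs : List (β → ℝ)) (f : X → ℝ)
    (hf : (Function.support f).Finite) :
    (Function.support (pf σ cs f)).Finite ∧
    Nsq (pf σ cs f) = EW cs (fun u => EW cs (fun u' =>
      ∑' y, f ((permW σ u).symm y) * f ((permW σ u').symm y))) := by
  have h0 : ∀ u, (Function.support fun y => f ((permW σ u).symm y)).Finite :=
    fun u => fs_comp hf _
  have h1 := EW_tsum cs (fun u y => f ((permW σ u).symm y)) h0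
  refine ⟨h1.1, ?_⟩
  have h2 := EW_tsum cs (fun u y => f ((permW σ u).symm y) * pf σ cs f y)
    (fun u => fs_mul (h0 u))
  have h3 : Nsq (pf σ cs f) =
      ∑' y, EW cs (fun u => f ((permW σ u).symm y) * pf σ cs f y) := by
    unfold Nsq
    congr 1
    funext y
    rw [EW_mul_right, sq]
    rfl
  rw [h3, h2.2]
  congr 1
  funext u
  have h4 := EW_tsum cs (fun u' y => f ((permW σ u).symm y) * f ((permW σ u').symm y))
    (fun u' => fs_mul (h0 u))
  rw [← h4.2]
  congr 1
  funext y
  rw [EW_mul_left]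
  rfl

lemma Nsq_comp (f : X → ℝ) (θ : Equiv.Perm X) : ∑' y, f (θ y) ^ 2 = Nsq f :=
  Equiv.tsum_eq θ (fun y => f y ^ 2)

lemma Nsq_nonneg (f : X → ℝ) : 0 ≤ Nsq f := tsum_nonneg fun _ => sq_nonneg _

lemma inner_le (f : X → ℝ) (hf : (Function.support f).Finite) (θ θ' : Equiv.Perm X) :
    ∑' y, f (θ y) * f (θ' y) ≤ Nsq f := by
  have s1 : Summable fun y => f (θ y) ^ 2 := summable_of_finite_support (fs_sq (fs_comp hf θ))
  have s2 : Summable fun y => f (θ' y) ^ 2 := summable_of_finite_support (fs_sq (fs_comp hf θ'))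
  have h1 : ∑' y, f (θ y) * f (θ' y) ≤ ∑' y, ((1/2) * f (θ y) ^ 2 + (1/2) * f (θ' y) ^ 2) := by
    refine Summable.tsum_le_tsum (fun y => ?_) (summable_of_finite_support (fs_mul (fs_comp hf θ)))
      ((s1.mul_left _).add (s2.mul_left _))
    nlinarith [sq_nonneg (f (θ y) - f (θ' y))]
  rw [Summable.tsum_add (s1.mul_left _) (s2.mul_left _), tsum_mul_left, tsum_mul_left,
    Nsq_comp, Nsq_comp] at h1
  linarith

/-- existence of a large displacement -/
lemma displacement (T : Finset (List β × β × β)) (θ : List β × β × β → Equiv.Perm X)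
    (Ψ : List β × β × β → X → ℝ) (ε C : ℝ) (hε : 0 < ε) (hC : 1 ≤ C)
    (hΨ : ∀ t ∈ T, ∀ x, |Ψ t x| ≤ C)
    (hgap : ∀ x, ε ≤ ∑ t ∈ T, (Ψ t (θ t x) - Ψ t x))
    (f : X → ℝ) (hf : (Function.support f).Finite) (hN : 0 < Nsq f) :
    ∃ t ∈ T, ∑' y, f y * f (θ t y) ≤
      (1 - ε ^ 2 / (8 * C ^ 2 * (T.card : ℝ) ^ 2)) * Nsq f := by
  have hfs : (Function.support fun y => f y ^ 2).Finite := by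
    simpa only [sq] using fs_mul hf
  have hX : Nonempty X := by
    by_contra h
    rw [not_nonempty_iff] at h
    simp [Nsq] at hN
  have hTne : T.Nonempty := by
    by_contra h
    rw [Finset.not_nonempty_iff_eq_empty] at h
    obtain ⟨x⟩ := hX
    have := hgap x
    simp [h] at this
    linarith
  have hcard : 0 < (T.card : ℝ) := by exact_mod_cast hTne.card_pos
  set M : ℝ := (T.card : ℝ)
  by_contra hall
  push Not at hall
  set N := Nsq f with hNdef
  set lam : ℝ := 4 * C * M / ε with hlam
  have hlam0 : 0 < lam := by positivity
  have hsm : ∀ (g : X → ℝ), Summable fun y => f y ^ 2 * g y := fun g =>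
    summable_of_finite_support (fs_mul hfs)
  -- per t bound
  have hper : ∀ t ∈ T, ∑' y, f y ^ 2 * (Ψ t (θ t y) - Ψ t y) ≤
      C * (lam * (N - ∑' y, f y * f (θ t y)) + 2 / lam * N) := by
    intro t ht
    have e1 : ∑' y, f y ^ 2 * (Ψ t (θ t y) - Ψ t y) =
        ∑' y, (f y ^ 2 - f (θ t y) ^ 2) * Ψ t (θ t y) := by
      simp only [mul_sub, sub_mul]
      rw [Summable.tsum_sub (hsm _) (hsm _), Summable.tsum_sub (hsm _)
        (summable_of_finite_support (fs_mul (fs_comp hfs (θ t))))]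
      congr 1
      exact (Equiv.tsum_eq (θ t) (fun y => f y ^ 2 * Ψ t y)).symm
    rw [e1]
    have s0 : Summable fun y => f y ^ 2 := summable_of_finite_support hfs
    have s1 : Summable fun y => f (θ t y) ^ 2 := summable_of_finite_support (fs_comp hfs (θ t))
    have s2 : Summable fun y => f y * f (θ t y) := summable_of_finite_support (fs_mul hf)
    have e2 : ∑' y, (f y ^ 2 - f (θ t y) ^ 2) * Ψ t (θ t y) ≤
        ∑' y, (C * (lam / 2 + 1 / lam) * f y ^ 2 + C * (lam / 2 + 1 / lam) * f (θ t y) ^ 2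
          - C * lam * (f y * f (θ t y))) := by
      refine Summable.tsum_le_tsum (fun y => ?_) ?_
        (((s0.mul_left _).add (s1.mul_left _)).sub (s2.mul_left _))
      · have hb := abs_le.mp (hΨ t ht (θ t y))
        set a := f y
        set b := f (θ t y)
        set P := Ψ t (θ t y)
        have h1 : (a ^ 2 - b ^ 2) * P ≤ C * |a ^ 2 - b ^ 2| := by
          calc (a ^ 2 - b ^ 2) * P ≤ |(a ^ 2 - b ^ 2) * P| := le_abs_self _
            _ = |a ^ 2 - b ^ 2| * |P| := abs_mul _ _
            _ ≤ |a ^ 2 - b ^ 2| * C :=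
              mul_le_mul_of_nonneg_left (abs_le.mpr hb) (abs_nonneg _)
            _ = _ := mul_comm _ _
        have h2 : |a ^ 2 - b ^ 2| ≤ lam / 2 * (a - b) ^ 2 + 1 / (2 * lam) * (a + b) ^ 2 := by
          have e : |a ^ 2 - b ^ 2| = |a - b| * |a + b| := by
            rw [← abs_mul]; congr 1; ring
          rw [e, ← sq_abs (a - b), ← sq_abs (a + b)]
          have h3 : 0 ≤ (lam * |a - b| - |a + b|) ^ 2 / (2 * lam) := by positivity
          have h4 : (lam * |a - b| - |a + b|) ^ 2 / (2 * lam) =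
            lam / 2 * |a - b| ^ 2 + 1 / (2 * lam) * |a + b| ^ 2 - |a - b| * |a + b| := by
            field_simp; ring
          linarith
        have h5 : 1 / (2 * lam) * (a + b) ^ 2 ≤ 1 / lam * (a ^ 2 + b ^ 2) := by
          have : 1 / lam * (a ^ 2 + b ^ 2) - 1 / (2 * lam) * (a + b) ^ 2 =
            (a - b) ^ 2 / (2 * lam) := by field_simp; ring
          have h6 : 0 ≤ (a - b) ^ 2 / (2 * lam) := by positivity
          linarith
        have h7 : C * |a ^ 2 - b ^ 2| ≤
            C * (lam / 2 * (a - b) ^ 2 + 1 / lam * (a ^ 2 + b ^ 2)) :=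
          mul_le_mul_of_nonneg_left (by linarith) (by linarith)
        have h8 : C * (lam / 2 * (a - b) ^ 2 + 1 / lam * (a ^ 2 + b ^ 2)) =
          C * (lam / 2 + 1 / lam) * a ^ 2 + C * (lam / 2 + 1 / lam) * b ^ 2
          - C * lam * (a * b) := by ring
        linarith
      · simp only [sub_mul]
        exact (hsm _).sub (summable_of_finite_support (fs_mul (fs_comp hfs (θ t))))
    rw [Summable.tsum_sub ((s0.mul_left _).add (s1.mul_left _)) (s2.mul_left _),
      Summable.tsum_add (s0.mul_left _) (s1.mul_left _), tsum_mul_left, tsum_mul_left,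
      tsum_mul_left, Nsq_comp f (θ t)] at e2
    have e3 : ∑' y, f y ^ 2 = N := rfl
    rw [e3] at e2
    refine e2.trans (le_of_eq ?_)
    rw [← hNdef]
    ring
  have htot : ε * N ≤ ∑ t ∈ T, ∑' y, f y ^ 2 * (Ψ t (θ t y) - Ψ t y) := by
    rw [← Summable.tsum_finsetSum (fun t _ => hsm _)]
    simp only [← Finset.mul_sum]
    rw [hNdef, Nsq, ← tsum_mul_left]
    refine Summable.tsum_le_tsum (fun y => ?_) ?_ (hsm _)
    · rw [mul_comm]
      exact mul_le_mul_of_nonneg_left (hgap y) (sq_nonneg _)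
    · exact (summable_of_finite_support hfs).mul_left _
  have hup : ∑ t ∈ T, ∑' y, f y ^ 2 * (Ψ t (θ t y) - Ψ t y) <
      ∑ t ∈ T, C * (lam * (ε ^ 2 / (8 * C ^ 2 * M ^ 2) * N) + 2 / lam * N) := by
    refine Finset.sum_lt_sum_of_nonempty hTne fun t ht => lt_of_le_of_lt (hper t ht) ?_
    have := hall t ht
    have h9 : N - ∑' y, f y * f (θ t y) < ε ^ 2 / (8 * C ^ 2 * M ^ 2) * N := by linarith
    have hC0 : 0 < C := by linarith
    gcongr
  rw [Finset.sum_const, nsmul_eq_mul] at hup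
  have hfin : M * (C * (lam * (ε ^ 2 / (8 * C ^ 2 * M ^ 2) * N) + 2 / lam * N)) = ε * N := by
    have hC0 : 0 < C := by linarith
    rw [hlam]
    field_simp
    ring
  have : ε * N < ε * N := by
    calc ε * N ≤ _ := htot
      _ < _ := hup
      _ = _ := hfin
  exact lt_irrefl _ this

end Coll

section Coll2
variable {β : Type} [Fintype β] {X : Type}

lemma Nsq_pf_le (σ : β → Equiv.Perm X) (e : ℝ) (he : 0 ≤ e) (cs : List (β → ℝ))
    (hc : ∀ c ∈ cs, GW e c) (f : X → ℝ)
    (hf : (Function.support f).Finite) : Nsq (pf σ cs f) ≤ Nsq f := by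
  rw [(Nsq_pf σ cs f hf).2]
  calc _ ≤ EW cs (fun u => EW cs (fun u' => Nsq f)) :=
        EW_mono cs e he hc _ _ fun u _ => EW_mono cs e he hc _ _ fun u' _ => inner_le f hf _ _
    _ = Nsq f := by rw [EW_const cs e hc, EW_const cs e hc]

lemma block_contract (σ : β → Equiv.Perm X) (T : Finset (List β × β × β))
    (Ψ : List β × β × β → X → ℝ) (ε C : ℝ) (hε : 0 < ε) (hC : 1 ≤ C)
    (hΨ : ∀ t ∈ T, ∀ x, |Ψ t x| ≤ C)
    (hgap : ∀ x, ε ≤ ∑ t ∈ T, (Ψ t (((permW σ (t.1 ++ [t.2.1]))⁻¹ *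
      permW σ (t.1 ++ [t.2.2])) x) - Ψ t x))
    (J : ℕ) (hJ : ∀ t ∈ T, t.1.length + 1 ≤ J)
    (e : ℝ) (he : 0 < e) (cs : List (β → ℝ)) (hcs : cs.length = J) (hc : ∀ c ∈ cs, GW e c)
    (f : X → ℝ) (hf : (Function.support f).Finite) :
    Nsq (pf σ cs f) ≤
      (1 - e ^ J * (e ^ J * (ε ^ 2 / (8 * C ^ 2 * (T.card : ℝ) ^ 2)))) * Nsq f := by
  set κ := ε ^ 2 / (8 * C ^ 2 * (T.card : ℝ) ^ 2) with hκ
  rcases (Nsq_nonneg f).eq_or_lt with h0 | hN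
  · have := Nsq_pf_le σ e he.le cs hc f hf
    rw [← h0] at this ⊢
    simpa using this
  obtain ⟨⟨s, m₁, m₂⟩, ht, hdis⟩ := displacement T
    (fun t => (permW σ (t.1 ++ [t.2.1]))⁻¹ * permW σ (t.1 ++ [t.2.2])) Ψ ε C hε hC hΨ hgap f hf hN
  have hJs := hJ _ ht
  simp only at hJs
  set tl : List β := List.replicate (J - (s.length + 1)) m₁
  set u₀ := (s ++ [m₂]) ++ tl with hu
  set u₁ := (s ++ [m₁]) ++ tl with hu'
  have hl0 : u₀.length = cs.length := by simp [hu, tl, hcs]; omega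
  have hl1 : u₁.length = cs.length := by simp [hu', tl, hcs]; omega
  let B : List β → List β → ℝ := fun u u' =>
    ∑' y, f ((permW σ u).symm y) * f ((permW σ u').symm y)
  have hB : B u₀ u₁ ≤ (1 - κ) * Nsq f := by
    refine le_trans (le_of_eq ?_) hdis
    simp only [B]
    rw [← Equiv.tsum_eq (permW σ u₀)]
    refine tsum_congr fun y => ?_
    have p0 : permW σ u₀ = permW σ tl * permW σ (s ++ [m₂]) := permW_append ..
    have p1 : permW σ u₁ = permW σ tl * permW σ (s ++ [m₁]) := permW_append ..
    rw [Equiv.symm_apply_apply, p0, p1]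
    congr 2
    rw [Equiv.symm_apply_eq]
    simp only [Equiv.Perm.mul_apply]
    congr 1
    exact ((permW σ (s ++ [m₁])).apply_symm_apply _).symm
  have hBle : ∀ u u', B u u' ≤ Nsq f := fun u u' => inner_le f hf _ _
  have h1 : Nsq f - Nsq (pf σ cs f) = EW cs (fun u => EW cs (fun u' => Nsq f - B u u')) := by
    rw [(Nsq_pf σ cs f hf).2]
    simp only [EW_sub, EW_const cs e hc]
    rfl
  have h2 : e ^ J * (e ^ J * (Nsq f - B u₀ u₁)) ≤ Nsq f - Nsq (pf σ cs f) := by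
    rw [h1]
    have a1 := EW_ge cs e he.le hc (fun u' => Nsq f - B u₀ u')
      (fun u' _ => sub_nonneg.mpr (hBle _ _)) u₁ hl1
    have a2 := EW_ge cs e he.le hc (fun u => EW cs (fun u' => Nsq f - B u u'))
      (fun u _ => EW_nonneg cs e he.le hc _ fun u' _ => sub_nonneg.mpr (hBle _ _)) u₀ hl0
    rw [hcs] at a1 a2
    exact (mul_le_mul_of_nonneg_left a1 (by positivity)).trans a2
  have h3 : e ^ J * (e ^ J * (κ * Nsq f)) ≤ e ^ J * (e ^ J * (Nsq f - B u₀ u₁)) := by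
    gcongr
    linarith
  nlinarith [h2, h3]

theorem coll_bound (σ : β → Equiv.Perm X) (T : Finset (List β × β × β))
    (Ψ : List β × β × β → X → ℝ) (ε : ℝ) (hε : 0 < ε)
    (hΨ : ∀ t, ∃ C, ∀ x, |Ψ t x| ≤ C)
    (hgap : ∀ x, ε ≤ ∑ t ∈ T, (Ψ t (((permW σ (t.1 ++ [t.2.1]))⁻¹ *
      permW σ (t.1 ++ [t.2.2])) x) - Ψ t x))
    (e : ℝ) (he : 0 < e) :
    ∃ C ρ : ℝ, 0 ≤ C ∧ 0 < ρ ∧ ρ < 1 ∧ ∀ (cs : List (β → ℝ)) (_ : ∀ c ∈ cs, GW e c) (x : X),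
      EW cs (fun u => EW cs (fun u' =>
        Set.indicator {y | y = permW σ u x} (fun _ => (1 : ℝ)) (permW σ u' x))) ≤
          C * ρ ^ cs.length := by
  classical
  rcases isEmpty_or_nonempty X with hX | ⟨⟨x0⟩⟩
  · exact ⟨0, 1/2, le_rfl, by norm_num, by norm_num, fun cs _ x => (IsEmpty.false x).elim⟩
  have hTne : T.Nonempty := by
    by_contra h
    rw [Finset.not_nonempty_iff_eq_empty] at h
    have := hgap x0
    simp [h] at this
    linarith
  choose Cf hCf using hΨ
  set C := 1 + ∑ t ∈ T, |Cf t| with hCdef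
  have hC1 : 1 ≤ C := by
    have : 0 ≤ ∑ t ∈ T, |Cf t| := Finset.sum_nonneg fun _ _ => abs_nonneg _
    linarith
  have hCb : ∀ t ∈ T, ∀ x, |Ψ t x| ≤ C := by
    intro t ht x
    have h1 := Finset.single_le_sum (f := fun t => |Cf t|) (fun _ _ => abs_nonneg _) ht
    have h2 := hCf t x
    have h3 := le_abs_self (Cf t)
    linarith
  set J := (T.sup fun t => t.1.length) + 1 with hJdef
  have hJ : ∀ t ∈ T, t.1.length + 1 ≤ J := by
    intro t ht
    have := Finset.le_sup (f := fun t : List β × β × β => t.1.length) ht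
    omega
  set κ := e ^ J * (e ^ J * (ε ^ 2 / (8 * C ^ 2 * (T.card : ℝ) ^ 2))) with hκ
  have hκ0 : 0 < κ := by
    have : 0 < (T.card : ℝ) := by exact_mod_cast hTne.card_pos
    have : 0 < C := by linarith
    positivity
  set r : ℝ := 1 - min κ (1/2) with hr
  have hr0 : 0 < r := by
    have : min κ (1/2) ≤ 1/2 := min_le_right _ _
    linarith
  have hr1 : r < 1 := by
    have : 0 < min κ (1/2) := lt_min hκ0 (by norm_num)
    linarith
  have hblock : ∀ cs : List (β → ℝ), cs.length = J → (∀ c ∈ cs, GW e c) → ∀ f : X → ℝ,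
      (Function.support f).Finite → Nsq (pf σ cs f) ≤ r * Nsq f := by
    intro cs hl hc f hf
    refine (block_contract σ T Ψ ε C hε hC1 hCb hgap J hJ e he cs hl hc f hf).trans ?_
    refine mul_le_mul_of_nonneg_right ?_ (Nsq_nonneg f)
    have : min κ (1/2) ≤ κ := min_le_left _ _
    linarith
  have hmany : ∀ (q : ℕ) (cs : List (β → ℝ)), q * J ≤ cs.length → (∀ c ∈ cs, GW e c) →
      ∀ f : X → ℝ, (Function.support f).Finite → Nsq (pf σ cs f) ≤ r ^ q * Nsq f := by
    intro q
    induction q with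
    | zero => intro cs _ hc f hf; simpa using Nsq_pf_le σ e he.le cs hc f hf
    | succ q ih =>
      intro cs hl hc f hf
      have hsplit := List.take_append_drop J cs
      rw [← hsplit, pf_append]
      have hc1 : ∀ c ∈ cs.take J, GW e c := fun c h => hc c (List.mem_of_mem_take h)
      have hc2 : ∀ c ∈ cs.drop J, GW e c := fun c h => hc c (List.mem_of_mem_drop h)
      have hl' : q * J + J ≤ cs.length := by rw [Nat.succ_mul] at hl; exact hl
      have h1 := ih (cs.drop J) (by rw [List.length_drop]; omega) hc2
        (pf σ (cs.take J) f) (Nsq_pf σ _ f hf).1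
      have h2 := hblock (cs.take J) (by rw [List.length_take]; omega) hc1 f hf
      calc _ ≤ r ^ q * Nsq (pf σ (cs.take J) f) := h1
        _ ≤ r ^ q * (r * Nsq f) := by gcongr
        _ = _ := by ring
  have hJ0 : 0 < J := by omega
  refine ⟨r⁻¹, r ^ ((J : ℝ)⁻¹), by positivity, by positivity, ?_, ?_⟩
  · exact Real.rpow_lt_one hr0.le hr1 (by positivity)
  intro cs hc x
  set f : X → ℝ := Set.indicator {x} (fun _ => 1) with hf
  have hfs : (Function.support f).Finite := (Set.finite_singleton x).subset (by
    intro y hy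
    by_contra h
    exact hy (Set.indicator_of_notMem h _))
  have hNf : Nsq f = 1 := by
    unfold Nsq
    rw [tsum_eq_single x]
    · simp [hf]
    · intro y hy
      simp [hf, hy]
  have key := hmany (cs.length / J) cs (Nat.div_mul_le_self _ _) hc f hfs
  rw [hNf, mul_one, (Nsq_pf σ cs f hfs).2] at key
  have hB : ∀ u u', (∑' y, f ((permW σ u).symm y) * f ((permW σ u').symm y)) =
      Set.indicator {y | y = permW σ u x} (fun _ => (1 : ℝ)) (permW σ u' x) := by
    intro u u'
    rw [tsum_eq_single (permW σ u' x)]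
    · simp only [hf, Equiv.symm_apply_apply, Set.indicator, Set.mem_singleton_iff,
        Set.mem_setOf_eq, Equiv.symm_apply_eq]
      simp
    · intro y hy
      have : (permW σ u').symm y ≠ x := by
        intro h
        exact hy ((Equiv.symm_apply_eq _).mp h)
      simp [hf, this]
  simp only [hB] at key
  refine key.trans ?_
  have h1 : (r ^ ((J : ℝ)⁻¹)) ^ cs.length = r ^ ((cs.length : ℝ) / J) := by
    rw [← Real.rpow_natCast, ← Real.rpow_mul hr0.le]
    congr 1; ring
  rw [h1, ← Real.rpow_neg_one, ← Real.rpow_add hr0, ← Real.rpow_natCast]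
  apply Real.rpow_le_rpow_of_exponent_ge hr0 hr1.le
  have h2 : (cs.length : ℝ) < (cs.length / J : ℕ) * J + J := by
    have := Nat.lt_div_mul_add (a := cs.length) hJ0
    exact_mod_cast this
  have hJr : (0 : ℝ) < J := by exact_mod_cast hJ0
  have h3 : (cs.length : ℝ) / J < (cs.length / J : ℕ) + 1 := by
    rw [div_lt_iff₀ hJr]; linarith
  linarith

end Coll2

section TKsec
variable {S n : Type} [Fintype S] [DecidableEq S] [Fintype n] [DecidableEq n]

def TG (M : S → Matrix n n ℝ) : Matrix (S → n) (S → n) ℝ :=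
  Matrix.of fun i j => ∏ s, M s (i s) (j s)

lemma TG_mul (M M' : S → Matrix n n ℝ) : TG M * TG M' = TG (fun s => M s * M' s) := by
  ext i j
  simp only [TG, Matrix.mul_apply, Matrix.of_apply, ← Finset.prod_mul_distrib]
  rw [Finset.prod_univ_sum, Fintype.piFinset_univ]

lemma TG_one : TG (fun _ : S => (1 : Matrix n n ℝ)) = 1 := by
  ext i j
  simp only [TG, Matrix.of_apply, Matrix.one_apply]
  by_cases h : i = j
  · subst h; simp
  · rw [if_neg h]
    obtain ⟨s, hs⟩ := Function.ne_iff.mp h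
    exact Finset.prod_eq_zero (Finset.mem_univ s) (by simp [hs])

def TK (S n : Type) [Fintype S] [DecidableEq S] [Fintype n] [DecidableEq n] :
    Matrix n n ℝ →* Matrix (S → n) (S → n) ℝ where
  toFun A := TG (fun _ => A)
  map_one' := TG_one
  map_mul' A B := (TG_mul _ _).symm

lemma TK_def (A : Matrix n n ℝ) : TK S n A = TG (fun _ => A) := rfl
lemma TK_apply (A : Matrix n n ℝ) (i j : S → n) : TK S n A i j = ∏ s, A (i s) (j s) := rfl

def slot (s : S) (Z : Matrix n n ℝ) : Matrix (S → n) (S → n) ℝ :=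
  TG (Function.update (fun _ => 1) s Z)

lemma slot_apply (s : S) (Z : Matrix n n ℝ) (i j : S → n) :
    slot s Z i j = Z (i s) (j s) * ∏ t ∈ Finset.univ.erase s, (1 : Matrix n n ℝ) (i t) (j t) := by
  unfold slot TG
  rw [Matrix.of_apply, ← Finset.mul_prod_erase _ _ (Finset.mem_univ s)]
  congr 1
  · simp
  · refine Finset.prod_congr rfl fun t ht => ?_
    rw [Function.update_of_ne (Finset.ne_of_mem_erase ht)]

def dTK (S n : Type) [Fintype S] [DecidableEq S] [Fintype n] [DecidableEq n] :
    Matrix n n ℝ →ₗ[ℝ] Matrix (S → n) (S → n) ℝ where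
  toFun Z := ∑ s, slot s Z
  map_add' X Y := by
    rw [← Finset.sum_add_distrib]
    refine Finset.sum_congr rfl fun s _ => ?_
    ext i j
    simp only [slot_apply, Matrix.add_apply, add_mul]
  map_smul' c X := by
    rw [RingHom.id_apply, Finset.smul_sum]
    refine Finset.sum_congr rfl fun s _ => ?_
    ext i j
    simp only [slot_apply, Matrix.smul_apply, smul_eq_mul, mul_assoc]

lemma dTK_def (Z : Matrix n n ℝ) : dTK S n Z = ∑ s, slot s Z := rfl

lemma slot_comm (s t : S) (h : s ≠ t) (X Y : Matrix n n ℝ) :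
    slot s X * slot t Y = slot t Y * slot s X := by
  unfold slot
  rw [TG_mul, TG_mul]
  congr 1
  funext r
  by_cases h1 : r = s
  · subst h1; simp [Function.update_of_ne h]
  · simp [Function.update_of_ne h1]

lemma slot_mul (s : S) (X Y : Matrix n n ℝ) : slot s X * slot s Y = slot s (X * Y) := by
  unfold slot
  rw [TG_mul]
  congr 1
  funext r
  by_cases h1 : r = s
  · subst h1; simp
  · simp [Function.update_of_ne h1]

lemma slot_sub (s : S) (X Y : Matrix n n ℝ) : slot s (X - Y) = slot s X - slot s Y := by
  ext i j
  simp only [slot_apply, Matrix.sub_apply, sub_mul]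

lemma dTK_br (X Y : Matrix n n ℝ) :
    dTK S n (X * Y - Y * X) = dTK S n X * dTK S n Y - dTK S n Y * dTK S n X := by
  simp only [dTK_def, slot_sub, Finset.sum_sub_distrib, ← slot_mul, Finset.sum_mul, Finset.mul_sum]
  rw [← Finset.sum_sub_distrib]
  conv_rhs => rw [Finset.sum_comm, ← Finset.sum_sub_distrib]
  refine Finset.sum_congr rfl fun s _ => ?_
  rw [← Finset.sum_sub_distrib, Finset.sum_eq_single s]
  · intro t _ ht
    rw [slot_comm t s ht, sub_self]
  · simp

lemma dTK_conj (X Y Z : Matrix n n ℝ) (h : X * Y = 1) :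
    dTK S n (X * Z * Y) = TK S n X * dTK S n Z * TK S n Y := by
  simp only [dTK_def, Finset.sum_mul, Finset.mul_sum]
  refine Finset.sum_congr rfl fun s _ => ?_
  unfold slot
  rw [TK_def, TK_def, TG_mul, TG_mul]
  congr 1
  funext r
  by_cases h1 : r = s
  · subst h1; simp
  · simp [Function.update_of_ne h1, h]

lemma dTK_diag (h : n → ℝ) : dTK S n (diagonal h) = diagonal fun i => ∑ s, h (i s) := by
  rw [dTK_def]
  ext i j
  rw [Matrix.sum_apply]
  simp only [slot_apply]
  by_cases hij : i = j
  · subst hij; simp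
  · rw [Matrix.diagonal_apply_ne _ hij]
    refine Finset.sum_eq_zero fun s _ => ?_
    obtain ⟨r, hr⟩ := Function.ne_iff.mp hij
    by_cases hs : r = s
    · subst hs; rw [Matrix.diagonal_apply_ne _ hr, zero_mul]
    · rw [Finset.prod_eq_zero (Finset.mem_erase.mpr ⟨hs, Finset.mem_univ r⟩), mul_zero]
      exact Matrix.one_apply_ne hr

lemma TK_diag (h : n → ℝ) : TK S n (diagonal h) = diagonal fun i => ∏ s, h (i s) := by
  ext i j
  rw [TK_apply]
  by_cases hij : i = j
  · subst hij; simp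
  · rw [Matrix.diagonal_apply_ne _ hij]
    obtain ⟨r, hr⟩ := Function.ne_iff.mp hij
    exact Finset.prod_eq_zero (Finset.mem_univ r) (Matrix.diagonal_apply_ne _ hr)

lemma TK_diag_exp (h : n → ℝ) : TK S n (diagonal fun i => Real.exp (h i)) =
    diagonal fun i => Real.exp (∑ s, h (i s)) := by
  rw [TK_diag]; simp only [Real.exp_sum]

lemma dTK_one : dTK S n 1 = (Fintype.card S : ℝ) • 1 := by
  have : (1 : Matrix n n ℝ) = diagonal fun _ => 1 := rfl
  rw [this, dTK_diag]
  simp only [Finset.sum_const, Finset.card_univ, nsmul_eq_mul, mul_one]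
  ext i j
  by_cases hij : i = j
  · subst hij; simp
  · simp [hij]

/-- elementary data -/
structure BaseData (n β : Type) [Fintype n] [DecidableEq n] where
  A : β → Matrix n n ℝ
  A' : β → Matrix n n ℝ
  hAA : ∀ m, A m * A' m = 1
  h : β → β → n → ℝ
  hA : ∀ m m', A m * A' m' = diagonal fun i => Real.exp (h m m' i)
  hsep : ∀ i j, i ≠ j → ∃ m m', h m m' i ≠ h m m' j
  hirr : ∀ B : Submodule ℝ (n → ℝ), (∀ (s : List β) (m m' : β), ∀ x ∈ B,
    ((s.map A).prod * diagonal (h m m') * (s.map A').reverse.prod) *ᵥ x ∈ B) → B = ⊥ ∨ B = ⊤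

def BaseData.gd {β : Type} (b : BaseData n β) (D : Type) [Fintype D] [DecidableEq D] :
    GapData n (D → (Bool → n)) β where
  K := (TK D (Bool → n)).comp (TK Bool n)
  dK := (dTK D (Bool → n)).comp (dTK Bool n)
  hbr X Y := by
    rw [LinearMap.comp_apply, dTK_br, dTK_br]; rfl
  hconj X Y Z h := by
    rw [LinearMap.comp_apply, dTK_conj _ _ _ h, dTK_conj _ _ _ (by rw [← map_mul, h, map_one])]
    rfl
  hdiag h := ⟨_, by rw [LinearMap.comp_apply, dTK_diag, dTK_diag], by
    rw [MonoidHom.comp_apply, TK_diag_exp, TK_diag_exp]⟩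
  N := 2 * Fintype.card D
  h1 := by
    rw [LinearMap.comp_apply, dTK_one, map_smul, dTK_one, smul_smul]
    simp
  A := b.A
  A' := b.A'
  hAA := b.hAA
  h := b.h
  hA := b.hA
  hsep := b.hsep
  hirr := b.hirr

end TKsec

section Pl
variable {J : Type} [Fintype J] [DecidableEq J] {d : ℕ}

def pl (B : Fin d → J → ℝ) (i : Fin d → J) : ℝ := (Matrix.of fun r s => B r (i s)).det

lemma pl_act (M : Matrix J J ℝ) (B : Fin d → J → ℝ) :
    pl (fun r => M *ᵥ B r) = TK (Fin d) J M *ᵥ pl B := by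
  funext i
  simp only [pl, Matrix.mulVec, dotProduct]
  have h : (Matrix.of fun r s => ∑ x, M (i s) x * B r x).det =
      Matrix.detRowAlternating (R := ℝ) (fun s => ∑ x, (M (i s) x • fun r => B r x)) := by
    rw [← Matrix.det_transpose]
    congr 1
    ext s r
    simp [Finset.sum_apply]
  rw [h]
  change Matrix.detRowAlternating.toMultilinearMap _ = _
  rw [MultilinearMap.map_sum]
  refine Finset.sum_congr rfl fun j _ => ?_
  rw [MultilinearMap.map_smul_univ, smul_eq_mul]
  congr 1
  rw [← Matrix.det_transpose]
  rfl

lemma pl_comb (C : Matrix (Fin d) (Fin d) ℝ) (B : Fin d → J → ℝ) :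
    pl (fun r => ∑ r', C r r' • B r') = C.det • pl B := by
  funext i
  simp only [pl, Pi.smul_apply, smul_eq_mul]
  rw [← Matrix.det_mul]
  congr 1
  ext r s
  simp [Matrix.mul_apply, Finset.sum_apply]

lemma pl_ne (B : Fin d → J → ℝ) (hB : LinearIndependent ℝ B) : ∃ i, pl B i ≠ 0 := by
  by_contra! hall
  -- columns span
  let col : J → (Fin d → ℝ) := fun j r => B r j
  have hspan : Submodule.span ℝ (Set.range col) = ⊤ := by
    have hr : (Matrix.of B).rank = d := by
      have := LinearIndependent.rank_matrix (M := Matrix.of B) hB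
      simpa using this
    apply Submodule.eq_top_of_finrank_eq
    have h2 := Matrix.rank_eq_finrank_span_cols (Matrix.of B)
    have h3 : Set.range (Matrix.of B).col = Set.range col := rfl
    rw [h3] at h2
    rw [← h2, hr]; simp
  obtain ⟨κ, a, hinj, hsp, hli⟩ := exists_linearIndependent' ℝ col
  rw [hspan] at hsp
  have bas := Module.Basis.mk hli hsp.ge
  haveI : Fintype κ := Fintype.ofInjective a hinj
  have hcard : Fintype.card κ = d := by
    have := Module.finrank_eq_card_basis bas
    simpa using this.symm
  let e : Fin d ≃ κ := (Fintype.equivFinOfCardEq hcard).symm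
  have hli2 : LinearIndependent ℝ (fun s => col (a (e s))) := hli.comp e e.injective
  have := hall (fun s => a (e s))
  have hu := (Matrix.linearIndependent_rows_iff_isUnit (A := Matrix.of fun s r => col (a (e s)) r)).mp hli2
  rw [Matrix.isUnit_iff_isUnit_det] at hu
  apply hu.ne_zero
  rw [← Matrix.det_transpose]
  exact this

lemma pl_cramer (B : Fin d → J → ℝ) (i : Fin d → J) (r : Fin d) (j : J) :
    pl B i * B r j = ∑ s, B r (i s) * pl B (Function.update i s j) := by
  have h := Matrix.mulVec_cramer (Matrix.of fun r s => B r (i s)) (fun r => B r j)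
  have h2 := congrFun h r
  simp only [Matrix.mulVec, dotProduct, Pi.smul_apply, smul_eq_mul, Matrix.cramer_apply] at h2
  rw [pl, ← h2]
  refine Finset.sum_congr rfl fun s _ => ?_
  rw [Matrix.of_apply, pl]
  congr 2
  ext r' s'
  by_cases hs : s' = s
  · subst hs; simp
  · simp [hs, Matrix.updateCol_apply]

def plR (v : (Fin d → J) → ℝ) (i : Fin d → J) : Submodule ℝ (J → ℝ) where
  carrier := {x | ∀ j, v i * x j = ∑ s, x (i s) * v (Function.update i s j)}
  zero_mem' := by intro j; simp
  add_mem' := by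
    intro x y hx hy j
    simp only [Pi.add_apply, mul_add, add_mul, Finset.sum_add_distrib, hx j, hy j]
  smul_mem' := by
    intro c x hx j
    simp only [Pi.smul_apply, smul_eq_mul, mul_assoc, ← Finset.mul_sum, ← hx j]
    ring

lemma plR_eq (B : Fin d → J → ℝ) (hB : LinearIndependent ℝ B) (i : Fin d → J) (hi : pl B i ≠ 0) :
    plR (pl B) i = Submodule.span ℝ (Set.range B) := by
  symm
  apply Submodule.eq_of_le_of_finrank_le
  · rw [Submodule.span_le]
    rintro _ ⟨r, rfl⟩ j
    exact pl_cramer B i r j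
  · rw [finrank_span_eq_card hB, Fintype.card_fin]
    let f : plR (pl B) i →ₗ[ℝ] (Fin d → ℝ) :=
      { toFun := fun x s => x.1 (i s)
        map_add' := fun x y => rfl
        map_smul' := fun c x => rfl }
    have hf : Function.Injective f := by
      rw [← LinearMap.ker_eq_bot, LinearMap.ker_eq_bot']
      rintro ⟨x, hx⟩ h0
      ext j
      have h1 := hx j
      have h2 : ∀ s, x (i s) = 0 := fun s => congrFun h0 s
      simp only [h2, zero_mul, Finset.sum_const_zero] at h1
      simpa [hi] using h1
    simpa using LinearMap.finrank_le_finrank_of_injective hf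

def IsPl (H : Submodule ℝ (J → ℝ)) (v : (Fin d → J) → ℝ) : Prop :=
  ∃ B : Fin d → J → ℝ, LinearIndependent ℝ B ∧ Submodule.span ℝ (Set.range B) = H ∧ v = pl B

lemma IsPl.exists (H : Submodule ℝ (J → ℝ)) (h : Module.finrank ℝ H = d) :
    ∃ v : (Fin d → J) → ℝ, IsPl H v := by
  let b := Module.finBasisOfFinrankEq ℝ H h
  refine ⟨_, fun r => (b r : J → ℝ), ?_, ?_, rfl⟩
  · exact b.linearIndependent.map' H.subtype (Submodule.ker_subtype H)
  · have : Set.range (fun r => (b r : J → ℝ)) = H.subtype '' Set.range b := by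
      rw [← Set.range_comp]; rfl
    rw [this, Submodule.span_image, b.span_eq, Submodule.map_top, Submodule.range_subtype]

lemma IsPl.finrank {H : Submodule ℝ (J → ℝ)} {v : (Fin d → J) → ℝ} (h : IsPl H v) :
    Module.finrank ℝ H = d := by
  obtain ⟨B, hB, rfl, rfl⟩ := h
  rw [finrank_span_eq_card hB, Fintype.card_fin]

lemma IsPl.unique {H : Submodule ℝ (J → ℝ)} {v v' : (Fin d → J) → ℝ} (h : IsPl H v)
    (h' : IsPl H v') : ∃ c : ℝ, c ≠ 0 ∧ v' = c • v := by
  obtain ⟨B, hB, hH, rfl⟩ := h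
  obtain ⟨B', hB', hH', rfl⟩ := h'
  have : ∀ r, ∃ C : Fin d → ℝ, ∑ r', C r' • B r' = B' r := by
    intro r
    rw [← Submodule.mem_span_range_iff_exists_fun, hH, ← hH']
    exact Submodule.subset_span ⟨r, rfl⟩
  choose C hC using this
  have h1 := pl_comb (Matrix.of C) B
  simp only [Matrix.of_apply, hC] at h1
  refine ⟨_, ?_, h1⟩
  intro h0
  obtain ⟨i, hi⟩ := pl_ne B' hB'
  apply hi
  have : pl B' = _ := h1
  rw [this, h0]; simp

lemma IsPl.inj {H H' : Submodule ℝ (J → ℝ)} {v : (Fin d → J) → ℝ} {c : ℝ} (hc : c ≠ 0)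
    (h : IsPl H v) (h' : IsPl H' (c • v)) : H' = H := by
  obtain ⟨B, hB, hH, rfl⟩ := h
  obtain ⟨B', hB', hH', hv⟩ := h'
  obtain ⟨i, hi⟩ := pl_ne B hB
  have hi' : pl B' i ≠ 0 := by rw [← hv]; simp [hc, hi]
  rw [← hH, ← hH', ← plR_eq B hB i hi, ← plR_eq B' hB' i hi', ← hv]
  ext x
  change (∀ j, _) ↔ (∀ j, _)
  refine forall_congr' fun j => ?_
  simp only [Pi.smul_apply, smul_eq_mul]
  have : ∑ s, x (i s) * (c * pl B (Function.update i s j)) =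
    c * ∑ s, x (i s) * pl B (Function.update i s j) := by
    rw [Finset.mul_sum]; exact Finset.sum_congr rfl fun s _ => by ring
  rw [this, mul_assoc]
  exact mul_right_inj' hc

lemma IsPl.map {H : Submodule ℝ (J → ℝ)} {v : (Fin d → J) → ℝ} (h : IsPl H v)
    (M M' : Matrix J J ℝ) (hM : M' * M = 1) :
    IsPl (H.map (Matrix.toLin' M)) (TK (Fin d) J M *ᵥ v) := by
  obtain ⟨B, hB, rfl, rfl⟩ := h
  refine ⟨fun r => M *ᵥ B r, ?_, ?_, (pl_act M B).symm⟩
  · refine hB.map' (Matrix.toLin' M) ?_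
    rw [LinearMap.ker_eq_bot']
    intro x hx
    rw [Matrix.toLin'_apply] at hx
    have := congrArg (fun y => M' *ᵥ y) hx
    simpa [Matrix.mulVec_mulVec, hM] using this
  · rw [← Submodule.span_image, ← Set.range_comp]
    rfl

end Pl

section Act
variable {n β : Type} [Fintype n] [DecidableEq n]

abbrev EE (n : Type) := (Bool → n) → ℝ

def bact (M : Matrix n n ℝ) (H : Submodule ℝ (EE n)) : Submodule ℝ (EE n) :=
  H.map (Matrix.toLin' (TK Bool n M))

lemma bact_mul (M M' : Matrix n n ℝ) (H : Submodule ℝ (EE n)) :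
    bact (M * M') H = bact M (bact M' H) := by
  unfold bact
  rw [map_mul, Matrix.toLin'_mul, Submodule.map_comp]

lemma bact_one (H : Submodule ℝ (EE n)) : bact 1 H = H := by
  unfold bact
  rw [map_one, Matrix.toLin'_one, Submodule.map_id]

lemma mem_bact {M M' : Matrix n n ℝ} (h : M * M' = 1) (H : Submodule ℝ (EE n)) (x : EE n) :
    x ∈ bact M' H ↔ TK Bool n M *ᵥ x ∈ H := by
  have h2 : M' * M = 1 := mul_eq_one_comm.mp h
  unfold bact
  rw [Submodule.mem_map]
  constructor
  · rintro ⟨y, hy, rfl⟩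
    rw [Matrix.toLin'_apply, Matrix.mulVec_mulVec, ← map_mul, h, map_one, Matrix.one_mulVec]
    exact hy
  · intro hx
    refine ⟨_, hx, ?_⟩
    rw [Matrix.toLin'_apply, Matrix.mulVec_mulVec, ← map_mul, h2, map_one, Matrix.one_mulVec]

namespace BaseData
variable (b : BaseData n β)

def wd (s : List β) : Matrix n n ℝ := (s.map b.A).prod
def wd' (s : List β) : Matrix n n ℝ := (s.map b.A').reverse.prod

lemma wd_eq (d : ℕ) (s : List β) : (b.gd (Fin d)).wd s = b.wd s := rfl
lemma wd'_eq (d : ℕ) (s : List β) : (b.gd (Fin d)).wd' s = b.wd' s := rfl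
lemma wd_mul (s : List β) : b.wd s * b.wd' s = 1 := (b.gd (Fin 0)).wd_mul s
lemma wd'_mul (s : List β) : b.wd' s * b.wd s = 1 := (b.gd (Fin 0)).wd'_mul s
lemma wd_append (s t : List β) : b.wd (s ++ t) = b.wd s * b.wd t := by simp [wd]
lemma wd'_append (s t : List β) : b.wd' (s ++ t) = b.wd' t * b.wd' s := by simp [wd']

def Xd (d : ℕ) : Type :=
  {H : Submodule ℝ (EE n) // ∃ v : (Fin d → (Bool → n)) → ℝ, IsPl H v ∧ v ∉ (b.gd (Fin d)).F}

lemma Xd_step (d : ℕ) (m : β) (H : Submodule ℝ (EE n))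
    (h : ∃ v : (Fin d → (Bool → n)) → ℝ, IsPl H v ∧ v ∉ (b.gd (Fin d)).F) :
    ∃ v : (Fin d → (Bool → n)) → ℝ, IsPl (bact (b.A' m) H) v ∧ v ∉ (b.gd (Fin d)).F := by
  obtain ⟨v, hv, hF⟩ := h
  refine ⟨_, hv.map (TK Bool n (b.A' m)) (TK Bool n (b.A m)) (by rw [← map_mul, b.hAA, map_one]), ?_⟩
  intro h1
  apply hF
  have h2 := (b.gd (Fin d)).F_A m _ h1
  have h3 : (b.gd (Fin d)).K ((b.gd (Fin d)).A m) *ᵥ (TK (Fin d) (Bool → n) (TK Bool n (b.A' m)) *ᵥ v)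
     = v := by
    change TK (Fin d) (Bool → n) (TK Bool n (b.A m)) *ᵥ _ = _
    rw [Matrix.mulVec_mulVec, ← map_mul, ← map_mul, b.hAA, map_one, map_one, Matrix.one_mulVec]
  rwa [h3] at h2

lemma Xd_step' (d : ℕ) (m : β) (H : Submodule ℝ (EE n))
    (h : ∃ v : (Fin d → (Bool → n)) → ℝ, IsPl H v ∧ v ∉ (b.gd (Fin d)).F) :
    ∃ v : (Fin d → (Bool → n)) → ℝ, IsPl (bact (b.A m) H) v ∧ v ∉ (b.gd (Fin d)).F := by
  obtain ⟨v, hv, hF⟩ := h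
  have hA : b.A' m * b.A m = 1 := mul_eq_one_comm.mp (b.hAA m)
  refine ⟨_, hv.map (TK Bool n (b.A m)) (TK Bool n (b.A' m)) (by rw [← map_mul, hA, map_one]), ?_⟩
  intro h1
  apply hF
  have h2 := (b.gd (Fin d)).F_A' m _ h1
  have h3 : (b.gd (Fin d)).K ((b.gd (Fin d)).A' m) *ᵥ (TK (Fin d) (Bool → n) (TK Bool n (b.A m)) *ᵥ v)
     = v := by
    change TK (Fin d) (Bool → n) (TK Bool n (b.A' m)) *ᵥ _ = _
    rw [Matrix.mulVec_mulVec, ← map_mul, ← map_mul, hA, map_one, map_one, Matrix.one_mulVec]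
  rwa [h3] at h2

def sg (d : ℕ) (m : β) : Equiv.Perm (b.Xd d) where
  toFun x := ⟨bact (b.A' m) x.1, b.Xd_step d m x.1 x.2⟩
  invFun x := ⟨bact (b.A m) x.1, b.Xd_step' d m x.1 x.2⟩
  left_inv x := Subtype.ext (by
    change bact (b.A m) (bact (b.A' m) x.1) = x.1
    rw [← bact_mul, b.hAA, bact_one])
  right_inv x := Subtype.ext (by
    change bact (b.A' m) (bact (b.A m) x.1) = x.1
    rw [← bact_mul, mul_eq_one_comm.mp (b.hAA m), bact_one])

lemma permW_sg (d : ℕ) (u : List β) : ∀ x : b.Xd d,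
    (permW (b.sg d) u x).1 = bact (b.wd' u) x.1 := by
  induction u with
  | nil => intro x; simp [permW, wd', bact_one]
  | cons m s ih =>
    intro x
    have : b.wd' (m :: s) = b.wd' s * b.A' m := by simp [wd']
    rw [this, bact_mul, permW, Equiv.Perm.mul_apply, ih]
    rfl

lemma permW_sg_inv (d : ℕ) (u : List β) (x : b.Xd d) :
    ((permW (b.sg d) u)⁻¹ x).1 = bact (b.wd u) x.1 := by
  obtain ⟨y, rfl⟩ := (permW (b.sg d) u).surjective x
  have : (permW (b.sg d) u)⁻¹ (permW (b.sg d) u y) = y := (permW (b.sg d) u).symm_apply_apply y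
  rw [this, permW_sg, ← bact_mul, b.wd_mul, bact_one]

theorem collision [Nonempty n] [Fintype β] [Nonempty β] (d : ℕ) (e : ℝ) (he : 0 < e) :
    ∃ C ρ : ℝ, 0 ≤ C ∧ 0 < ρ ∧ ρ < 1 ∧ ∀ (cs : List (β → ℝ)) (_ : ∀ c ∈ cs, GW e c)
      (x : b.Xd d),
      EW cs (fun u => EW cs (fun u' => Set.indicator {u' | bact (b.wd' u') x.1 = bact (b.wd' u) x.1}
        (fun _ => (1 : ℝ)) u')) ≤ C * ρ ^ cs.length := by
  classical
  obtain ⟨T, ψ, ε, hε, hb, hs, hgap⟩ := (b.gd (Fin d)).gap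
  choose v hv hvF using fun x : b.Xd d => x.2
  obtain ⟨C, ρ, h0, h1, h2, h3⟩ := coll_bound (b.sg d) T (fun t x => ψ t (v x)) ε hε
    (fun t => (hb t).imp fun C hC x => hC _) (by
      intro x
      refine (hgap (v x) (hvF x)).trans (le_of_eq ?_)
      refine Finset.sum_congr rfl fun t _ => ?_
      congr 1
      obtain ⟨s, m, m'⟩ := t
      simp only
      set y := ((permW (b.sg d) (s ++ [m]))⁻¹ * permW (b.sg d) (s ++ [m'])) x with hy
      have hy1 : y.1 = bact (b.wd s * (b.A m * b.A' m') * b.wd' s) x.1 := by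
        rw [hy, Equiv.Perm.mul_apply, permW_sg_inv, permW_sg, ← bact_mul, wd_append, wd'_append]
        congr 1
        simp [wd, wd', mul_assoc]
      have hinv : (b.wd s * (b.A m' * b.A' m) * b.wd' s) * (b.wd s * (b.A m * b.A' m') * b.wd' s)
          = 1 := by
        have e1 := b.wd'_mul s
        have e2 : b.A' m * b.A m = 1 := mul_eq_one_comm.mp (b.hAA m)
        calc _ = b.wd s * (b.A m' * (b.A' m * (b.wd' s * b.wd s) * b.A m) * b.A' m') * b.wd' s := by
              simp only [mul_assoc]
          _ = 1 := by rw [e1, mul_one, e2, mul_one, b.hAA, mul_one, b.wd_mul]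
      have hm := (hv x).map (TK Bool n (b.wd s * (b.A m * b.A' m') * b.wd' s)) (TK Bool n _)
        (by rw [← map_mul, hinv, map_one])
      have hm2 := hv y
      rw [hy1] at hm2
      obtain ⟨c, hc, hcv⟩ := IsPl.unique hm hm2
      rw [hcv, hs _ _ _ hc]
      rfl) e he
  refine ⟨C, ρ, h0, h1, h2, fun cs hcs x => ?_⟩
  refine le_trans (le_of_eq ?_) (h3 cs hcs x)
  congr 1
  funext u
  congr 1
  funext u'
  simp only [Set.indicator, Set.mem_setOf_eq]
  congr 1
  rw [← permW_sg, ← permW_sg, eq_iff_iff]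
  exact ⟨fun h => Subtype.ext h, fun h => congrArg Subtype.val h⟩

/-- elementary tensor -/
def ten (x y : n → ℝ) : EE n := fun i => x (i false) * y (i true)

lemma dTK_ten (Z : Matrix n n ℝ) (x y : n → ℝ) :
    dTK Bool n Z *ᵥ ten x y = ten (Z *ᵥ x) y + ten x (Z *ᵥ y) := by
  have hsum : ∀ f : (Bool → n) → ℝ, ∑ j, f j = ∑ a, ∑ c, f (fun t => bif t then c else a) := by
    intro f
    rw [← Finset.sum_product', Finset.univ_product_univ]
    refine Fintype.sum_equiv ⟨fun j => (j false, j true), fun ac t => bif t then ac.2 else ac.1,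
      fun j => by funext t; cases t <;> rfl, fun ac => rfl⟩ _ _ fun j => ?_
    congr 1
    funext t; cases t <;> rfl
  have hf : ∀ j : Bool → n, Finset.univ.erase false = {true} := fun _ => by decide
  have ht : Finset.univ.erase true = {false} := by decide
  have hf : Finset.univ.erase false = {true} := by decide
  funext i
  simp only [Matrix.mulVec, dotProduct, hsum, ten, Pi.add_apply, dTK_def, Fintype.sum_bool,
    Matrix.add_apply, slot_apply, ht, hf, Finset.prod_singleton, cond_true, cond_false,
    Matrix.one_apply, add_mul, Finset.sum_add_distrib]
  rw [add_comm]
  congr 1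
  · rw [Finset.sum_mul]
    refine Finset.sum_congr rfl fun a _ => ?_
    rw [Finset.sum_eq_single (i true)]
    · simp; ring
    · intro c _ hc
      simp [Ne.symm hc]
    · simp
  · rw [Finset.sum_eq_single (i false)]
    · rw [Finset.mul_sum]
      refine Finset.sum_congr rfl fun c _ => ?_
      simp; ring
    · intro c _ hc
      simp [Ne.symm hc]
    · simp

/-- invariance from membership in F -/
lemma F_inv (d : ℕ) (H : Submodule ℝ (EE n)) (v : (Fin d → (Bool → n)) → ℝ) (hv : IsPl H v)
    (hF : v ∈ (b.gd (Fin d)).F) (s : List β) (m m' : β) :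
    ∀ x ∈ H, dTK Bool n ((b.gd (Fin d)).Zg s m m') *ᵥ x ∈ H := by
  set g := b.gd (Fin d) with hg
  -- the subspace H0 = wd'^{-1} H
  set H0 := bact (b.wd' s) H with hH0
  set v0 := g.K (b.wd' s) *ᵥ v with hv0
  have hpl0 : IsPl H0 v0 := hv.map (TK Bool n (b.wd' s)) (TK Bool n (b.wd s))
    (by rw [← map_mul, b.wd_mul, map_one])
  have hF0 : v0 ∈ g.F := g.F_wd' s v hF
  have h1 := hF0 [] m m'
  have hz : g.Zg [] m m' = diagonal (b.h m m') := by
    simp [GapData.Zg, GapData.wd, GapData.wd']; intro i; rfl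
  rw [hz] at h1
  obtain ⟨η, hη, hη'⟩ := g.hdiag (b.h m m')
  rw [hη] at h1
  have h2 : g.K (diagonal fun i => Real.exp (b.h m m' i)) *ᵥ v0 = Real.exp (g.cg m m') • v0 := by
    rw [hη']
    funext i
    have := congrFun h1 i
    simp only [Matrix.mulVec_diagonal, Pi.smul_apply, smul_eq_mul] at this ⊢
    by_cases h0 : v0 i = 0
    · simp [h0]
    · rw [mul_right_cancel₀ h0 this]
  have h3 : IsPl (bact (diagonal fun i => Real.exp (b.h m m' i)) H0)
      (g.K (diagonal fun i => Real.exp (b.h m m' i)) *ᵥ v0) :=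
    hpl0.map (TK Bool n (diagonal fun i => Real.exp (b.h m m' i)))
      (TK Bool n (diagonal fun i => Real.exp (- b.h m m' i)))
    (by rw [← map_mul, Matrix.diagonal_mul_diagonal]; simp [← Real.exp_add])
  rw [h2] at h3
  have h4 := IsPl.inj (Real.exp_ne_zero _) hpl0 h3
  have h5 : ∀ x ∈ H0, (fun i => Real.exp (∑ t, b.h m m' (i t)) * x i) ∈ H0 := by
    intro x hx
    rw [← h4]
    refine ⟨x, hx, ?_⟩
    rw [TK_diag_exp]
    funext i
    simp [Matrix.mulVec_diagonal]
  have h6 := interp_mem H0 _ h5 Real.log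
  simp only [Real.log_exp] at h6
  intro x hx
  have hx0 : TK Bool n (b.wd' s) *ᵥ x ∈ H0 := ⟨x, hx, by simp⟩
  have h7 := h6 _ hx0
  have h8 : (fun i => (∑ t, b.h m m' (i t)) * (TK Bool n (b.wd' s) *ᵥ x) i) =
      dTK Bool n (diagonal (b.h m m')) *ᵥ (TK Bool n (b.wd' s) *ᵥ x) := by
    rw [dTK_diag]
    funext i
    simp [Matrix.mulVec_diagonal]
  rw [h8, hH0, mem_bact (b.wd_mul s)] at h7
  have h9 : dTK Bool n (g.Zg s m m') = TK Bool n (b.wd s) * dTK Bool n (diagonal (b.h m m')) *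
      TK Bool n (b.wd' s) := dTK_conj _ _ _ (b.wd_mul s)
  rw [h9, mul_assoc, ← Matrix.mulVec_mulVec, ← Matrix.mulVec_mulVec]
  exact h7

lemma F_top (d : ℕ) (H : Submodule ℝ (EE n)) (v : (Fin d → (Bool → n)) → ℝ) (hv : IsPl H v)
    (hF : v ∈ (b.gd (Fin d)).F) (a : n) (ha : ten (Pi.single a 1) 1 ∈ H) : H = ⊤ := by
  set g := b.gd (Fin d) with hg
  have hinv := b.F_inv d H v hv hF
  obtain ⟨h, hinj, hsep⟩ := g.exists_sep
  have hh : ∀ x ∈ H, dTK Bool n (diagonal h) *ᵥ x ∈ H := by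
    let G : Submodule ℝ (Matrix n n ℝ) :=
      { carrier := {Z | ∀ x ∈ H, dTK Bool n Z *ᵥ x ∈ H}
        zero_mem' := by intro x hx; simp
        add_mem' := by
          intro X Y hX hY x hx
          rw [map_add, Matrix.add_mulVec]
          exact H.add_mem (hX x hx) (hY x hx)
        smul_mem' := by
          intro c X hX x hx
          rw [map_smul, Matrix.smul_mulVec]
          exact H.smul_mem c (hX x hx) }
    refine hsep G fun m m' => ?_
    have := hinv [] m m'
    have hz : g.Zg [] m m' = diagonal (b.h m m') := by
      simp [GapData.Zg, GapData.wd, GapData.wd']; intro i; rfl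
    rw [hz] at this
    exact this
  have hh2 : ∀ x ∈ H, (fun i : Bool → n => (∑ t, h (i t)) * x i) ∈ H := by
    intro x hx
    have h1 := hh x hx
    rw [dTK_diag] at h1
    convert h1 using 1
    funext i
    simp [Matrix.mulVec_diagonal]
  have haj : ∀ j, ten (Pi.single a 1) (Pi.single j 1) ∈ H := by
    intro j
    have h1 := interp_mem H _ hh2 (fun r => if r = h a + h j then 1 else 0) _ ha
    convert h1 using 1
    funext i
    simp only [ten, Fintype.sum_bool, Pi.one_apply, mul_one]
    by_cases hi : i false = a
    · rw [hi, Pi.single_eq_same, one_mul, mul_one]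
      by_cases hj : i true = j
      · rw [hj, Pi.single_eq_same, if_pos (add_comm _ _)]
      · rw [Pi.single_eq_of_ne hj, if_neg]
        intro hc
        exact hj (hinj (by linarith))
    · rw [Pi.single_eq_of_ne hi]; simp
  let B : Submodule ℝ (n → ℝ) :=
    { carrier := {x | ∀ y, ten x y ∈ H}
      zero_mem' := by
        intro y
        convert H.zero_mem using 1
        funext i; simp [ten]
      add_mem' := by
        intro x x' hx hx' y
        convert H.add_mem (hx y) (hx' y) using 1
        funext i; simp [ten, add_mul]
      smul_mem' := by
        intro c x hx y
        convert H.smul_mem c (hx y) using 1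
        funext i; simp [ten, mul_assoc] }
  have haB : Pi.single a 1 ∈ B := by
    intro y
    have : ten (Pi.single a 1) y = ∑ j, y j • ten (Pi.single a 1) (Pi.single j 1) := by
      funext i
      simp only [Finset.sum_apply, Pi.smul_apply, ten, smul_eq_mul]
      rw [Finset.sum_eq_single (i true)]
      · simp; ring
      · intro j _ hj
        rw [Pi.single_eq_of_ne (Ne.symm hj)]; simp
      · simp
    rw [this]
    exact H.sum_mem fun j _ => H.smul_mem _ (haj j)
  have hB : B = ⊥ ∨ B = ⊤ := by
    refine b.hirr B fun s m m' x hx y => ?_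
    have h1 := hinv s m m' _ (hx y)
    rw [dTK_ten] at h1
    exact (H.add_mem_iff_left (hx _)).mp h1
  rcases hB with hB | hB
  · rw [hB] at haB
    have := congrFun ((Submodule.mem_bot ℝ).mp haB) a
    simp at this
  · rw [Submodule.eq_top_iff']
    intro x
    have hb2 : ∀ x y, ten x y ∈ H := fun x => by
      have : x ∈ B := hB ▸ Submodule.mem_top
      exact this
    have : x = ∑ i : Bool → n, x i • ten (Pi.single (i false) 1) (Pi.single (i true) 1) := by
      funext i
      simp only [Finset.sum_apply, Pi.smul_apply, ten, smul_eq_mul]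
      rw [Finset.sum_eq_single i]
      · simp
      · intro j _ hj
        by_cases h1 : j false = i false
        · have h2 : j true ≠ i true := by
            intro h2
            apply hj
            funext t
            cases t
            · exact h1
            · exact h2
          rw [Pi.single_eq_of_ne (Ne.symm h2)]; simp
        · rw [Pi.single_eq_of_ne (Ne.symm h1)]; simp
      · simp
    rw [this]
    exact H.sum_mem fun i _ => H.smul_mem _ (hb2 _ _)

end BaseData
end Act

section Hit
variable {n β : Type} [Fintype n] [DecidableEq n]
namespace BaseData
variable (b : BaseData n β)

def hit (a : n) (H : Submodule ℝ (EE n)) (w : List β) : ℝ :=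
  @ite ℝ (TK Bool n (b.wd w) *ᵥ ten (Pi.single a 1) 1 ∈ H) (Classical.propDecidable _) 1 0

lemma hit_nonneg (a : n) (H : Submodule ℝ (EE n)) (w : List β) : 0 ≤ b.hit a H w := by
  unfold hit; split_ifs <;> norm_num

lemma hit_append (a : n) (H : Submodule ℝ (EE n)) (o i : List β) :
    b.hit a H (o ++ i) = b.hit a (bact (b.wd' o) H) i := by
  unfold hit
  have : TK Bool n (b.wd (o ++ i)) *ᵥ ten (Pi.single a 1) 1 ∈ H ↔
      TK Bool n (b.wd i) *ᵥ ten (Pi.single a 1) 1 ∈ bact (b.wd' o) H := by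
    rw [mem_bact (b.wd_mul o), wd_append, map_mul, Matrix.mulVec_mulVec]
  by_cases h1 : TK Bool n (b.wd (o ++ i)) *ᵥ ten (Pi.single a 1) 1 ∈ H
  · rw [if_pos h1, if_pos (this.mp h1)]
  · rw [if_neg h1, if_neg (fun h => h1 (this.mpr h))]

lemma hit_mul (a : n) (H H' : Submodule ℝ (EE n)) (w : List β) :
    b.hit a H w * b.hit a H' w = b.hit a (H ⊓ H') w := by
  unfold hit
  by_cases h1 : TK Bool n (b.wd w) *ᵥ ten (Pi.single a 1) 1 ∈ H
  · by_cases h2 : TK Bool n (b.wd w) *ᵥ ten (Pi.single a 1) 1 ∈ H'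
    · rw [if_pos h1, if_pos h2, if_pos (Submodule.mem_inf.mpr ⟨h1, h2⟩), one_mul]
    · rw [if_neg h2, if_neg (fun h => h2 (Submodule.mem_inf.mp h).2), mul_zero]
  · rw [if_neg h1, if_neg (fun h => h1 (Submodule.mem_inf.mp h).1), zero_mul]

lemma hit_le_one (a : n) (H : Submodule ℝ (EE n)) (w : List β) : b.hit a H w ≤ 1 := by
  unfold hit; split_ifs <;> norm_num

lemma bact_finrank (w : List β) (H : Submodule ℝ (EE n)) :
    Module.finrank ℝ (bact (b.wd' w) H) = Module.finrank ℝ H := by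
  apply le_antisymm
  · exact Submodule.finrank_map_le _ _
  · have h : H = bact (b.wd w) (bact (b.wd' w) H) := by
      rw [← bact_mul, b.wd_mul, bact_one]
    conv_lhs => rw [h]
    exact Submodule.finrank_map_le _ _

lemma EW_pair [Fintype β] (cs ds : List (β → ℝ)) (e : ℝ) (he : 0 ≤ e)
    (hc : ∀ c ∈ cs, GW e c) (hd : ∀ c ∈ ds, GW e c) (G : List β → List β → ℝ) :
    (EW cs (fun o => EW ds (fun i => G o i))) ^ 2 ≤
      EW cs (fun o => EW cs (fun o' => EW ds (fun i => G o i * G o' i))) := by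
  rw [EW_swap]
  refine (EW_sq ds e he hd _).trans (le_of_eq ?_)
  have : ∀ i, (EW cs (fun o => G o i)) ^ 2 = EW cs (fun o => EW cs (fun o' => G o i * G o' i)) := by
    intro i
    rw [sq, EW_mul_EW]
  simp only [this]
  rw [EW_swap]
  congr 1
  funext o
  rw [EW_swap]

theorem hitting [Nonempty n] [Fintype β] [Nonempty β] (a : n) (e : ℝ) (he : 0 < e) (d : ℕ) :
    ∃ C ρ : ℝ, 0 ≤ C ∧ 0 < ρ ∧ ρ < 1 ∧ ∀ H : Submodule ℝ (EE n), H ≠ ⊤ → Module.finrank ℝ H < d →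
      ∀ (cs : List (β → ℝ)) (_ : ∀ c ∈ cs, GW e c),
      EW cs (b.hit a H) ≤ C * ρ ^ cs.length := by
  classical
  induction d with
  | zero => exact ⟨0, 1/2, le_rfl, by norm_num, by norm_num, fun H _ h => by omega⟩
  | succ d ih =>
    obtain ⟨C', ρ', hC', hρ0', hρ1', hih⟩ := ih
    obtain ⟨C₁, ρ₁, hC₁, hρ0₁, hρ1₁, hcol⟩ := b.collision d e he
    set r := max ρ' ρ₁ with hr
    have hr0 : 0 < r := lt_max_of_lt_left hρ0'
    have hr1 : r < 1 := max_lt hρ1' hρ1₁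
    set s := r ^ ((4 : ℝ)⁻¹) with hs
    have hs0 : 0 < s := by positivity
    have hs1 : s < 1 := Real.rpow_lt_one hr0.le hr1 (by norm_num)
    have hs4 : s ^ 4 = r := by
      rw [hs, ← Real.rpow_natCast, ← Real.rpow_mul hr0.le]; norm_num
    have hrs : r ≤ s := by
      rw [← hs4]; exact pow_le_of_le_one hs0.le hs1.le (by norm_num)
    refine ⟨C' + Real.sqrt (C₁ + C') / s, s, by positivity, hs0, hs1, ?_⟩
    intro H hH hd cs hcs
    set N := cs.length with hN
    have hsqrt : 0 ≤ Real.sqrt (C₁ + C') / s := by positivity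
    rcases (Nat.lt_succ_iff.mp hd).lt_or_eq with hlt | heq
    · refine (hih H hH hlt cs hcs).trans ?_
      have : ρ' ^ N ≤ s ^ N := pow_le_pow_left₀ hρ0'.le ((le_max_left _ _).trans hrs) _
      calc C' * ρ' ^ N ≤ C' * s ^ N := by gcongr
        _ ≤ _ := by gcongr; linarith
    obtain ⟨v, hv⟩ := IsPl.exists H heq
    by_cases hF : v ∈ (b.gd (Fin d)).F
    · -- never hits
      have : ∀ w, b.hit a H w = 0 := by
        intro w
        unfold hit
        rw [if_neg]
        intro hmem
        rw [← mem_bact (b.wd_mul w)] at hmem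
        have hpl0 : IsPl (bact (b.wd' w) H) _ := hv.map (TK Bool n (b.wd' w)) (TK Bool n (b.wd w))
          (by rw [← map_mul, b.wd_mul, map_one])
        have hF0 := (b.gd (Fin d)).F_wd' w v hF
        have ht := b.F_top d _ _ hpl0 hF0 a hmem
        apply hH
        apply Submodule.eq_top_of_finrank_eq
        rw [← b.bact_finrank w H, ht, finrank_top]
      have h0 : EW cs (b.hit a H) = 0 := by
        have : b.hit a H = fun _ => 0 := funext this
        rw [this, EW_const cs e hcs]
      rw [h0]; positivity
    let x : b.Xd d := ⟨H, v, hv, hF⟩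
    set n1 := N / 2 with hn1
    have hcs1 : ∀ c ∈ cs.take n1, GW e c := fun c h => hcs c (List.mem_of_mem_take h)
    have hcs2 : ∀ c ∈ cs.drop n1, GW e c := fun c h => hcs c (List.mem_of_mem_drop h)
    have hl1 : (cs.take n1).length = n1 := by rw [List.length_take]; omega
    have hl2 : (cs.drop n1).length = N - n1 := by rw [List.length_drop]
    set P := EW cs (b.hit a H) with hP
    have hP1 : P = EW (cs.take n1) (fun o => EW (cs.drop n1)
        (fun i => b.hit a (bact (b.wd' o) H) i)) := by
      rw [hP]
      conv_lhs => rw [← List.take_append_drop n1 cs]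
      rw [EW_append]
      simp only [hit_append]
    have hP2 : P ^ 2 ≤ C₁ * ρ₁ ^ n1 + C' * ρ' ^ (N - n1) := by
      rw [hP1]
      refine (EW_pair _ _ e he.le hcs1 hcs2 _).trans ?_
      have hc := hcol (cs.take n1) hcs1 x
      rw [hl1] at hc
      calc _ ≤ EW (cs.take n1) (fun u => EW (cs.take n1) (fun u' =>
            Set.indicator {u' | bact (b.wd' u') x.1 = bact (b.wd' u) x.1}
            (fun _ => (1 : ℝ)) u' + C' * ρ' ^ (N - n1))) := by
            refine EW_mono _ e he.le hcs1 _ _ fun u _ => EW_mono _ e he.le hcs1 _ _ fun u' _ => ?_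
            simp only [hit_mul]
            by_cases hu : bact (b.wd' u') H = bact (b.wd' u) H
            · rw [Set.indicator_of_mem (by exact hu)]
              have h1 : EW (cs.drop n1) (fun i => b.hit a (bact (b.wd' u) H ⊓ bact (b.wd' u') H) i)
                  ≤ EW (cs.drop n1) (fun _ => 1) :=
                EW_mono _ e he.le hcs2 _ _ fun i _ => b.hit_le_one _ _ _
              rw [EW_const _ e hcs2] at h1
              have : 0 ≤ C' * ρ' ^ (N - n1) := by positivity
              linarith
            · rw [Set.indicator_of_notMem (by exact hu), zero_add, ← hl2]
              have hlt : Module.finrank ℝ ↥(bact (b.wd' u) H ⊓ bact (b.wd' u') H) < d := by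
                by_contra hge
                push Not at hge
                have e1 : bact (b.wd' u) H ⊓ bact (b.wd' u') H = bact (b.wd' u) H :=
                  Submodule.eq_of_le_of_finrank_le inf_le_left (by rw [bact_finrank, heq]; exact hge)
                have e2 : bact (b.wd' u) H ⊓ bact (b.wd' u') H = bact (b.wd' u') H :=
                  Submodule.eq_of_le_of_finrank_le inf_le_right (by rw [bact_finrank, heq]; exact hge)
                exact hu (e2.symm.trans e1)
              refine hih _ ?_ hlt _ hcs2
              intro ht
              rw [ht] at hlt
              have h1 : Module.finrank ℝ H ≤ Module.finrank ℝ (EE n) := Submodule.finrank_le H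
              rw [finrank_top] at hlt
              omega
        _ = EW (cs.take n1) (fun u => EW (cs.take n1) (fun u' =>
            Set.indicator {u' | bact (b.wd' u') x.1 = bact (b.wd' u) x.1}
            (fun _ => (1 : ℝ)) u')) + C' * ρ' ^ (N - n1) := by
            simp only [EW_add, EW_const _ e hcs1]
        _ ≤ _ := by linarith
    have hpow : ∀ (t : ℝ) (j : ℕ), 0 < t → t ≤ r → 2 * N ≤ 4 * j + 2 → t ^ j ≤ s ^ (2 * N) / s ^ 2 := by
      intro t j ht htr hj
      rw [le_div_iff₀ (by positivity)]
      calc t ^ j * s ^ 2 ≤ r ^ j * s ^ 2 := by gcongr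
        _ = s ^ (4 * j + 2) := by rw [← hs4]; ring
        _ ≤ s ^ (2 * N) := pow_le_pow_of_le_one hs0.le hs1.le hj
    have h1 := hpow ρ₁ n1 hρ0₁ (le_max_right _ _) (by omega)
    have h2 := hpow ρ' (N - n1) hρ0' (le_max_left _ _) (by omega)
    have h3 : P ^ 2 ≤ (Real.sqrt (C₁ + C') / s * s ^ N) ^ 2 := by
      have : (Real.sqrt (C₁ + C') / s * s ^ N) ^ 2 = (C₁ + C') * (s ^ (2 * N) / s ^ 2) := by
        rw [mul_pow, div_pow, Real.sq_sqrt (by positivity), ← pow_mul, mul_comm N 2]; ring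
      rw [this]
      calc P ^ 2 ≤ _ := hP2
        _ ≤ C₁ * (s ^ (2 * N) / s ^ 2) + C' * (s ^ (2 * N) / s ^ 2) := by gcongr
        _ = _ := by ring
    have h4 : P ≤ Real.sqrt (C₁ + C') / s * s ^ N :=
      (abs_le_of_sq_le_sq' h3 (by positivity)).2
    have h5 : 0 ≤ C' * s ^ N := by positivity
    rw [add_mul]; linarith

end BaseData
end Hit

section Paths

lemma sum_cons {α : Type} [Fintype α] (m : ℕ) (f : (Fin (m + 1) → α) → ℝ) :
    ∑ x, f x = ∑ i, ∑ y : Fin m → α, f (Fin.cons i y) := by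
  rw [← Finset.sum_product', Finset.univ_product_univ]
  exact ((Fin.consEquiv (fun _ => α)).sum_comp f).symm

lemma path_sum {n : Type} [Fintype n] [DecidableEq n] (m : ℕ) : ∀ (v u : n → ℝ) (M : Fin m → Matrix n n ℝ),
    ∑ x : Fin (m + 1) → n, v (x 0) * u (x (Fin.last m)) * ∏ j, M j (x j.castSucc) (x j.succ) =
      v ⬝ᵥ ((List.ofFn M).prod *ᵥ u) := by
  induction m with
  | zero =>
    intro v u M
    rw [sum_cons]
    simp [dotProduct]
  | succ m ih =>
    intro v u M
    rw [sum_cons, Finset.sum_comm, List.ofFn_succ, List.prod_cons, ← Matrix.mulVec_mulVec,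
      Matrix.dotProduct_mulVec, ← ih]
    refine Finset.sum_congr rfl fun y _ => ?_
    rw [Matrix.vecMul, dotProduct, Finset.sum_mul, Finset.sum_mul]
    refine Finset.sum_congr rfl fun i _ => ?_
    rw [Fin.prod_univ_succ]
    simp only [Fin.cons_zero, Fin.castSucc_zero, Fin.cons_succ, ← Fin.succ_castSucc, ← Fin.succ_last]
    ring

lemma EW_ofFn {β : Type} [Fintype β] (m : ℕ) : ∀ (c : Fin m → β → ℝ) (F : List β → ℝ),
    EW (List.ofFn c) F = ∑ w : Fin m → β, (∏ j, c j (w j)) * F (List.ofFn w) := by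
  induction m with
  | zero => intro c F; simp [EW]
  | succ m ih =>
    intro c F
    rw [List.ofFn_succ, sum_cons]
    simp only [EW, ih, Finset.mul_sum]
    refine Finset.sum_congr rfl fun i _ => Finset.sum_congr rfl fun y _ => ?_
    rw [Fin.prod_univ_succ, List.ofFn_succ]
    simp only [Fin.cons_zero, Fin.cons_succ]
    ring

end Paths

section Concrete
variable {k l : ℕ} (p : Matrix (Fin k) (Fin k) ℝ) (q : Matrix (Fin k) (Fin l) ℝ)

lemma rows_indep (hH2q : q.rank = k) : LinearIndependent ℝ (fun i => q i) := by
  rw [linearIndependent_iff_card_eq_finrank_span, Fintype.card_fin, Set.finrank]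
  have := Matrix.rank_eq_finrank_span_row q
  rw [hH2q] at this
  exact this

lemma coord_mem {n β : Type} [Fintype n] [DecidableEq n] (h : β → β → n → ℝ)
    (hsep : ∀ i j, i ≠ j → ∃ m m', h m m' i ≠ h m m' j) (B : Submodule ℝ (n → ℝ))
    (hB : ∀ m m', ∀ x ∈ B, diagonal (h m m') *ᵥ x ∈ B) (x : n → ℝ) (hx : x ∈ B) (i : n)
    (hi : x i ≠ 0) : Pi.single i 1 ∈ B := by
  have hB2 : ∀ m m', ∀ x ∈ B, (fun i => h m m' i * x i) ∈ B := by
    intro m m' x hx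
    convert hB m m' x hx using 1
    funext i
    simp [Matrix.mulVec_diagonal]
  have key : ∀ T : Finset n, i ∉ T → ∃ y ∈ B, y i ≠ 0 ∧ ∀ j ∈ T, y j = 0 := by
    intro T
    induction T using Finset.induction_on with
    | empty => exact fun _ => ⟨x, hx, hi, by simp⟩
    | insert j T hj ih =>
      intro hiT
      rw [Finset.mem_insert, not_or] at hiT
      obtain ⟨y, hy, hyi, hyT⟩ := ih hiT.2
      obtain ⟨m, m', hm⟩ := hsep i j hiT.1
      refine ⟨_, interp_mem B _ (hB2 m m') (fun r => if r = h m m' i then 1 else 0) y hy, ?_, ?_⟩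
      · simpa using hyi
      · intro t ht
        rw [Finset.mem_insert] at ht
        rcases ht with rfl | ht
        · simp [Ne.symm hm]
        · simp [hyT t ht]
  obtain ⟨y, hy, hyi, hyT⟩ := key (Finset.univ.erase i) (by simp)
  have : Pi.single i 1 = (y i)⁻¹ • y := by
    funext j
    by_cases hj : j = i
    · subst hj; simp [hyi]
    · rw [Pi.single_eq_of_ne hj, Pi.smul_apply, hyT j (by simp [hj]), smul_zero]
  rw [this]
  exact B.smul_mem _ hy

def Am (m : Fin l) : Matrix (Fin k) (Fin k) ℝ := diagonal (fun i => q i m) * p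
def Am' (m : Fin l) : Matrix (Fin k) (Fin k) ℝ := p⁻¹ * diagonal (fun i => (q i m)⁻¹)
def hm (m m' : Fin l) (i : Fin k) : ℝ := Real.log (q i m) - Real.log (q i m')

lemma Am_Am' (hH1q : ∀ i m, 0 < q i m) (hH2p : p.det ≠ 0) (m m' : Fin l) :
    Am p q m * Am' p q m' = diagonal fun i => Real.exp (hm q m m' i) := by
  unfold Am Am'
  rw [mul_assoc, ← mul_assoc p, Matrix.mul_nonsing_inv _ (isUnit_iff_ne_zero.mpr hH2p), one_mul,
    Matrix.diagonal_mul_diagonal]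
  congr 1
  funext i
  rw [hm, Real.exp_sub, Real.exp_log (hH1q i m), Real.exp_log (hH1q i m'), div_eq_mul_inv]

lemma hm_sep (hq_row : ∀ i, ∑ m, q i m = 1) (hH1q : ∀ i m, 0 < q i m) (hH2q : q.rank = k) :
    ∀ i j, i ≠ j → ∃ m m', hm q m m' i ≠ hm q m m' j := by
  intro i j hij
  by_contra! hall
  apply hij
  apply (rows_indep q hH2q).injective
  funext m
  have h1 : ∀ m', q i m * q j m' = q j m * q i m' := by
    intro m'
    have := congrArg Real.exp (hall m m')
    simp only [hm, Real.exp_sub, Real.exp_log (hH1q _ _)] at this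
    rwa [div_eq_div_iff (hH1q _ _).ne' (hH1q _ _).ne'] at this
  have h2 : ∑ m', q i m * q j m' = ∑ m', q j m * q i m' := Finset.sum_congr rfl fun m' _ => h1 m'
  rwa [← Finset.mul_sum, ← Finset.mul_sum, hq_row, hq_row, mul_one, mul_one] at h2

def bd (hl : 0 < l) (hq_row : ∀ i, ∑ m, q i m = 1) (hH1p : ∀ i j, 0 < p i j)
    (hH1q : ∀ i m, 0 < q i m) (hH2p : p.det ≠ 0) (hH2q : q.rank = k) :
    BaseData (Fin k) (Fin l) where
  A := Am p q
  A' := Am' p q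
  hAA m := by rw [Am_Am' p q hH1q hH2p]; simp [hm]
  h := hm q
  hA := Am_Am' p q hH1q hH2p
  hsep := hm_sep q hq_row hH1q hH2q
  hirr := by
    intro B hB
    rw [or_iff_not_imp_left]
    intro hne
    have hsep := hm_sep q hq_row hH1q hH2q
    have hAA : ∀ m, Am p q m * Am' p q m = 1 := fun m => by rw [Am_Am' p q hH1q hH2p]; simp [hm]
    let m0 : Fin l := ⟨0, hl⟩
    have hA'A : Am' p q m0 * Am p q m0 = 1 := mul_eq_one_comm.mp (hAA m0)
    have h0 : ∀ m m', ∀ x ∈ B, diagonal (hm q m m') *ᵥ x ∈ B := by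
      intro m m' x hx
      simpa using hB [] m m' x hx
    let B' : Submodule ℝ (Fin k → ℝ) := B.comap (Matrix.toLin' (Am p q m0))
    have h1 : ∀ m m', ∀ x ∈ B', diagonal (hm q m m') *ᵥ x ∈ B' := by
      intro m m' x hx
      have := hB [m0] m m' _ hx
      simp only [List.map_cons, List.map_nil, List.prod_cons, List.prod_nil, mul_one,
        List.reverse_cons, List.reverse_nil, List.nil_append, Matrix.toLin'_apply,
        Matrix.mulVec_mulVec] at this
      rw [mul_assoc, hA'A, mul_one, ← Matrix.mulVec_mulVec] at this
      exact this
    obtain ⟨x, hx, hx0⟩ := Submodule.exists_mem_ne_zero_of_ne_bot hne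
    have hx' : Am' p q m0 *ᵥ x ∈ B' := by
      change Am p q m0 *ᵥ (Am' p q m0 *ᵥ x) ∈ B
      rw [Matrix.mulVec_mulVec, hAA, Matrix.one_mulVec]
      exact hx
    have hx0' : ∃ i, (Am' p q m0 *ᵥ x) i ≠ 0 := by
      by_contra! hall
      apply hx0
      have : Am' p q m0 *ᵥ x = 0 := funext hall
      have h2 := congrArg (fun y => Am p q m0 *ᵥ y) this
      simpa [Matrix.mulVec_mulVec, hAA] using h2
    obtain ⟨i, hi⟩ := hx0'
    have h2 := coord_mem (hm q) hsep B' h1 _ hx' i hi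
    have h3 : Am p q m0 *ᵥ Pi.single i 1 ∈ B := h2
    have h4 : ∀ j, Pi.single j 1 ∈ B := by
      intro j
      refine coord_mem (hm q) hsep B h0 _ h3 j ?_
      simp only [Matrix.mulVec_single_one, Matrix.col_apply, Am, Matrix.diagonal_mul]
      exact (mul_pos (hH1q _ _) (hH1p _ _)).ne'
    rw [Submodule.eq_top_iff']
    intro y
    have : y = ∑ j, y j • (Pi.single j 1 : Fin k → ℝ) := by
      rw [← Finset.univ_sum_single y]
      refine Finset.sum_congr rfl fun j _ => ?_
      funext t
      by_cases ht : t = j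
      · subst ht; simp
      · simp [ht]
    rw [this]
    exact B.sum_mem fun j _ => B.smul_mem _ (h4 j)

end Concrete

lemma TK_ten {n : Type} [Fintype n] [DecidableEq n] (M : Matrix n n ℝ) (x y : n → ℝ) :
    TK Bool n M *ᵥ BaseData.ten x y = BaseData.ten (M *ᵥ x) (M *ᵥ y) := by
  funext i
  simp only [Matrix.mulVec, dotProduct, BaseData.ten, TK_apply, Fintype.prod_bool]
  rw [Finset.sum_mul_sum, ← Finset.sum_product', Finset.univ_product_univ]
  refine Fintype.sum_equiv ⟨fun j => (j false, j true), fun ac t => bif t then ac.2 else ac.1,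
      fun j => by funext t; cases t <;> rfl, fun ac => rfl⟩ _ _ fun j => ?_
  simp only [Equiv.coe_fn_mk]
  ring

section Meas
variable {k l : ℕ} (p : Matrix (Fin k) (Fin k) ℝ) (q : Matrix (Fin k) (Fin l) ℝ)

def word (z : ℤ → Fin l) (m : ℕ) : List (Fin l) := List.ofFn (fun j : Fin m => z (((j : ℕ) : ℤ) - m))

def piB (piv : Fin k → ℝ) (b : Fin l) : Fin k → ℝ := fun i => piv i * q i b

lemma prod_shift (w : List (Fin l)) :
    (w.map (fun m => p * diagonal (fun i => q i m))).prod * p = p * (w.map (Am p q)).prod := by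
  induction w with
  | nil => simp
  | cons m w ih =>
    simp only [List.map_cons, List.prod_cons, mul_assoc, ih, Am]

lemma Spath_eq (piv : Fin k → ℝ) (m : ℕ) (a : Fin k) (b : Fin l) (z : ℤ → Fin l) :
    Spath p q piv (m + 1) a b z =
      piB q piv b ⬝ᵥ (p *ᵥ (((word z m).map (Am p q)).prod *ᵥ Pi.single a 1)) := by
  have h := path_sum m (piB q piv b) (fun i => p i a)
    (fun j : Fin m => p * diagonal (fun i => q i (z (((j : ℕ) : ℤ) - m))))
  have h2 : (List.ofFn (fun j : Fin m => p * diagonal (fun i => q i (z (((j : ℕ) : ℤ) - m))))) =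
      (word z m).map (fun m => p * diagonal (fun i => q i m)) := by
    rw [word, List.map_ofFn]; rfl
  have h3 : (fun i => p i a) = p *ᵥ Pi.single a 1 := by
    funext i; simp
  rw [h2, h3, Matrix.mulVec_mulVec, prod_shift] at h
  rw [Matrix.mulVec_mulVec, ← h, Spath]
  refine Finset.sum_congr rfl fun x _ => ?_
  rw [piB]
  congr 1
  refine Finset.prod_congr rfl fun j _ => ?_
  rw [Matrix.mul_diagonal, mul_comm]

lemma Spath_sum (piv : Fin k → ℝ) (m : ℕ) (b : Fin l) (z : ℤ → Fin l) :
    ∑ a, Spath p q piv (m + 1) a b z =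
      piB q piv b ⬝ᵥ (p *ᵥ (((word z m).map (Am p q)).prod *ᵥ 1)) := by
  simp only [Spath_eq]
  rw [← dotProduct_sum]
  congr 1
  rw [← Matrix.mulVec_sum, ← Matrix.mulVec_sum]
  congr 2
  funext i
  simp [Finset.sum_apply, Pi.single_apply]

lemma Spath_pos (hk : 0 < k) (piv : Fin k → ℝ) (hpiv : ∀ i, 0 < piv i) (hH1p : ∀ i j, 0 < p i j)
    (hH1q : ∀ i m, 0 < q i m) (m : ℕ) (a : Fin k) (b : Fin l) (z : ℤ → Fin l) :
    0 < Spath p q piv (m + 1) a b z := by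
  haveI : Nonempty (Fin k) := ⟨⟨0, hk⟩⟩
  unfold Spath
  refine Finset.sum_pos (fun x _ => ?_) Finset.univ_nonempty
  refine mul_pos (mul_pos (mul_pos (hpiv _) (hH1q _ _)) (hH1p _ _)) (Finset.prod_pos fun j _ => ?_)
  exact mul_pos (hH1q _ _) (hH1p _ _)

lemma ten_dot {n : Type} [Fintype n] [DecidableEq n] (x y u v : n → ℝ) :
    BaseData.ten x y ⬝ᵥ BaseData.ten u v = (x ⬝ᵥ u) * (y ⬝ᵥ v) := by
  simp only [dotProduct, BaseData.ten]
  rw [Finset.sum_mul_sum, ← Finset.sum_product', Finset.univ_product_univ]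
  refine Fintype.sum_equiv ⟨fun j => (j false, j true), fun ac t => bif t then ac.2 else ac.1,
      fun j => by funext t; cases t <;> rfl, fun ac => rfl⟩ _ _ fun j => ?_
  simp only [Equiv.coe_fn_mk]
  ring

def Hbc (piv : Fin k → ℝ) (b c : Fin l) : Submodule ℝ (EE (Fin k)) where
  carrier := {X | (BaseData.ten (piB q piv b ᵥ* p) (piB q piv c ᵥ* p) -
    BaseData.ten (piB q piv c ᵥ* p) (piB q piv b ᵥ* p)) ⬝ᵥ X = 0}
  zero_mem' := by simp
  add_mem' := by
    intro x y hx hy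
    simp only [Set.mem_setOf_eq] at hx hy ⊢
    rw [dotProduct_add, hx, hy, add_zero]
  smul_mem' := by
    intro c x hx
    simp only [Set.mem_setOf_eq] at hx ⊢
    rw [dotProduct_smul, hx, smul_zero]

lemma Del_ne_iff (hk : 0 < k) (piv : Fin k → ℝ) (hpiv : ∀ i, 0 < piv i) (hH1p : ∀ i j, 0 < p i j)
    (hH1q : ∀ i m, 0 < q i m) (m : ℕ) (a : Fin k) (b c : Fin l) (z : ℤ → Fin l) :
    Del p q piv (m + 1) a b c z = 0 ↔ TK Bool (Fin k) ((word z m).map (Am p q)).prod *ᵥ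
      BaseData.ten (Pi.single a 1) 1 ∈ Hbc p q piv b c := by
  haveI : Nonempty (Fin k) := ⟨⟨0, hk⟩⟩
  have hD : ∀ b, 0 < ∑ a, Spath p q piv (m + 1) a b z := fun b =>
    Finset.sum_pos (fun a _ => Spath_pos p q hk piv hpiv hH1p hH1q m a b z) Finset.univ_nonempty
  rw [TK_ten]
  change _ ↔ _ ⬝ᵥ _ = (0 : ℝ)
  rw [sub_dotProduct, ten_dot, ten_dot]
  simp only [← Matrix.dotProduct_mulVec]
  rw [← Spath_eq, ← Spath_eq, ← Spath_sum, ← Spath_sum, Del, sub_eq_zero, sub_eq_zero,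
    div_eq_div_iff (hD b).ne' (hD c).ne']

lemma path_prob (hp_row : ∀ i, ∑ j, p i j = 1) (piv : Fin k → ℝ) (hs : ∑ i, piv i = 1) (m : ℕ) :
    ∑ x : Fin (m + 1) → Fin k, piv (x 0) * ∏ j : Fin m, p (x j.castSucc) (x j.succ) = 1 := by
  have h := path_sum m piv 1 (fun _ => p)
  simp only [Pi.one_apply, mul_one] at h
  rw [h]
  have h1 : p *ᵥ (1 : Fin k → ℝ) = 1 := by
    funext i; simp [Matrix.mulVec, dotProduct, hp_row]
  have h2 : ∀ m : ℕ, (p ^ m) *ᵥ (1 : Fin k → ℝ) = 1 := by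
    intro m
    induction m with
    | zero => simp
    | succ m ih => rw [pow_succ, ← Matrix.mulVec_mulVec, h1, ih]
  rw [List.ofFn_const, List.prod_replicate, h2]
  simpa [dotProduct] using hs

lemma meas_bound (hp_row : ∀ i, ∑ j, p i j = 1) (hp : ∀ i j, 0 ≤ p i j) (hq : ∀ i m, 0 ≤ q i m)
    (piv : Fin k → ℝ) (hpiv : ∀ i, 0 ≤ piv i) (hs : ∑ i, piv i = 1)
    (μ : Measure (ℤ → Fin l)) (hlaw : IsHMMLaw p q piv μ) (n : ℕ) (f : List (Fin l) → ℝ)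
    (hf : ∀ w, f w = 0 ∨ f w = 1) (K : ℝ)
    (hK : ∀ x : Fin (n + 1) → Fin k, EW (List.ofFn fun j => q (x j)) f ≤ K) :
    μ {z | f (word z (n + 1)) = 1} ≤ ENNReal.ofReal K := by
  classical
  let W := Fin (n + 1) → Fin l
  let ex : W → ℕ → Fin l := fun w t => if h : t < n + 1 then w ⟨t, h⟩ else w 0
  let cyl : W → Set (ℤ → Fin l) := fun w =>
    {z | ∀ t : ℕ, t ≤ n → z (-((n + 1 : ℕ) : ℤ) + t) = ex w t}
  let G : Finset W := Finset.univ.filter fun w => f (List.ofFn w) = 1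
  have hsub : {z | f (word z (n + 1)) = 1} ⊆ ⋃ w ∈ G, cyl w := by
    intro z hz
    rw [Set.mem_iUnion₂]
    refine ⟨fun j => z (((j : ℕ) : ℤ) - ((n + 1 : ℕ) : ℤ)), Finset.mem_filter.mpr ⟨Finset.mem_univ _, hz⟩, ?_⟩
    intro t ht
    simp only [ex]
    rw [dif_pos (by omega)]
    congr 1
  have hpos : ∀ w : W, 0 ≤ ∑ x : Fin (n + 1) → Fin k, piv (x 0) * q (x 0) (w 0) *
          ∏ j : Fin n, p (x j.castSucc) (x j.succ) * q (x j.succ) (w j.succ) := fun w =>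
    Finset.sum_nonneg fun x _ => mul_nonneg (mul_nonneg (hpiv _) (hq _ _))
      (Finset.prod_nonneg fun j _ => mul_nonneg (hp _ _) (hq _ _))
  have hcyl : ∀ w, μ (cyl w) = ENNReal.ofReal (∑ x : Fin (n + 1) → Fin k,
        piv (x 0) * q (x 0) (w 0) *
          ∏ j : Fin n, p (x j.castSucc) (x j.succ) * q (x j.succ) (w j.succ)) := by
    intro w
    simp only [cyl]
    rw [hlaw (-((n + 1 : ℕ) : ℤ)) n (ex w)]
    congr 1
    refine Finset.sum_congr rfl fun x _ => ?_
    have e0 : ex w 0 = w 0 := by simp [ex]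
    have e1 : ∀ j : Fin n, ex w (j + 1) = w j.succ := by
      intro j
      simp only [ex]
      rw [dif_pos (by omega)]
      rfl
    simp only [e0, e1]
  calc μ {z | f (word z (n + 1)) = 1} ≤ ∑ w ∈ G, μ (cyl w) :=
        (measure_mono hsub).trans (measure_biUnion_finset_le _ _)
    _ = ENNReal.ofReal (∑ w ∈ G, ∑ x : Fin (n + 1) → Fin k,
        piv (x 0) * q (x 0) (w 0) *
          ∏ j : Fin n, p (x j.castSucc) (x j.succ) * q (x j.succ) (w j.succ)) := by
        rw [ENNReal.ofReal_sum_of_nonneg fun w _ => hpos w]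
        exact Finset.sum_congr rfl fun w _ => hcyl w
    _ ≤ ENNReal.ofReal K := by
        apply ENNReal.ofReal_le_ofReal
        calc _ = ∑ x : Fin (n + 1) → Fin k, (piv (x 0) * ∏ j : Fin n, p (x j.castSucc) (x j.succ)) *
              EW (List.ofFn fun j => q (x j)) f := by
              rw [Finset.sum_comm]
              refine Finset.sum_congr rfl fun x _ => ?_
              rw [EW_ofFn, Finset.mul_sum, Finset.sum_filter]
              refine Finset.sum_congr rfl fun w _ => ?_
              rw [Fin.prod_univ_succ, Finset.prod_mul_distrib]
              rcases hf (List.ofFn w) with h | h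
              · rw [h, if_neg (by norm_num)]; ring
              · rw [h, if_pos rfl]; ring
          _ ≤ ∑ x : Fin (n + 1) → Fin k, (piv (x 0) * ∏ j : Fin n, p (x j.castSucc) (x j.succ)) * K := by
              refine Finset.sum_le_sum fun x _ => mul_le_mul_of_nonneg_left (hK x) ?_
              exact mul_nonneg (hpiv _) (Finset.prod_nonneg fun j _ => hp _ _)
          _ = K := by rw [← Finset.sum_mul, path_prob p hp_row piv hs, one_mul]

theorem ae_ne (hk : 0 < k) (hkl : k ≤ l) (hp_row : ∀ i, ∑ j, p i j = 1)
    (hq_row : ∀ i, ∑ m, q i m = 1) (hH1p : ∀ i j, 0 < p i j) (hH1q : ∀ i m, 0 < q i m)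
    (hH2p : p.det ≠ 0) (hH2q : q.rank = k)
    (piv : Fin k → ℝ) (hpiv : ∀ i, 0 < piv i) (hs : ∑ i, piv i = 1)
    (μ : Measure (ℤ → Fin l)) (hlaw : IsHMMLaw p q piv μ) (a : Fin k) (b c : Fin l)
    (hH : Hbc p q piv b c ≠ ⊤) :
    ∀ᵐ z ∂μ, ∀ᶠ n : ℕ in atTop, Del p q piv n a b c z ≠ 0 := by
  have hl : 0 < l := by omega
  haveI : Nonempty (Fin k) := ⟨⟨0, hk⟩⟩
  haveI : Nonempty (Fin l) := ⟨⟨0, hl⟩⟩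
  let B := bd p q hl hq_row hH1p hH1q hH2p hH2q
  obtain ⟨e, he, hel⟩ : ∃ e, 0 < e ∧ ∀ i m, e ≤ q i m := by
    obtain ⟨im, him⟩ := Finite.exists_min (fun im : Fin k × Fin l => q im.1 im.2)
    exact ⟨_, hH1q im.1 im.2, fun i m => him (i, m)⟩
  obtain ⟨C, ρ, hC, hρ0, hρ1, hhit⟩ := B.hitting a e he (Module.finrank ℝ (Hbc p q piv b c) + 1)
  have hbound : ∀ n : ℕ, μ {z | B.hit a (Hbc p q piv b c) (word z (n + 1)) = 1} ≤
      ENNReal.ofReal (C * ρ ^ (n + 1)) := by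
    intro n
    refine meas_bound p q hp_row (fun i j => (hH1p i j).le) (fun i j => (hH1q i j).le) piv
      (fun i => (hpiv i).le) hs μ hlaw n _ ?_ _ ?_
    · intro w
      unfold BaseData.hit
      split_ifs
      · right; rfl
      · left; rfl
    · intro x
      have := hhit _ hH (Nat.lt_succ_self _) (List.ofFn fun j => q (x j)) (by
        intro c hc
        rw [List.mem_ofFn] at hc
        obtain ⟨j, rfl⟩ := hc
        exact ⟨fun m => hel _ m, hq_row _⟩)
      simpa using this
  have hsum : ∑' n : ℕ, μ {z | B.hit a (Hbc p q piv b c) (word z (n + 1)) = 1} ≠ ⊤ := by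
    refine ne_top_of_le_ne_top ?_ (ENNReal.tsum_le_tsum hbound)
    rw [← ENNReal.ofReal_tsum_of_nonneg (fun n => by positivity)]
    · exact ENNReal.ofReal_ne_top
    · exact ((summable_nat_add_iff 1).mpr (summable_geometric_of_lt_one hρ0.le hρ1)).mul_left C
  have := ae_eventually_notMem hsum
  filter_upwards [this] with z hz
  rw [eventually_atTop] at hz ⊢
  obtain ⟨N, hN⟩ := hz
  refine ⟨N + 2, fun n hn h0 => ?_⟩
  obtain ⟨m, rfl⟩ : ∃ m, n = (m + 1) + 1 := ⟨n - 2, by omega⟩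
  apply hN m (by omega)
  rw [Del_ne_iff p q hk piv hpiv hH1p hH1q] at h0
  change B.hit _ _ _ = 1
  unfold BaseData.hit
  exact if_pos h0

lemma Hbc_ne (hk : 0 < k) (piv : Fin k → ℝ) (hpiv : ∀ i, 0 < piv i) (hH1p : ∀ i j, 0 < p i j)
    (hH1q : ∀ i m, 0 < q i m) (n : ℕ) (hn : 0 < n) (a : Fin k) (b c : Fin l) (z : ℤ → Fin l)
    (h : Del p q piv n a b c z ≠ 0) : Hbc p q piv b c ≠ ⊤ := by
  obtain ⟨m, rfl⟩ : ∃ m, n = m + 1 := ⟨n - 1, by omega⟩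
  rw [Ne, Del_ne_iff p q hk piv hpiv hH1p hH1q] at h
  intro ht
  rw [ht] at h
  exact h Submodule.mem_top

end Meas

section Det
variable {k : ℕ}

lemma abs_le_enorm2 (v : Fin k → ℝ) (i : Fin k) : |v i| ≤ enorm2 v := by
  unfold enorm2
  rw [← Real.sqrt_sq_eq_abs]
  exact Real.sqrt_le_sqrt (Finset.single_le_sum (f := fun i => v i ^ 2) (fun i _ => sq_nonneg _) (Finset.mem_univ i))

lemma enorm2_nonneg (v : Fin k → ℝ) : 0 ≤ enorm2 v := Real.sqrt_nonneg _

lemma enorm2_le_sum (v : Fin k → ℝ) : enorm2 v ≤ ∑ i, |v i| := by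
  unfold enorm2
  rw [Real.sqrt_le_left (Finset.sum_nonneg fun i _ => abs_nonneg _)]
  simp_rw [← sq_abs (v _)]
  exact Finset.sum_sq_le_sq_sum_of_nonneg (fun i _ => abs_nonneg _)

lemma sum_le_enorm2 (v : Fin k → ℝ) : ∑ i, |v i| ≤ k * enorm2 v := by
  have := Finset.sum_le_card_nsmul Finset.univ (fun i => |v i|) (enorm2 v) (fun i _ => abs_le_enorm2 v i)
  simpa using this

lemma enorm2_pos {v : Fin k → ℝ} (h : v ≠ 0) : 0 < enorm2 v := by
  obtain ⟨i, hi⟩ := Function.ne_iff.mp h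
  exact (abs_pos.mpr hi).trans_le (abs_le_enorm2 v i)

/-- coordinatewise domination of the Euclidean norm -/
lemma enorm2_le_mul {v w : Fin k → ℝ} {C : ℝ} (hC : 0 ≤ C) (h : ∀ i, |v i| ≤ C * |w i|) :
    enorm2 v ≤ C * enorm2 w := by
  unfold enorm2
  rw [Real.sqrt_le_left (by positivity), mul_pow, Real.sq_sqrt (Finset.sum_nonneg fun i _ => sq_nonneg _),
    Finset.mul_sum]
  refine Finset.sum_le_sum fun i _ => ?_
  rw [← sq_abs (v i), ← sq_abs (w i), ← mul_pow]
  exact pow_le_pow_left₀ (abs_nonneg _) (h i) 2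

/-- orbits of a cocycle of matrices -/
def Orb (T : ℕ → Matrix (Fin k) (Fin k) ℝ) (x : ℕ → Fin k → ℝ) : Prop :=
  ∀ n, x (n + 1) = T n *ᵥ x n

variable {T : ℕ → Matrix (Fin k) (Fin k) ℝ} {δ : ℝ}

lemma Orb.sub_smul {x y : ℕ → Fin k → ℝ} (hx : Orb T x) (hy : Orb T y) (α : ℝ) :
    Orb T (fun n => y n - α • x n) := by
  intro n
  change y (n + 1) - α • x (n + 1) = _
  rw [hx n, hy n, Matrix.mulVec_sub, Matrix.mulVec_smul]

lemma Orb.step_le {x y : ℕ → Fin k → ℝ} (hx : Orb T x) (hy : Orb T y) (hT0 : ∀ n i j, 0 ≤ T n i j) {n : ℕ}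
    {C : ℝ} (h : ∀ i, y n i ≤ C * x n i) : ∀ i, y (n + 1) i ≤ C * x (n + 1) i := by
  intro i
  rw [hx n, hy n]
  simp only [Matrix.mulVec, dotProduct]
  rw [Finset.mul_sum]
  refine Finset.sum_le_sum fun j _ => ?_
  calc T n i j * y n j ≤ T n i j * (C * x n j) := mul_le_mul_of_nonneg_left (h j) (hT0 n i j)
    _ = _ := by ring

lemma Orb.mono_le {x y : ℕ → Fin k → ℝ} (hx : Orb T x) (hy : Orb T y) (hT0 : ∀ n i j, 0 ≤ T n i j) {n : ℕ}
    {C : ℝ} (h : ∀ i, y n i ≤ C * x n i) (m : ℕ) (hm : n ≤ m) : ∀ i, y m i ≤ C * x m i := by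
  induction m, hm using Nat.le_induction with
  | base => exact h
  | succ m _ ih => exact hx.step_le hy hT0 ih

lemma Orb.neg {y : ℕ → Fin k → ℝ} (hy : Orb T y) : Orb T (fun n => - y n) := by
  intro n
  change - y (n + 1) = _
  rw [hy n, Matrix.mulVec_neg]

lemma Orb.pos (hδ : 0 < δ) (hT : ∀ n i j, δ ≤ T n i j)
    [Nonempty (Fin k)] {x : ℕ → Fin k → ℝ} (hx : Orb T x) (h0 : ∀ i, 0 < x 0 i) (n : ℕ) :
    ∀ i, 0 < x n i := by
  induction n with
  | zero => exact h0
  | succ n ih =>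
    intro i
    rw [hx n]
    exact Finset.sum_pos (fun j _ => mul_pos (hδ.trans_le (hT n i j)) (ih j)) Finset.univ_nonempty

lemma Orb.contr_step (hT : ∀ n i j, δ ≤ T n i j) (hT1 : ∀ n i j, T n i j ≤ 1)
    {x y : ℕ → Fin k → ℝ} (hx : Orb T x) (hy : Orb T y) {n : ℕ}
    (hpos : ∀ i, 0 < x n i) (hδ' : 0 ≤ δ) {lo : ℝ} (h : ∀ i, lo * x n i ≤ y n i) (i : Fin k) :
    (lo + δ * ((∑ j, y n j) / (∑ j, x n j) - lo)) * x (n + 1) i ≤ y (n + 1) i := by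
  haveI : Nonempty (Fin k) := ⟨i⟩
  have hU : 0 < ∑ j, x n j := Finset.sum_pos (fun j _ => hpos j) Finset.univ_nonempty
  set U := ∑ j, x n j with hUd
  have hs0 : 0 ≤ (∑ j, y n j) - lo * U := by
    rw [hUd, Finset.mul_sum, ← Finset.sum_sub_distrib]
    exact Finset.sum_nonneg fun j _ => sub_nonneg.mpr (h j)
  have h1 : δ * ((∑ j, y n j) - lo * U) ≤ y (n + 1) i - lo * x (n + 1) i := by
    rw [hx n, hy n]
    simp only [Matrix.mulVec, dotProduct]
    rw [hUd, Finset.mul_sum, ← Finset.sum_sub_distrib, Finset.mul_sum, Finset.mul_sum, ← Finset.sum_sub_distrib]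
    refine Finset.sum_le_sum fun j _ => ?_
    calc _ ≤ T n i j * (y n j - lo * x n j) := mul_le_mul_of_nonneg_right (hT n i j) (sub_nonneg.mpr (h j))
      _ = _ := by ring
  have h2 : x (n + 1) i ≤ U := by
    rw [hx n]
    simp only [Matrix.mulVec, dotProduct]
    exact Finset.sum_le_sum fun j _ => by nlinarith [hT1 n i j, hpos j]
  have h3 : ((∑ j, y n j) / U - lo) * U = (∑ j, y n j) - lo * U := by field_simp
  have h4 : 0 ≤ (∑ j, y n j) / U - lo := by
    by_contra hc
    push Not at hc
    nlinarith
  have h5 : δ * ((∑ j, y n j) / U - lo) * x (n + 1) i ≤ δ * ((∑ j, y n j) / U - lo) * U :=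
    mul_le_mul_of_nonneg_left h2 (by positivity)
  nlinarith

lemma Orb.contr (hδ : 0 < δ) (hT : ∀ n i j, δ ≤ T n i j) (hT1 : ∀ n i j, T n i j ≤ 1)
    [Nonempty (Fin k)] {x y : ℕ → Fin k → ℝ} (hx : Orb T x) (hy : Orb T y) (h0 : ∀ i, 0 < x 0 i)
    (hδ1 : δ ≤ 1) :
    ∃ α C : ℝ, 0 < C ∧ ∀ n i, |y n i - α * x n i| ≤ C * (1 - δ) ^ n * x n i := by
  have hpos := hx.pos hδ hT h0
  obtain ⟨C, hC, hCb⟩ : ∃ C : ℝ, 0 < C ∧ ∀ i, |y 0 i| ≤ C * x 0 i := by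
    refine ⟨∑ i, |y 0 i| / x 0 i + 1, by
      have := Finset.sum_nonneg (s := Finset.univ) (f := fun i => |y 0 i| / x 0 i) (fun i _ => by
        have := h0 i; positivity)
      linarith, fun i => ?_⟩
    have h1 := Finset.single_le_sum (s := Finset.univ) (f := fun i => |y 0 i| / x 0 i) (fun i _ => by
        have := h0 i; positivity) (Finset.mem_univ i)
    have h2 : |y 0 i| / x 0 i ≤ ∑ i, |y 0 i| / x 0 i + 1 := by linarith
    rwa [div_le_iff₀ (h0 i)] at h2
  let mm : ℕ → ℝ := fun n => (∑ j, y n j) / (∑ j, x n j)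
  let P : ℕ → ℝ × ℝ := fun n => Nat.rec (-C, C)
    (fun n P => (P.1 + δ * (mm n - P.1), P.2 + δ * (mm n - P.2))) n
  have hP : ∀ n, P (n + 1) = ((P n).1 + δ * (mm n - (P n).1), (P n).2 + δ * (mm n - (P n).2)) := fun n => rfl
  have hP0 : P 0 = (-C, C) := rfl
  have hlo : ∀ n i, (P n).1 * x n i ≤ y n i := by
    intro n
    induction n with
    | zero => intro i; have := abs_le.mp (hCb i); rw [hP0]; simp only; linarith [this.1]
    | succ n ih =>
      intro i
      rw [hP]
      exact hx.contr_step hT hT1 hy (hpos n) hδ.le ih i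
  have hhi : ∀ n i, y n i ≤ (P n).2 * x n i := by
    intro n
    induction n with
    | zero => intro i; have := abs_le.mp (hCb i); rw [hP0]; simp only; linarith [this.2]
    | succ n ih =>
      intro i
      have := hx.contr_step hT hT1 hy.neg (hpos n) hδ.le (lo := -(P n).2) (fun i => by
        have := ih i; simp only [Pi.neg_apply]; linarith) i
      rw [hP]
      simp only [Pi.neg_apply, Finset.sum_neg_distrib, mm, neg_div] at this ⊢
      linarith
  have hm : ∀ n, (P n).1 ≤ mm n ∧ mm n ≤ (P n).2 := by
    intro n
    have hU : 0 < ∑ j, x n j := Finset.sum_pos (fun j _ => hpos n j) Finset.univ_nonempty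
    constructor
    · rw [le_div_iff₀ hU, Finset.mul_sum]
      exact Finset.sum_le_sum fun i _ => hlo n i
    · rw [div_le_iff₀ hU, Finset.mul_sum]
      exact Finset.sum_le_sum fun i _ => hhi n i
  have hdiff : ∀ n, (P n).2 - (P n).1 = 2 * C * (1 - δ) ^ n := by
    intro n
    induction n with
    | zero => simp [P]; ring
    | succ n ih => rw [hP, pow_succ, ← mul_assoc, ← ih]; simp only; ring
  have hanti : Antitone fun n => Set.Icc (P n).1 (P n).2 := by
    refine antitone_nat_of_succ_le fun n => ?_
    apply Set.Icc_subset_Icc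
    · rw [hP]; simp only; nlinarith [hm n]
    · rw [hP]; simp only; nlinarith [hm n]
  have hα := ciSup_mem_iInter_Icc_of_antitone_Icc hanti (fun n => (hm n).1.trans (hm n).2)
  set α := ⨆ n, (P n).1 with hαd
  refine ⟨α, 2 * C, by positivity, fun n i => ?_⟩
  have hαn := Set.mem_iInter.mp hα n
  rw [← hdiff, abs_le]
  have := hpos n i
  have h1 := hlo n i
  have h2 := hhi n i
  have h3 := mul_le_mul_of_nonneg_right hαn.1 this.le
  have h4 := mul_le_mul_of_nonneg_right hαn.2 this.le
  constructor <;> linarith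

lemma Orb.harnack (hT : ∀ n i j, δ ≤ T n i j) (hT1 : ∀ n i j, T n i j ≤ 1)
    (hT0 : ∀ n i j, 0 ≤ T n i j) {x : ℕ → Fin k → ℝ} (hx : Orb T x) (hpos : ∀ n i, 0 < x n i) (n : ℕ) (i : Fin k) :
    δ * ∑ j, x (n + 1) j ≤ k * x (n + 1) i := by
  have h1 : ∀ j, x (n + 1) j ≤ ∑ l, x n l := by
    intro j
    rw [hx n]
    simp only [Matrix.mulVec, dotProduct]
    exact Finset.sum_le_sum fun l _ => by nlinarith [hT1 n j l, hpos n l]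
  have h2 : δ * ∑ l, x n l ≤ x (n + 1) i := by
    rw [hx n, Finset.mul_sum]
    simp only [Matrix.mulVec, dotProduct]
    exact Finset.sum_le_sum fun l _ => mul_le_mul_of_nonneg_right (hT n i l) (hpos n l).le
  have h3 := Finset.sum_le_card_nsmul Finset.univ (fun j => x (n+1) j) _ (fun j _ => h1 j)
  simp only [Finset.card_univ, Fintype.card_fin, nsmul_eq_mul] at h3
  rcases le_or_gt 0 δ with h | h
  · calc δ * ∑ j, x (n + 1) j ≤ δ * (k * ∑ l, x n l) := mul_le_mul_of_nonneg_left h3 h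
      _ = k * (δ * ∑ l, x n l) := by ring
      _ ≤ _ := mul_le_mul_of_nonneg_left h2 (by positivity)
  · have : 0 ≤ ∑ j, x (n + 1) j := Finset.sum_nonneg fun j _ => (hpos _ _).le
    have h5 := hpos (n + 1) i
    have : (0:ℝ) ≤ k * x (n + 1) i := by positivity
    nlinarith

lemma Orb.bdd (hT1 : ∀ n i j, T n i j ≤ 1)
    (hT0 : ∀ n i j, 0 ≤ T n i j) (hk : 0 < k) {y : ℕ → Fin k → ℝ} (hy : Orb T y) (hne : ∀ n, y n ≠ 0) :
    IsBoundedUnder (· ≤ ·) atTop (fun n : ℕ => Real.log (enorm2 (y n)) / n) := by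
  have h1 : ∀ n, ∑ i, |y n i| ≤ (k : ℝ) ^ n * ∑ i, |y 0 i| := by
    intro n
    induction n with
    | zero => simp
    | succ n ih =>
      have : ∀ i, |y (n + 1) i| ≤ ∑ j, |y n j| := by
        intro i
        rw [hy n]
        simp only [Matrix.mulVec, dotProduct]
        refine (Finset.abs_sum_le_sum_abs _ _).trans (Finset.sum_le_sum fun j _ => ?_)
        rw [abs_mul, abs_of_nonneg (hT0 n i j)]
        nlinarith [hT1 n i j, abs_nonneg (y n j)]
      have h3 := Finset.sum_le_card_nsmul Finset.univ (fun j => |y (n+1) j|) _ (fun j _ => this j)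
      simp only [Finset.card_univ, Fintype.card_fin, nsmul_eq_mul] at h3
      calc _ ≤ _ := h3
        _ ≤ (k : ℝ) * ((k : ℝ) ^ n * ∑ i, |y 0 i|) := mul_le_mul_of_nonneg_left ih (by positivity)
        _ = _ := by ring
  have hS : 0 < ∑ i, |y 0 i| := (enorm2_pos (hne 0)).trans_le (enorm2_le_sum _)
  refine ⟨Real.log k + |Real.log (∑ i, |y 0 i|)|, ?_⟩
  rw [eventually_map, eventually_atTop]
  refine ⟨1, fun n hn => ?_⟩
  have hn' : (1 : ℝ) ≤ n := by exact_mod_cast hn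
  show Real.log (enorm2 (y n)) / n ≤ Real.log k + |Real.log (∑ i, |y 0 i|)|
  rw [div_le_iff₀ (by linarith)]
  have h2 := Real.log_le_log (enorm2_pos (hne n)) ((enorm2_le_sum _).trans (h1 n))
  have hk' : (0 : ℝ) < k := by exact_mod_cast hk
  rw [Real.log_mul (by positivity) hS.ne', Real.log_pow] at h2
  have h4 := le_abs_self (Real.log (∑ i, |y 0 i|))
  have h5 := abs_nonneg (Real.log (∑ i, |y 0 i|))
  nlinarith

/-- comparison of growth rates -/
lemma growth_le {f g : ℕ → ℝ} {C a b r : ℝ} (hC : 0 < C) (hr : 0 < r) (hf : ∀ n, 0 < f n) (hg : ∀ n, 0 < g n)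
    (h : ∀ᶠ n in atTop, f n ≤ C * r ^ n * g n)
    (hfa : Tendsto (fun n : ℕ => Real.log (f n) / n) atTop (nhds a))
    (hgb : Tendsto (fun n : ℕ => Real.log (g n) / n) atTop (nhds b)) : a ≤ Real.log r + b := by
  have h1 : Tendsto (fun n : ℕ => Real.log C / n + (Real.log r + Real.log (g n) / n)) atTop
      (nhds (0 + (Real.log r + b))) :=
    (tendsto_const_div_atTop_nhds_zero_nat _).add (tendsto_const_nhds.add hgb)
  rw [zero_add] at h1
  refine le_of_tendsto_of_tendsto hfa h1 ?_
  filter_upwards [h, eventually_ge_atTop 1] with n hn h1n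
  have hn' : (1 : ℝ) ≤ n := by exact_mod_cast h1n
  have h2 := Real.log_le_log (hf n) hn
  rw [Real.log_mul (by positivity) (hg n).ne', Real.log_mul hC.ne' (by positivity), Real.log_pow] at h2
  have h3 : Real.log C / n + (Real.log r + Real.log (g n) / n) =
    (Real.log C + n * Real.log r + Real.log (g n)) / n := by field_simp; ring
  rw [h3]
  gcongr

lemma limsup_eq_of {f g h : ℕ → ℝ} {L : ℝ} (hg : Tendsto g atTop (nhds L)) (hh : Tendsto h atTop (nhds L))
    (h1 : ∀ᶠ n in atTop, f n ≤ g n) (h2 : ∃ᶠ n in atTop, h n ≤ f n) :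
    limsup f atTop = L := by
  have hb : IsBoundedUnder (· ≤ ·) atTop f := hg.isBoundedUnder_le.mono_le h1
  have hfr : ∀ ε > 0, ∃ᶠ n in atTop, L - ε ≤ f n := by
    intro ε hε
    have := hh.eventually (lt_mem_nhds (show L - ε < L by linarith))
    exact (h2.and_eventually this).mono fun n hn => hn.2.le.trans hn.1
  have hcb : IsCoboundedUnder (· ≤ ·) atTop f := IsCoboundedUnder.of_frequently_ge (hfr 1 one_pos)
  apply le_antisymm
  · refine le_of_forall_pos_le_add fun ε hε => ?_
    refine limsup_le_of_le hcb ?_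
    have := hg.eventually (gt_mem_nhds (show L < L + ε by linarith))
    filter_upwards [this, h1] with n hn hn1
    linarith
  · refine le_of_forall_pos_le_add fun ε hε => ?_
    have := le_limsup_of_frequently_le (hfr ε hε) hb
    linarith

end Det

section Low
variable {k l : ℕ} (p : Matrix (Fin k) (Fin k) ℝ) (q : Matrix (Fin k) (Fin l) ℝ)

lemma invShift_iter (n : ℕ) (z : ℤ → Fin l) (t : ℤ) : (invShift^[n] z) t = z (t - n) := by
  induction n generalizing z with
  | zero => simp
  | succ n ih =>
    rw [Function.iterate_succ_apply, ih]
    simp only [invShift]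
    congr 1
    push_cast
    ring

lemma Lmat_eq (n : ℕ) (z : ℤ → Fin l) :
    Lmat p q (invShift^[n] z) = p * diagonal (fun i => q i (z (-(n : ℤ)))) := by
  ext i j
  rw [Matrix.mul_diagonal, Lmat, Matrix.of_apply, invShift_iter, mul_comm, zero_sub]

lemma word_succ (z : ℤ → Fin l) (m : ℕ) : word z (m + 1) = z (-((m + 1 : ℕ) : ℤ)) :: word z m := by
  rw [word, List.ofFn_succ]
  congr 1
  simp only [Fin.val_succ]
  rw [word]
  congr 1
  funext j
  congr 1
  push_cast
  ring

lemma Lpow_eq (m : ℕ) (z : ℤ → Fin l) :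
    Lpow p q (m + 1) z = p * ((word z m).map (Am p q)).prod * diagonal (fun i => q i (z 0)) := by
  induction m with
  | zero => 
    rw [Lpow, Lpow, Lmat_eq]
    simp [word]
  | succ m ih =>
    rw [Lpow, ih, Lmat_eq, word_succ, List.map_cons, List.prod_cons, Am]
    simp only [mul_assoc]

/-- the normalised basis vectors -/
def va (z : ℤ → Fin l) (a : Fin k) : Fin k → ℝ := Pi.single a ((q a (z 0))⁻¹)

lemma Spath_Lpow (hH1q : ∀ i m, 0 < q i m) (piv : Fin k → ℝ) (n : ℕ) (hn : 0 < n) (a : Fin k) (b : Fin l)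
    (z : ℤ → Fin l) : Spath p q piv n a b z = piB q piv b ⬝ᵥ (Lpow p q n z *ᵥ va q z a) := by
  obtain ⟨m, rfl⟩ : ∃ m, n = m + 1 := ⟨n - 1, by omega⟩
  rw [Spath_eq, Lpow_eq, ← Matrix.mulVec_mulVec, ← Matrix.mulVec_mulVec]
  congr 3
  funext i
  rw [Matrix.mulVec_diagonal, va]
  by_cases h : i = a
  · subst h; simp [(hH1q i (z 0)).ne']
  · simp [h]

lemma Spath_Lpow_sum (hH1q : ∀ i m, 0 < q i m) (piv : Fin k → ℝ) (n : ℕ) (hn : 0 < n) (b : Fin l)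
    (z : ℤ → Fin l) : ∑ a, Spath p q piv n a b z = piB q piv b ⬝ᵥ (Lpow p q n z *ᵥ ∑ a, va q z a) := by
  simp only [Spath_Lpow p q hH1q piv n hn]
  rw [← dotProduct_sum, ← Matrix.mulVec_sum]

lemma exists_C1 (hH2q : q.rank = k) (piv : Fin k → ℝ) (hpiv : ∀ i, 0 < piv i) :
    ∃ C1 : ℝ, 0 < C1 ∧ ∀ (y : Fin k → ℝ) (D : ℝ), (∀ b, |piB q piv b ⬝ᵥ y| ≤ D) → ∀ i, |y i| ≤ C1 * D := by
  let Φ : (Fin k → ℝ) →ₗ[ℝ] (Fin l → ℝ) := Matrix.mulVecLin (Matrix.of fun b => piB q piv b)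
  have hΦ : ∀ y b, Φ y b = piB q piv b ⬝ᵥ y := fun y b => rfl
  have hinj : LinearMap.ker Φ = ⊥ := by
    rw [LinearMap.ker_eq_bot']
    intro y hy
    have hli := Fintype.linearIndependent_iff.mp (rows_indep q hH2q) (fun i => piv i * y i) (by
      funext b
      have := congrFun hy b
      rw [hΦ] at this
      rw [Finset.sum_apply]
      simp only [Pi.smul_apply, smul_eq_mul, Pi.zero_apply]
      simp only [dotProduct, piB, Pi.zero_apply] at this
      rw [← this]
      exact Finset.sum_congr rfl fun i _ => by ring)
    funext i
    exact (mul_eq_zero.mp (hli i)).resolve_left (hpiv i).ne'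
  obtain ⟨g, hg⟩ := Φ.exists_leftInverse_of_injective hinj
  have hC0 : ∀ i, 0 ≤ ∑ b, |g (Pi.single b 1) i| := fun i => Finset.sum_nonneg fun b _ => abs_nonneg _
  refine ⟨∑ i, ∑ b, |g (Pi.single b 1) i| + 1, by
    have := Finset.sum_nonneg fun i (_ : i ∈ Finset.univ) => hC0 i
    linarith, fun y D hD i => ?_⟩
  have h1 : y = ∑ b, (Φ y b) • g (Pi.single b 1) := by
    have h2 : Φ y = ∑ b, (Φ y b) • (Pi.single b (1:ℝ) : Fin l → ℝ) := by
      funext c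
      simp [Finset.sum_apply, Pi.single_apply]
    calc y = g (Φ y) := (LinearMap.congr_fun hg y).symm
      _ = _ := by
        conv_lhs => rw [h2]
        simp only [map_sum, map_smul]
  have hD0 : 0 ≤ D ∨ l = 0 := by
    rcases Nat.eq_zero_or_pos l with h | h
    · right; exact h
    · left; exact (abs_nonneg _).trans (hD ⟨0, h⟩)
  have h3 : |y i| ≤ ∑ b, |g (Pi.single b 1) i| * D := by
    conv_lhs => rw [h1]
    rw [Finset.sum_apply]
    refine (Finset.abs_sum_le_sum_abs _ _).trans (Finset.sum_le_sum fun b _ => ?_)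
    rw [Pi.smul_apply, smul_eq_mul, abs_mul, mul_comm]
    exact mul_le_mul_of_nonneg_left (hD b) (abs_nonneg _)
  rcases hD0 with hD0 | h0
  · rw [← Finset.sum_mul] at h3
    refine h3.trans (mul_le_mul_of_nonneg_right ?_ hD0)
    have := Finset.single_le_sum (f := fun i => ∑ b, |g (Pi.single b 1) i|) (fun i _ => hC0 i) (Finset.mem_univ i)
    linarith
  · exfalso
    subst h0
    have : q.rank ≤ 0 := by simpa using q.rank_le_width
    have := i.2
    omega

/-- lower bound for the spread of the ratios -/
lemma spread_lower (hl : 0 < l) (hH2q : q.rank = k) (hq1 : ∀ i m, q i m ≤ 1) (hq0 : ∀ i m, 0 < q i m)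
    (piv : Fin k → ℝ) (hpiv : ∀ i, 0 < piv i)
    (hpiv1 : ∀ i, piv i ≤ 1) {η : ℝ} (hη : 0 < η) :
    ∃ C3 : ℝ, 0 < C3 ∧ ∀ (x y : Fin k → ℝ), (∀ i, 0 < x i) → (∀ i, η * ∑ j, x j ≤ x i) →
      (∃ i, y i ≤ 0) → (∃ i, 0 ≤ y i) →
      ∃ b c, enorm2 y ≤ C3 * |piB q piv b ⬝ᵥ y / piB q piv b ⬝ᵥ x - piB q piv c ⬝ᵥ y / piB q piv c ⬝ᵥ x| * enorm2 x := by
  obtain ⟨C1, hC1, hC⟩ := exists_C1 q hH2q piv hpiv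
  refine ⟨k * (C1 + C1 / η) * k + 1, by positivity, fun x y hx hxη hn hp => ?_⟩
  haveI : Nonempty (Fin l) := ⟨⟨0, hl⟩⟩
  let r : Fin l → ℝ := fun b => piB q piv b ⬝ᵥ y / piB q piv b ⬝ᵥ x
  obtain ⟨bc, hbc⟩ := Finite.exists_max (fun bc : Fin l × Fin l => |r bc.1 - r bc.2|)
  refine ⟨bc.1, bc.2, ?_⟩
  change enorm2 y ≤ _ * |r bc.1 - r bc.2| * _
  set D := |r bc.1 - r bc.2| with hDd
  have hD0 : 0 ≤ D := abs_nonneg _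
  set S := ∑ j, x j with hS
  have hS0 : 0 ≤ S := Finset.sum_nonneg fun i _ => (hx i).le
  obtain ⟨i0, hi0⟩ := hn
  obtain ⟨i1, hi1⟩ := hp
  have hS0' : 0 < S := Finset.sum_pos (fun i _ => hx i) ⟨i0, Finset.mem_univ _⟩
  have hpx : ∀ b, 0 < piB q piv b ⬝ᵥ x := fun b =>
    Finset.sum_pos (fun i _ => mul_pos (mul_pos (hpiv i) (hq0 i b)) (hx i)) ⟨i0, Finset.mem_univ _⟩
  have hpS : ∀ b, piB q piv b ⬝ᵥ x ≤ S := fun b =>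
    Finset.sum_le_sum fun i _ => by
      have : piB q piv b i ≤ 1 := mul_le_one₀ (hpiv1 i) (hq0 i b).le (hq1 i b)
      nlinarith [hx i]
  let r0 := r bc.1
  have h1 : ∀ i, |y i - r0 * x i| ≤ C1 * (D * S) := by
    refine hC (y - r0 • x) (D * S) (fun b => ?_)
    rw [dotProduct_sub, dotProduct_smul, smul_eq_mul]
    have e : piB q piv b ⬝ᵥ y - r0 * piB q piv b ⬝ᵥ x = (r b - r0) * (piB q piv b ⬝ᵥ x) := by
      simp only [r]
      rw [sub_mul, div_mul_cancel₀ _ (hpx b).ne']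
    rw [e, abs_mul, abs_of_pos (hpx b)]
    exact mul_le_mul (hbc (b, bc.1)) (hpS b) (hpx b).le hD0
  have h2 : |r0| * η ≤ C1 * D := by
    rcases le_total 0 r0 with h | h
    · have a1 := (abs_le.mp (h1 i0)).1
      have a2 := mul_le_mul_of_nonneg_left (hxη i0) h
      rw [abs_of_nonneg h]
      have : r0 * η * S ≤ C1 * D * S := by nlinarith
      exact le_of_mul_le_mul_right this hS0'
    · have a1 := (abs_le.mp (h1 i1)).2
      have a2 := mul_le_mul_of_nonneg_left (hxη i1) (neg_nonneg.mpr h)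
      rw [abs_of_nonpos h]
      have : -r0 * η * S ≤ C1 * D * S := by nlinarith
      exact le_of_mul_le_mul_right this hS0'
  have h2' : |r0| ≤ C1 / η * D := by
    rw [div_mul_eq_mul_div, le_div_iff₀ hη]; exact h2
  have h3 : ∀ i, |y i| ≤ (C1 + C1 / η) * D * S := by
    intro i
    have hxi : x i ≤ S := Finset.single_le_sum (fun i _ => (hx i).le) (Finset.mem_univ i)
    have e : y i = (y i - r0 * x i) + r0 * x i := by ring
    rw [e]
    refine (abs_add_le _ _).trans ?_
    rw [abs_mul, abs_of_pos (hx i)]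
    have := mul_le_mul h2' hxi (hx i).le (by positivity)
    nlinarith [h1 i]
  have h4 : enorm2 y ≤ k * ((C1 + C1 / η) * D * S) := by
    refine (enorm2_le_sum y).trans ?_
    have := Finset.sum_le_card_nsmul Finset.univ (fun i => |y i|) _ (fun i _ => h3 i)
    simpa using this
  have h5 : S ≤ k * enorm2 x := by
    have := sum_le_enorm2 x
    simpa only [abs_of_pos (hx _)] using this
  calc enorm2 y ≤ k * ((C1 + C1 / η) * D * S) := h4
    _ ≤ k * ((C1 + C1 / η) * D * (k * enorm2 x)) := by gcongr
    _ = (k * (C1 + C1 / η) * k) * D * enorm2 x := by ring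
    _ ≤ _ := by
      have := enorm2_nonneg x
      gcongr
      linarith

lemma spread_upper (hq1 : ∀ i m, q i m ≤ 1) (hq0 : ∀ i m, 0 < q i m)
    (piv : Fin k → ℝ) (hpiv : ∀ i, 0 < piv i) (hk : 0 < k) (hl : 0 < l)
    (hpiv1 : ∀ i, piv i ≤ 1) :
    ∃ C3 : ℝ, 0 < C3 ∧ ∀ (x y : Fin k → ℝ), (∀ i, 0 < x i) → ∀ b c,
      |piB q piv b ⬝ᵥ y / piB q piv b ⬝ᵥ x - piB q piv c ⬝ᵥ y / piB q piv c ⬝ᵥ x| * enorm2 x ≤ C3 * enorm2 y := by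
  haveI : Nonempty (Fin k) := ⟨⟨0, hk⟩⟩
  haveI : Nonempty (Fin l) := ⟨⟨0, hl⟩⟩
  obtain ⟨e, he, hel⟩ : ∃ e, 0 < e ∧ ∀ b i, e ≤ piB q piv b i := by
    obtain ⟨im, him⟩ := Finite.exists_min (fun im : Fin l × Fin k => piB q piv im.1 im.2)
    exact ⟨_, mul_pos (hpiv _) (hq0 _ _), fun i m => him (i, m)⟩
  refine ⟨2 * (k / e), by positivity, fun x y hx b c => ?_⟩
  have hxn : 0 < enorm2 x := enorm2_pos (fun h => (hx (Classical.arbitrary _)).ne' (congrFun h _))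
  have key : ∀ b, |piB q piv b ⬝ᵥ y / piB q piv b ⬝ᵥ x| * enorm2 x ≤ k / e * enorm2 y := by
    intro b
    have h1 : e * enorm2 x ≤ piB q piv b ⬝ᵥ x := by
      calc e * enorm2 x ≤ e * ∑ i, |x i| := by gcongr; exact enorm2_le_sum x
        _ ≤ _ := by
          rw [Finset.mul_sum]
          exact Finset.sum_le_sum fun i _ => by
            rw [abs_of_pos (hx i)]
            exact mul_le_mul_of_nonneg_right (hel b i) (hx i).le
    have h2 : |piB q piv b ⬝ᵥ y| ≤ k * enorm2 y := by
      refine (Finset.abs_sum_le_sum_abs _ _).trans (le_trans (Finset.sum_le_sum fun i _ => ?_) (sum_le_enorm2 y))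
      have hb0 : 0 ≤ piB q piv b i := he.le.trans (hel b i)
      have hb1 : piB q piv b i ≤ 1 := mul_le_one₀ (hpiv1 i) (hq0 i b).le (hq1 i b)
      rw [abs_mul, abs_of_nonneg hb0]
      nlinarith [abs_nonneg (y i)]
    have h3 : 0 < piB q piv b ⬝ᵥ x := lt_of_lt_of_le (by positivity) h1
    rw [abs_div, abs_of_pos h3, div_mul_eq_mul_div, div_le_iff₀ h3]
    calc |piB q piv b ⬝ᵥ y| * enorm2 x ≤ (k * enorm2 y) * enorm2 x := by gcongr
      _ = k / e * enorm2 y * (e * enorm2 x) := by field_simp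
      _ ≤ _ := by
        have := enorm2_nonneg y
        gcongr
  calc _ ≤ (|piB q piv b ⬝ᵥ y / piB q piv b ⬝ᵥ x| + |piB q piv c ⬝ᵥ y / piB q piv c ⬝ᵥ x|) * enorm2 x :=
        mul_le_mul_of_nonneg_right (abs_sub _ _) hxn.le
    _ ≤ _ := by linarith [key b, key c]

end Low

section Final

lemma Lpow_det {k l : ℕ} (p : Matrix (Fin k) (Fin k) ℝ) (q : Matrix (Fin k) (Fin l) ℝ)
    (hH1q : ∀ i m, 0 < q i m) (hH2p : p.det ≠ 0) (z : ℤ → Fin l) (n : ℕ) : (Lpow p q n z).det ≠ 0 := by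
  induction n with
  | zero => rw [Lpow]; simp
  | succ n ih =>
    rw [Lpow, Matrix.det_mul, Lmat_eq, Matrix.det_mul, Matrix.det_diagonal]
    exact mul_ne_zero (mul_ne_zero hH2p (Finset.prod_ne_zero_iff.mpr fun i _ => (hH1q _ _).ne')) ih

theorem det_part
    (k l : ℕ) (hk : 0 < k) (hkl : k ≤ l)
    (p : Matrix (Fin k) (Fin k) ℝ) (q : Matrix (Fin k) (Fin l) ℝ)
    (hp_row : ∀ i, ∑ j, p i j = 1)
    (hq_row : ∀ i, ∑ m, q i m = 1)
    (hH1p : ∀ i j, 0 < p i j)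
    (hH1q : ∀ i m, 0 < q i m)
    (hH2p : p.det ≠ 0)
    (hH2q : q.rank = k)
    (piv : Fin k → ℝ)
    (hpiv : ∀ i, 0 < piv i)
    (hpiv_sum : ∑ i, piv i = 1)
    (lam1 lam2 : ℝ) (hlam : lam2 < lam1) (z : ℤ → Fin l)
    (V W : Submodule ℝ (Fin k → ℝ)) (hV : V ≠ ⊤)
    (hV1 : ∀ w : Fin k → ℝ, w ∉ V →
        Tendsto (fun n : ℕ => Real.log (enorm2 ((Lpow p q n z).mulVec w)) / n)
          atTop (nhds lam1))
    (hV2 : ∀ ξ : Fin k → ℝ, ξ ∈ V → ξ ≠ 0 →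
        Filter.limsup (fun n : ℕ => Real.log (enorm2 ((Lpow p q n z).mulVec ξ)) / n)
          atTop ≤ lam2)
    (hWr : Module.finrank ℝ W + 2 ≤ k)
    (hW : ∀ ξ : Fin k → ℝ, ξ ∈ V → ξ ∉ W →
        Tendsto (fun n : ℕ => Real.log (enorm2 ((Lpow p q n z).mulVec ξ)) / n)
          atTop (nhds lam2)) :
    ∃ (a : Fin k) (b c : Fin l), (∃ n : ℕ, 0 < n ∧ Del p q piv n a b c z ≠ 0) ∧
      ((∀ᶠ n : ℕ in atTop, Del p q piv n a b c z ≠ 0) → tau p q piv z a b c = lam2 - lam1) := by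
  haveI : Nonempty (Fin k) := ⟨⟨0, hk⟩⟩
  have hl : 0 < l := by omega
  haveI : Nonempty (Fin l) := ⟨⟨0, hl⟩⟩
  have hp1 : ∀ i j, p i j ≤ 1 := fun i j => by
    rw [← hp_row i]
    exact Finset.single_le_sum (fun j _ => (hH1p i j).le) (Finset.mem_univ j)
  have hq1 : ∀ i j, q i j ≤ 1 := fun i j => by
    rw [← hq_row i]
    exact Finset.single_le_sum (fun j _ => (hH1q i j).le) (Finset.mem_univ j)
  have hpiv1 : ∀ i, piv i ≤ 1 := fun i => by
    rw [← hpiv_sum]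
    exact Finset.single_le_sum (fun j _ => (hpiv j).le) (Finset.mem_univ i)
  let T : ℕ → Matrix (Fin k) (Fin k) ℝ := fun n => Lmat p q (invShift^[n] z)
  have hTe : ∀ n i j, T n i j = q j ((invShift^[n] z) 0) * p i j := fun n i j => rfl
  obtain ⟨δ, hδ, hδ2, hT⟩ : ∃ δ : ℝ, 0 < δ ∧ δ ≤ 1 / 2 ∧ ∀ n i j, δ ≤ T n i j := by
    obtain ⟨im, him⟩ := Finite.exists_min (fun im : Fin l × Fin k × Fin k => q im.2.2 im.1 * p im.2.1 im.2.2)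
    exact ⟨min (q im.2.2 im.1 * p im.2.1 im.2.2) (1 / 2),
      lt_min (mul_pos (hH1q _ _) (hH1p _ _)) (by norm_num), min_le_right _ _,
      fun n i j => (min_le_left _ _).trans (him (_, i, j))⟩
  have hT0 : ∀ n i j, 0 ≤ T n i j := fun n i j => hδ.le.trans (hT n i j)
  have hT1 : ∀ n i j, T n i j ≤ 1 := fun n i j => mul_le_one₀ (hq1 _ _) (hH1p _ _).le (hp1 _ _)
  let O : (Fin k → ℝ) → ℕ → Fin k → ℝ := fun w n => Lpow p q n z *ᵥ w
  have hO : ∀ w, Orb T (O w) := fun w n => by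
    simp only [O]
    rw [Matrix.mulVec_mulVec]
    rfl
  have hO0 : ∀ w, O w 0 = w := fun w => by simp [O, Lpow]
  have hOne : ∀ w, w ≠ 0 → ∀ n, O w n ≠ 0 := fun w hw n h =>
    hw (Matrix.eq_zero_of_mulVec_eq_zero (Lpow_det p q hH1q hH2p z n) h)
  -- the positive vector
  let u : Fin k → ℝ := ∑ a, va q z a
  have hua : ∀ i, u i = (q i (z 0))⁻¹ := fun i => by
    simp only [u, va, Finset.sum_apply, Pi.single_apply]
    simp
  have hu : ∀ i, 0 < u i := fun i => by rw [hua]; exact inv_pos.mpr (hH1q _ _)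
  have hu0 : u ≠ 0 := fun h => (hu (Classical.arbitrary _)).ne' (congrFun h _)
  have hupos : ∀ n i, 0 < O u n i := (hO u).pos hδ hT (by rw [hO0]; exact hu)
  have hun : ∀ n, 0 < enorm2 (O u n) := fun n => enorm2_pos (hOne u hu0 n)
  have hlow : ∀ (w : Fin k → ℝ) (ε : ℝ) (n0 : ℕ), 0 < ε → (∀ i, ε * O u n0 i ≤ O w n0 i) → ∀ n, n0 ≤ n →
      enorm2 (O u n) ≤ ε⁻¹ * 1 ^ n * enorm2 (O w n) := by
    intro w ε n0 hε h n hn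
    have := (hO w).mono_le (hO u) hT0 (C := ε⁻¹) (n := n0) (fun i => by
      rw [inv_mul_eq_div, le_div_iff₀ hε]; linarith [h i]) n hn
    rw [one_pow, mul_one]
    refine enorm2_le_mul (by positivity) fun i => ?_
    rw [abs_of_pos (hupos n i)]
    exact (this i).trans (mul_le_mul_of_nonneg_left (le_abs_self _) (by positivity))
  -- u does not belong to V
  have huV : u ∉ V := by
    intro huV
    obtain ⟨w, hw⟩ : ∃ w, w ∉ V := by
      by_contra hc
      push Not at hc
      exact hV (eq_top_iff.mpr fun x _ => hc x)
    have hw0 : w ≠ 0 := fun h => hw (h ▸ V.zero_mem)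
    have hlt := eventually_lt_of_limsup_lt (lt_of_le_of_lt (hV2 u huV hu0) (show lam2 < (lam1 + lam2) / 2 by linarith))
      ((hO u).bdd hT1 hT0 hk (hOne u hu0))
    obtain ⟨α, C, hC, hαC⟩ := (hO u).contr hδ hT hT1 (hO w) (by rw [hO0]; exact hu) (by linarith)
    have hb : ∀ n, enorm2 (O w n) ≤ (C + |α|) * enorm2 (O u n) := fun n => by
      refine enorm2_le_mul (by positivity) fun i => ?_
      rw [abs_of_pos (hupos n i)]
      have h1 := hαC n i
      have h2 : (1 - δ) ^ n ≤ 1 := pow_le_one₀ (by linarith) (by linarith)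
      have h3 : O w n i = (O w n i - α * O u n i) + α * O u n i := by ring
      rw [h3]
      refine (abs_add_le _ _).trans ?_
      rw [abs_mul, abs_of_pos (hupos n i)]
      have h4 : C * (1 - δ) ^ n * O u n i ≤ C * 1 * O u n i := by
        have := hupos n i
        gcongr
      linarith
    have hD : 0 < C + |α| := by positivity
    have ht : Tendsto (fun n : ℕ => Real.log (C + |α|) / n + (lam1 + lam2) / 2) atTop
        (nhds (0 + (lam1 + lam2) / 2)) :=
      (tendsto_const_div_atTop_nhds_zero_nat _).add tendsto_const_nhds
    have := le_of_tendsto_of_tendsto (hV1 w hw) ht (by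
      filter_upwards [hlt, eventually_ge_atTop 1] with n hn h1n
      have hn' : (0 : ℝ) < n := by exact_mod_cast h1n
      have h2 := Real.log_le_log (enorm2_pos (hOne w hw0 n)) (hb n)
      rw [Real.log_mul hD.ne' (hun n).ne'] at h2
      calc _ ≤ (Real.log (C + |α|) + Real.log (enorm2 (O u n))) / n := by gcongr
        _ = Real.log (C + |α|) / n + Real.log (enorm2 (O u n)) / n := add_div _ _ _
        _ ≤ _ := by
          have := hn.le
          gcongr)
    linarith
  have hug := hV1 u huV
  -- projections along u
  have hproj : ∀ v : Fin k → ℝ, ∃ α : ℝ, v - α • u ∈ V := by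
    intro v
    obtain ⟨α, C, hC, hαC⟩ := (hO u).contr hδ hT hT1 (hO v) (by rw [hO0]; exact hu) (by linarith)
    refine ⟨α, ?_⟩
    by_contra hc
    have hne : v - α • u ≠ 0 := fun h => hc (h ▸ V.zero_mem)
    have := growth_le (f := fun n => enorm2 (O (v - α • u) n)) (g := fun n => enorm2 (O u n)) hC
      (show 0 < 1 - δ by linarith) (fun n => enorm2_pos (hOne _ hne n)) hun
      (Eventually.of_forall fun n => enorm2_le_mul (mul_nonneg hC.le (pow_nonneg (by linarith) n)) fun i => by
        rw [abs_of_pos (hupos n i)]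
        have e : O (v - α • u) n i = O v n i - α * O u n i := by
          simp only [O]
          rw [Matrix.mulVec_sub, Matrix.mulVec_smul]
          rfl
        rw [e]
        exact hαC n i) (hV1 _ hc) hug
    have h2 : Real.log (1 - δ) < 0 := Real.log_neg (by linarith) (by linarith)
    linarith
  choose α hα using fun a => hproj (va q z a)
  -- a vector outside W
  obtain ⟨a, ha⟩ : ∃ a, va q z a - α a • u ∉ W := by
    by_contra hc
    push Not at hc
    have htop : W ⊔ Submodule.span ℝ {u} = ⊤ := by
      rw [eq_top_iff]
      intro w _
      have hw : w = ∑ a, (w a * q a (z 0)) • va q z a := by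
        funext i
        simp only [va, Finset.sum_apply, Pi.smul_apply, Pi.single_apply, smul_eq_mul]
        have := (hH1q i (z 0)).ne'
        simp
        field_simp
      rw [hw]
      refine Submodule.sum_mem _ fun a _ => Submodule.smul_mem _ _ ?_
      rw [← sub_add_cancel (va q z a) (α a • u)]
      exact Submodule.add_mem_sup (hc a) (Submodule.smul_mem _ _ (Submodule.mem_span_singleton_self u))
    have h1 := Submodule.finrank_add_le_finrank_add_finrank W (Submodule.span ℝ {u})
    have h2 : Module.finrank ℝ (Submodule.span ℝ {u}) ≤ 1 := by
      have := finrank_span_le_card (R := ℝ) ({u} : Set (Fin k → ℝ))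
      simpa using this
    rw [htop, finrank_top, Module.finrank_fin_fun] at h1
    omega
  set ξ := va q z a - α a • u with hξ
  have hξV : ξ ∈ V := hα a
  have hξ0 : ξ ≠ 0 := fun h => ha (h ▸ W.zero_mem)
  have hξg := hW ξ hξV ha
  have hξn : ∀ n, 0 < enorm2 (O ξ n) := fun n => enorm2_pos (hOne ξ hξ0 n)
  -- sign changes
  have hsign : ∀ w, w ≠ 0 → Tendsto (fun n : ℕ => Real.log (enorm2 (O w n)) / n) atTop (nhds lam2) →
      ∀ n, ∃ i, O w n i ≤ 0 := by
    intro w hw0 hwg n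
    by_contra hc
    push Not at hc
    obtain ⟨i0, hi0⟩ := Finite.exists_min (fun i => O w n i / O u n i)
    have hε : 0 < O w n i0 / O u n i0 := div_pos (hc i0) (hupos n i0)
    have := growth_le (r := 1) (inv_pos.mpr hε) one_pos hun (fun n => enorm2_pos (hOne w hw0 n))
      (eventually_atTop.mpr ⟨n, hlow w _ n hε (fun i => by
        have := hi0 i
        rwa [le_div_iff₀ (hupos n i)] at this)⟩) hug hwg
    rw [Real.log_one] at this
    linarith
  have hs1 := hsign ξ hξ0 hξg
  have hs2 : ∀ n, ∃ i, 0 ≤ O ξ n i := by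
    have hneg := hsign (-ξ) (neg_ne_zero.mpr hξ0) (hW _ (V.neg_mem hξV) (fun h => ha (by simpa using W.neg_mem h)))
    intro n
    obtain ⟨i, hi⟩ := hneg n
    refine ⟨i, ?_⟩
    simp only [O, Matrix.mulVec_neg, Pi.neg_apply] at hi
    simpa [O] using hi
  -- the difference in terms of ξ
  have hpx : ∀ n b, 0 < piB q piv b ⬝ᵥ O u n := fun n b =>
    Finset.sum_pos (fun i _ => mul_pos (mul_pos (hpiv i) (hH1q i b)) (hupos n i)) Finset.univ_nonempty
  have hDel : ∀ n, 0 < n → ∀ b c, Del p q piv n a b c z =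
      piB q piv b ⬝ᵥ O ξ n / piB q piv b ⬝ᵥ O u n - piB q piv c ⬝ᵥ O ξ n / piB q piv c ⬝ᵥ O u n := by
    intro n hn b c
    have key : ∀ b, Spath p q piv n a b z / (∑ a' : Fin k, Spath p q piv n a' b z) =
        piB q piv b ⬝ᵥ O ξ n / piB q piv b ⬝ᵥ O u n + α a := by
      intro b
      rw [Spath_Lpow_sum p q hH1q piv n hn, Spath_Lpow p q hH1q piv n hn]
      have e : va q z a = ξ + α a • u := by rw [hξ, sub_add_cancel]
      rw [e, Matrix.mulVec_add, Matrix.mulVec_smul, dotProduct_add, dotProduct_smul, smul_eq_mul, add_div]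
      congr 1
      exact mul_div_cancel_right₀ _ (hpx n b).ne'
    rw [Del, key, key]
    ring
  obtain ⟨C, hC, hlower⟩ := spread_lower q hl hH2q hq1 hH1q piv hpiv hpiv1 (η := δ / k) (by positivity)
  obtain ⟨C', hC', hupper⟩ := spread_upper q hq1 hH1q piv hpiv hk hl hpiv1
  have hfreq : ∃ᶠ n : ℕ in atTop, ∃ bc : Fin l × Fin l,
      enorm2 (O ξ n) ≤ C * |Del p q piv n a bc.1 bc.2 z| * enorm2 (O u n) := by
    refine Eventually.frequently ?_
    filter_upwards [eventually_ge_atTop 1] with n hn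
    obtain ⟨m, rfl⟩ : ∃ m, n = m + 1 := ⟨n - 1, by omega⟩
    obtain ⟨b, c, h⟩ := hlower (O u (m + 1)) (O ξ (m + 1)) (hupos _) (fun i => by
      have := (hO u).harnack hT hT1 hT0 hupos m i
      have hk' : (0 : ℝ) < k := by exact_mod_cast hk
      rw [div_mul_eq_mul_div, div_le_iff₀ hk']
      linarith) (hs1 _) (hs2 _)
    refine ⟨(b, c), ?_⟩
    rw [hDel _ hn]
    exact h
  obtain ⟨bc, hbc⟩ : ∃ bc : Fin l × Fin l, ∃ᶠ n : ℕ in atTop,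
      enorm2 (O ξ n) ≤ C * |Del p q piv n a bc.1 bc.2 z| * enorm2 (O u n) := by
    by_contra hc
    rw [not_exists] at hc
    have := eventually_all.mpr fun bc => not_frequently.mp (hc bc)
    obtain ⟨n, ⟨bc, h1⟩, h2⟩ := (hfreq.and_eventually this).exists
    exact h2 bc h1
  have hbc1 := hbc.and_eventually (eventually_ge_atTop 1)
  refine ⟨a, bc.1, bc.2, ?_, fun hne => ?_⟩
  · obtain ⟨n, h1, h2⟩ := hbc1.exists
    refine ⟨n, h2, fun h0 => ?_⟩
    rw [h0, abs_zero, mul_zero, zero_mul] at h1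
    exact absurd h1 (not_le.mpr (hξn n))
  · have hlim : ∀ K : ℝ, Tendsto (fun n : ℕ => Real.log K / n + (Real.log (enorm2 (O ξ n)) / n -
        Real.log (enorm2 (O u n)) / n)) atTop (nhds (lam2 - lam1)) := by
      intro K
      have := (tendsto_const_div_atTop_nhds_zero_nat (Real.log K)).add (hξg.sub hug)
      simpa using this
    unfold tau
    have hform : ∀ K : ℝ, ∀ n : ℕ, 0 < K → Real.log K / n + (Real.log (enorm2 (O ξ n)) / n -
        Real.log (enorm2 (O u n)) / n) = Real.log (K * enorm2 (O ξ n) / enorm2 (O u n)) / n := by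
      intro K n hK
      have h1 := hξn n
      have h2 := hun n
      rw [Real.log_div (by positivity) h2.ne', Real.log_mul hK.ne' h1.ne']
      ring
    refine limsup_eq_of (hlim C') (hlim C⁻¹) ?_ ?_
    · filter_upwards [hne, eventually_ge_atTop 1] with n hn h1n
      rw [hform C' n hC']
      have := hupper (O u n) (O ξ n) (hupos n) bc.1 bc.2
      rw [← hDel n h1n, ← le_div_iff₀ (hun n)] at this
      have h2 := Real.log_le_log (abs_pos.mpr hn) this
      gcongr
    · refine hbc1.mono fun n hn => ?_
      rw [hform _ n (inv_pos.mpr hC)]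
      have h1 := hξn n
      have h2 := hun n
      have h3 : C⁻¹ * enorm2 (O ξ n) / enorm2 (O u n) ≤ |Del p q piv n a bc.1 bc.2 z| := by
        rw [div_le_iff₀ h2, inv_mul_le_iff₀ hC]
        linarith [hn.1]
      have h4 := Real.log_le_log (by positivity) h3
      gcongr

end Final

/-- **Theorem 2 (lower bound).** Under (H1), (H2), the Oseledec hypothesis and the
second-space hypothesis, for `μ`-almost every `z` there exist `a ∈ A` and `b, c ∈ B`
with `τ_z(a,b,c) = λ₂ - λ₁`. -/
theorem loss_of_memory_lower_bound
    (k l : ℕ) (hk : 0 < k) (hkl : k ≤ l)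
    (p : Matrix (Fin k) (Fin k) ℝ) (q : Matrix (Fin k) (Fin l) ℝ)
    (hp_row : ∀ i, ∑ j, p i j = 1)
    (hq_row : ∀ i, ∑ m, q i m = 1)
    -- Hypothesis (H1)
    (hH1p : ∀ i j, 0 < p i j)
    (hH1q : ∀ i m, 0 < q i m)
    -- Hypothesis (H2)
    (hH2p : p.det ≠ 0)
    (hH2q : q.rank = k)
    -- invariant probability vector
    (piv : Fin k → ℝ)
    (hpiv_nonneg : ∀ i, 0 ≤ piv i)
    (hpiv_sum : ∑ i, piv i = 1)
    (hpiv_inv : ∀ j, ∑ i, piv i * p i j = piv j)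
    -- the hidden Markov measure
    (μ : Measure (ℤ → Fin l)) [IsProbabilityMeasure μ]
    (herg : Ergodic shift μ)
    (hlaw : IsHMMLaw p q piv μ)
    -- Oseledec hypothesis
    (lam1 lam2 : ℝ) (hlam : lam2 < lam1)
    (V : (ℤ → Fin l) → Submodule ℝ (Fin k → ℝ))
    (hosel : ∀ᵐ z ∂μ,
      V z ≠ ⊤ ∧
      (∀ v ∈ V z, (Lmat p q z).mulVec v ∈ V (invShift z)) ∧
      (∀ w : Fin k → ℝ, w ∉ V z →
        Tendsto (fun n : ℕ => Real.log (enorm2 ((Lpow p q n z).mulVec w)) / n)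
          atTop (nhds lam1)) ∧
      (∀ ξ : Fin k → ℝ, ξ ∈ V z → ξ ≠ 0 →
        Filter.limsup (fun n : ℕ => Real.log (enorm2 ((Lpow p q n z).mulVec ξ)) / n)
          atTop ≤ lam2))
    -- Second-space hypothesis
    (W : (ℤ → Fin l) → Submodule ℝ (Fin k → ℝ))
    (hsecond : ∀ᵐ z ∂μ,
      W z ≤ V z ∧
      Module.finrank ℝ (W z) + 2 ≤ k ∧
      (∀ v ∈ W z, (Lmat p q z).mulVec v ∈ W (invShift z)) ∧
      (∀ ξ : Fin k → ℝ, ξ ∈ V z → ξ ∉ W z →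
        Tendsto (fun n : ℕ => Real.log (enorm2 ((Lpow p q n z).mulVec ξ)) / n)
          atTop (nhds lam2))) :
    ∀ᵐ z ∂μ, ∃ (a : Fin k) (b c : Fin l), tau p q piv z a b c = lam2 - lam1 := by
  have hpiv : ∀ i, 0 < piv i := by
    intro j
    rw [← hpiv_inv j]
    obtain ⟨i, hi⟩ : ∃ i, 0 < piv i := by
      by_contra hc
      push Not at hc
      have h0 : ∑ i, piv i ≤ 0 := Finset.sum_nonpos fun i _ => hc i
      linarith
    exact Finset.sum_pos' (fun i _ => mul_nonneg (hpiv_nonneg i) (hH1p i j).le)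
      ⟨i, Finset.mem_univ i, mul_pos hi (hH1p i j)⟩
  have hae : ∀ᵐ z ∂μ, ∀ (a : Fin k) (b c : Fin l), Hbc p q piv b c ≠ ⊤ →
      ∀ᶠ n : ℕ in atTop, Del p q piv n a b c z ≠ 0 := by
    rw [ae_all_iff]; intro a
    rw [ae_all_iff]; intro b
    rw [ae_all_iff]; intro c
    by_cases hH : Hbc p q piv b c = ⊤
    · exact Eventually.of_forall fun z h => absurd hH h
    · filter_upwards [ae_ne p q hk hkl hp_row hq_row hH1p hH1q hH2p hH2q piv hpiv hpiv_sum μ hlaw a b c hH]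
        with z hz _
      exact hz
  filter_upwards [hosel, hsecond, hae] with z h1 h2 h3
  obtain ⟨a, b, c, ⟨n, hn, hD⟩, ht⟩ := det_part k l hk hkl p q hp_row hq_row hH1p hH1q hH2p hH2q piv hpiv
    hpiv_sum lam1 lam2 hlam z (V z) (W z) h1.1 h1.2.2.1 h1.2.2.2 h2.2.1 h2.2.2.2
  exact ⟨a, b, c, ht (h3 a b c (Hbc_ne p q hk piv hpiv hH1p hH1q n hn a b c z hD))⟩

end
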